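/- arXiv:2008.00050 — 3 statements merged into one kernel-verified Lean document; each statement's English description precedes it below -/
import Mathlib

section
/- Let ω > 1 be a quadratic irrational. Then the conjugate ω* lies in the interval (−1,1) (i.e., ω is E-reduced) if and only if ω is a periodic point of the ECF Gauss shift, i.e., there exists n ≥ 1 with T_E^n(ω) = ω. -/
noncomputable section

/-- `ω'` is the conjugate of the quadratic irrational `ω`: both are roots of the
minimal integer polynomial `A X^2 + B X + C` of `ω` (with `A > 0`, `gcd(A,B,C) = 1`),
and `ω' ≠ ω`. -/
def IsConjPair (ω ω' : ℝ) : Prop :=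
  Irrational ω ∧ ∃ A B C : ℤ, 0 < A ∧ Int.gcd (Int.gcd A B : ℤ) C = 1 ∧
    (A : ℝ) * ω ^ 2 + B * ω + C = 0 ∧ (A : ℝ) * ω' ^ 2 + B * ω' + C = 0 ∧ ω' ≠ ω

/-- The quadratic irrational `ω` has discriminant `Δ = B^2 - 4AC`, where
`A X^2 + B X + C` is its minimal integer polynomial (`A > 0`, `gcd(A,B,C) = 1`). -/
def HasDisc (ω : ℝ) (Δ : ℤ) : Prop :=
  Irrational ω ∧ ∃ A B C : ℤ, 0 < A ∧ Int.gcd (Int.gcd A B : ℤ) C = 1 ∧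
    (A : ℝ) * ω ^ 2 + B * ω + C = 0 ∧ Δ = B ^ 2 - 4 * A * C

/-- First ECF digit: `a₁(u) = 2⎣(u+1)/2⎦`. -/
def aE (u : ℝ) : ℤ := 2 * ⌊(u + 1) / 2⌋

/-- Sign digit: `e₁(u) = sgn (u - a₁(u)) ∈ {±1}`. -/
def eE (u : ℝ) : ℤ := if (aE u : ℝ) < u then 1 else -1

/-- The ECF Gauss shift `T_E(u) = e₁(u) / (u - a₁(u))`. -/
def TE (u : ℝ) : ℝ := (eE u : ℝ) / (u - aE u)


/-- The two-dimensional extension of the shift. -/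
def FE (p : ℝ × ℝ) : ℝ × ℝ :=
  ((eE p.1 : ℝ) / (p.1 - aE p.1), (eE p.1 : ℝ) / (p.2 - aE p.1))

/-- Pairs of conjugates with discriminant `D`. -/
def PD (D : ℤ) (p : ℝ × ℝ) : Prop :=
  Irrational p.1 ∧ 1 < p.1 ∧ ∃ A B C : ℤ, A ≠ 0 ∧ (B : ℝ) = -A * (p.1 + p.2) ∧
    (C : ℝ) = A * (p.1 * p.2) ∧ D = B ^ 2 - 4 * A * C

theorem eE_cases (u : ℝ) : (eE u = 1) ∨ (eE u = -1) := by
  unfold eE; split_ifs <;> simp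

theorem digit_facts (u : ℝ) (hu : Irrational u) (h1 : 1 < u) :
    (2 : ℝ) ≤ aE u ∧ 0 < (eE u : ℝ) * (u - aE u) ∧ (eE u : ℝ) * (u - aE u) < 1 := by
  have ha : (aE u : ℝ) = 2 * (⌊(u + 1) / 2⌋ : ℝ) := by unfold aE; push_cast; ring
  have hl := Int.floor_le ((u + 1) / 2)
  have hr := Int.lt_floor_add_one ((u + 1) / 2)
  have hm : (1 : ℤ) ≤ ⌊(u + 1) / 2⌋ := by
    rw [Int.le_floor]; push_cast; linarith
  have hm' : (1 : ℝ) ≤ (⌊(u + 1) / 2⌋ : ℝ) := by exact_mod_cast hm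
  have hne : u ≠ ((aE u : ℤ) : ℝ) := hu.ne_int _
  have hne2 : u ≠ ((aE u - 1 : ℤ) : ℝ) := hu.ne_int _
  push_cast at hne2
  refine ⟨by linarith, ?_⟩
  unfold eE
  split_ifs with h
  · push_cast
    constructor <;> linarith
  · have h2 : u < aE u := lt_of_le_of_ne (not_lt.mp h) hne
    have h3 : (aE u : ℝ) - 1 < u := lt_of_le_of_ne (by linarith) (Ne.symm hne2)
    push_cast
    constructor <;> linarith

theorem eE_sq (u : ℝ) : (eE u : ℝ) * eE u = 1 := by
  rcases eE_cases u with h | h <;> simp [h]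

theorem TE_gt (u : ℝ) (hu : Irrational u) (h1 : 1 < u) : 1 < TE u := by
  obtain ⟨_, h2, h3⟩ := digit_facts u hu h1
  have : TE u = 1 / ((eE u : ℝ) * (u - aE u)) := by
    unfold TE
    rcases eE_cases u with h | h <;> simp [h]
    rw [← neg_sub, neg_div_neg_eq, one_div]
  rw [this, lt_div_iff₀ h2]
  linarith

theorem TE_irr (u : ℝ) (hu : Irrational u) : Irrational (TE u) := by
  have h : Irrational (u - aE u)⁻¹ := (hu.sub_intCast _).inv
  unfold TE
  rcases eE_cases u with h' | h'
  · simpa [h'] using h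
  · rw [h', div_eq_mul_inv]; simpa using h.neg

theorem snd_irr {D : ℤ} {p : ℝ × ℝ} (h : PD D p) : Irrational p.2 := by
  obtain ⟨h1, _, A, B, C, hA, hB, hC, _⟩ := h
  have hA' : (A : ℝ) ≠ 0 := by exact_mod_cast hA
  have : p.2 = ((-(B : ℚ) / A : ℚ) : ℝ) - p.1 := by
    push_cast; rw [hB]; field_simp; ring
  rw [this]
  exact h1.ratCast_sub _

theorem PD_F {D : ℤ} {p : ℝ × ℝ} (h : PD D p) : PD D (FE p) := by
  have hs := snd_irr h
  obtain ⟨h1, h2, A, B, C, hA, hB, hC, hD⟩ := h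
  refine ⟨TE_irr _ h1, TE_gt _ h1 h2, ?_⟩
  have hA' : (A : ℝ) ≠ 0 := by exact_mod_cast hA
  have n1 : p.1 - aE p.1 ≠ 0 := sub_ne_zero.2 (h1.ne_int _)
  have n2 : p.2 - aE p.1 ≠ 0 := sub_ne_zero.2 (hs.ne_int _)
  have he := eE_sq p.1
  have hei : eE p.1 * eE p.1 = 1 := by exact_mod_cast he
  have key : ((A * aE p.1 ^ 2 + B * aE p.1 + C : ℤ) : ℝ)
      = A * ((p.1 - aE p.1) * (p.2 - aE p.1)) := by
    push_cast; rw [hB, hC]; ring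
  refine ⟨A * aE p.1 ^ 2 + B * aE p.1 + C, eE p.1 * (2 * A * aE p.1 + B), A, ?_, ?_, ?_, ?_⟩
  · intro h0
    rw [h0] at key
    have := mul_ne_zero hA' (mul_ne_zero n1 n2)
    apply this; rw [← key]; simp
  · rw [key]; unfold FE; push_cast; rw [hB]; field_simp; ring
  · rw [key]; unfold FE
    simp only
    field_simp
    rw [pow_two, he]
  · rw [hD]
    linear_combination (-(2 * A * aE p.1 + B) ^ 2) * hei

theorem PD_iter {D : ℤ} {p : ℝ × ℝ} (h : PD D p) (n : ℕ) : PD D (FE^[n] p) := by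
  induction n with
  | zero => exact h
  | succ k ih => rw [Function.iterate_succ_apply']; exact PD_F ih

theorem fst_iter (p : ℝ × ℝ) (n : ℕ) : (FE^[n] p).1 = TE^[n] p.1 := by
  induction n with
  | zero => rfl
  | succ k ih => rw [Function.iterate_succ_apply', Function.iterate_succ_apply', ← ih]; rfl

theorem conj_unique {D E : ℤ} {p q : ℝ × ℝ} (hp : PD D p) (hq : PD E q) (h : p.1 = q.1) :
    p = q := by
  obtain ⟨h1, _, A, B, C, hA, hB, hC, _⟩ := hp
  obtain ⟨_, _, A', B', C', hA', hB', hC', _⟩ := hq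
  have a1 : (A : ℝ) ≠ 0 := by exact_mod_cast hA
  have a2 : (A' : ℝ) ≠ 0 := by exact_mod_cast hA'
  rw [← h] at hB' hC'
  have lin : ((B * A' - B' * A : ℤ) : ℝ) * p.1 + ((C * A' - C' * A : ℤ) : ℝ) = 0 := by
    push_cast; rw [hB, hC, hB', hC']; ring
  have z : B * A' - B' * A = 0 := by
    by_contra hz
    have hz' : ((B * A' - B' * A : ℤ) : ℝ) ≠ 0 := by exact_mod_cast hz
    apply h1
    refine ⟨(-(C * A' - C' * A : ℤ) : ℚ) / (B * A' - B' * A : ℤ), ?_⟩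
    rw [Rat.cast_div, Rat.cast_neg, Rat.cast_intCast, Rat.cast_intCast, div_eq_iff hz']
    linarith
  have z' : (B : ℝ) * A' - B' * A = 0 := by exact_mod_cast z
  rw [hB, hB'] at z'
  have : (A : ℝ) * A' * (q.2 - p.2) = 0 := by linear_combination z'
  have h3 : q.2 - p.2 = 0 := by
    rcases mul_eq_zero.1 this with h | h
    · exact absurd h (mul_ne_zero a1 a2)
    · exact h
  exact Prod.ext h (by linarith)

theorem red_F {p : ℝ × ℝ} (h1 : Irrational p.1) (h2 : 1 < p.1) (h : |p.2| < 1) :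
    |(FE p).2| < 1 := by
  obtain ⟨ha, _, _⟩ := digit_facts _ h1 h2
  have hp := abs_lt.1 h
  unfold FE
  simp only
  rw [abs_div]
  have : |(eE p.1 : ℝ)| = 1 := by rcases eE_cases p.1 with h | h <;> simp [h]
  have hb : 1 < |p.2 - aE p.1| := by rw [lt_abs]; right; linarith
  rw [this, div_lt_one (by linarith)]
  exact hb

theorem FE_inj {p q : ℝ × ℝ} (hp1 : Irrational p.1) (hp2 : 1 < p.1) (hp : |p.2| < 1)
    (hq1 : Irrational q.1) (hq2 : 1 < q.1) (hq : |q.2| < 1) (h : FE p = FE q) : p = q := by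
  obtain ⟨ha, _, _⟩ := digit_facts _ hp1 hp2
  obtain ⟨hb, _, _⟩ := digit_facts _ hq1 hq2
  have hp' := abs_lt.1 hp
  have hq' := abs_lt.1 hq
  unfold FE at h
  rw [Prod.mk.injEq] at h
  obtain ⟨e1, e2⟩ := h
  have n1 : p.1 - aE p.1 ≠ 0 := sub_ne_zero.2 (hp1.ne_int _)
  have n2 : q.1 - aE q.1 ≠ 0 := sub_ne_zero.2 (hq1.ne_int _)
  have m1 : p.2 - aE p.1 < 0 := by linarith
  have m2 : q.2 - aE q.1 < 0 := by linarith
  rw [div_eq_div_iff n1 n2] at e1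
  rw [div_eq_div_iff m1.ne m2.ne] at e2
  have hee : eE p.1 = eE q.1 := by
    rcases eE_cases p.1 with h | h <;> rcases eE_cases q.1 with h' | h' <;>
      rw [h, h'] at e2 ⊢ <;> push_cast at e2 <;> linarith
  have hne : (eE q.1 : ℝ) ≠ 0 := by
    intro h; have := eE_sq q.1; rw [h] at this; simp at this
  rw [hee] at e1 e2
  have f1 := mul_left_cancel₀ hne e1
  have f2 := mul_left_cancel₀ hne e2
  have haa : aE p.1 = aE q.1 := by
    have l1 : (aE p.1 : ℝ) - aE q.1 < 2 := by linarith
    have l2 : (aE q.1 : ℝ) - aE p.1 < 2 := by linarith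
    have l1' : aE p.1 - aE q.1 < 2 := by exact_mod_cast l1
    have l2' : aE q.1 - aE p.1 < 2 := by exact_mod_cast l2
    unfold aE at *
    omega
  rw [haa] at f1 f2
  exact Prod.ext (by linarith) (by linarith)

theorem quad_fin (A B C : ℤ) (hA : A ≠ 0) :
    {x : ℝ | (A : ℝ) * x ^ 2 + B * x + C = 0}.Finite := by
  have hA' : (A : ℝ) ≠ 0 := by exact_mod_cast hA
  by_cases he : ∃ y : ℝ, (A : ℝ) * y ^ 2 + B * y + C = 0
  · obtain ⟨y, hy⟩ := he
    apply Set.Finite.subset (Set.toFinite {y, -(B : ℝ) / A - y})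
    intro x hx
    simp only [Set.mem_ofPred_eq] at hx
    have : (x - y) * (A * (x + y) + B) = 0 := by linear_combination hx - hy
    rcases mul_eq_zero.1 this with h | h
    · left; linarith
    · right
      simp only [Set.mem_singleton_iff]
      field_simp
      linarith
  · push Not at he
    convert Set.finite_empty
    ext x; simpa using he x

theorem red_fin (D : ℤ) : {p : ℝ × ℝ | PD D p ∧ |p.2| < 1}.Finite := by
  have hfin : (⋃ t ∈ {t ∈ (Set.Icc (-D) D ×ˢ Set.Icc (-D) D ×ˢ Set.Icc (-D) D : Set (ℤ × ℤ × ℤ)) |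
      t.1 ≠ 0}, ({x : ℝ | (t.1 : ℝ) * x ^ 2 + t.2.1 * x + t.2.2 = 0} ×ˢ
        {x : ℝ | (t.1 : ℝ) * x ^ 2 + t.2.1 * x + t.2.2 = 0})).Finite := by
    apply Set.Finite.biUnion
    · apply Set.Finite.subset _ (Set.sep_subset _ _)
      exact (Set.finite_Icc _ _).prod ((Set.finite_Icc _ _).prod (Set.finite_Icc _ _))
    · intro t ht
      exact (quad_fin _ _ _ ht.2).prod (quad_fin _ _ _ ht.2)
  apply hfin.subset
  rintro p ⟨⟨h1, h2, A, B, C, hA, hB, hC, hD⟩, h⟩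
  have hp := abs_lt.1 h
  have hA' : (A : ℝ) ≠ 0 := by exact_mod_cast hA
  have hneg : ((A : ℝ) + C) ^ 2 < B ^ 2 := by
    have e : (B : ℝ) ^ 2 - (A + C) ^ 2 = A ^ 2 * ((p.1 - 1) * (p.1 + 1) * ((1 - p.2) * (1 + p.2))) := by
      rw [hB, hC]; ring
    have : 0 < (A : ℝ) ^ 2 * ((p.1 - 1) * (p.1 + 1) * ((1 - p.2) * (1 + p.2))) := by
      apply mul_pos (by positivity)
      apply mul_pos
      · apply mul_pos <;> linarith
      · apply mul_pos <;> linarith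
    linarith
  have hneg' : (A + C) ^ 2 < B ^ 2 := by exact_mod_cast hneg
  have hlt : |A + C| < |B| := sq_lt_sq.1 hneg'
  have hDe : D = (|B| - |A + C|) * (|B| + |A + C|) + |A - C| ^ 2 := by
    rw [hD, sq_abs]
    linear_combination (sq_abs (A + C)) - sq_abs B
  have hs : |B| + |A + C| + |A - C| ≤ D := by
    have i1 : |A - C| ≤ |A - C| ^ 2 := by
      have := abs_nonneg (A - C); rcases (show |A - C| = 0 ∨ 1 ≤ |A - C| by omega) with h | h <;> nlinarith
    have i2 : 0 ≤ (|B| - |A + C| - 1) * (|B| + |A + C|) :=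
      mul_nonneg (by omega) (by positivity)
    nlinarith
  have b1 := abs_le.1 (show |B| ≤ D by have := abs_nonneg (A + C); have := abs_nonneg (A - C); omega)
  have b2 := abs_le.1 (le_refl |A + C|)
  have b3 := abs_le.1 (le_refl |A - C|)
  have b4 := abs_nonneg B
  simp only [Set.mem_iUnion]
  refine ⟨(A, B, C), ⟨⟨⟨by simp only; omega, by simp only; omega⟩, ⟨b1.1, b1.2⟩,
    ⟨by simp only; omega, by simp only; omega⟩⟩, hA⟩, ?_, ?_⟩
  · simp only [Set.mem_ofPred_eq]; rw [hB, hC]; ring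
  · simp only [Set.mem_ofPred_eq]; rw [hB, hC]; ring

theorem dist_incr {p : ℝ × ℝ} (h1 : Irrational p.1) (h2 : 1 < p.1) (hne : p.1 ≠ p.2)
    (h : 1 ≤ |(FE p).2|) : |p.1 - p.2| < |(FE p).1 - (FE p).2| := by
  have hT : 1 < (FE p).1 := TE_gt _ h1 h2
  have n1 : p.1 - aE p.1 ≠ 0 := sub_ne_zero.2 (h1.ne_int _)
  have n2 : p.2 - aE p.1 ≠ 0 := by
    intro h0
    unfold FE at h
    simp only [h0, div_zero, abs_zero] at h
    linarith
  have he := eE_sq p.1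
  have e : (FE p).1 - (FE p).2 = (eE p.1) * ((p.2 - p.1) * ((FE p).1 * (FE p).2)) := by
    unfold FE
    simp only
    field_simp
    linear_combination (-(eE p.1 : ℝ) * (p.2 - p.1)) * he
  have e1 : |(eE p.1 : ℝ)| = 1 := by rcases eE_cases p.1 with h | h <;> simp [h]
  rw [e, abs_mul, abs_mul, abs_mul, e1, one_mul, abs_sub_comm p.2 p.1]
  have : 1 < |(FE p).1| := by rw [abs_of_pos (by linarith)]; exact hT
  have pos : 0 < |p.1 - p.2| := abs_pos.2 (sub_ne_zero.2 hne)
  have : 1 < |(FE p).1| * |(FE p).2| := by nlinarith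
  nlinarith

theorem stmt10 (ω ωs : ℝ) (hω : 1 < ω) (hconj : IsConjPair ω ωs) :
    (-1 < ωs ∧ ωs < 1) ↔ ∃ n ≥ 1, TE^[n] ω = ω := by
  obtain ⟨hirr, A, B, C, hA, -, e1, e2, hne⟩ := hconj
  have hsum : (B : ℝ) = -A * (ω + ωs) := by
    have : (ωs - ω) * (A * (ω + ωs) + B) = 0 := by linear_combination e2 - e1
    rcases mul_eq_zero.1 this with h | h
    · exact absurd (sub_eq_zero.1 h) hne
    · linarith
  have hP : PD (B ^ 2 - 4 * A * C) (ω, ωs) := by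
    refine ⟨hirr, hω, A, B, C, hA.ne', hsum, ?_, rfl⟩
    rw [hsum] at e1
    simp only
    linear_combination e1
  generalize B ^ 2 - 4 * A * C = D at hP
  rw [← abs_lt]
  have hred : ∀ q, PD D q → |q.2| < 1 → ∀ k, |(FE^[k] q).2| < 1 := by
    intro q hq h k
    induction k with
    | zero => exact h
    | succ k ih =>
      rw [Function.iterate_succ_apply']
      have := PD_iter hq k
      exact red_F this.1 this.2.1 ih
  constructor
  · intro h
    have hmaps : ∀ k, FE^[k] (ω, ωs) ∈ {p : ℝ × ℝ | PD D p ∧ |p.2| < 1} := fun k =>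
      ⟨PD_iter hP k, hred _ hP h k⟩
    have hcancel : ∀ i d, FE^[i + d] (ω, ωs) = FE^[i] (ω, ωs) → FE^[d] (ω, ωs) = (ω, ωs) := by
      intro i d
      induction i with
      | zero => intro h; simpa using h
      | succ i ih =>
        intro h
        apply ih
        rw [show i + 1 + d = (i + d) + 1 by ring, Function.iterate_succ_apply',
          Function.iterate_succ_apply'] at h
        have x := hmaps (i + d)
        have y := hmaps i
        exact FE_inj x.1.1 x.1.2.1 x.2 y.1.1 y.1.2.1 y.2 h
    obtain ⟨i, j, hij, heq⟩ : ∃ i j : ℕ, i < j ∧ FE^[i] (ω, ωs) = FE^[j] (ω, ωs) := by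
      have := Set.Finite.exists_lt_map_eq_of_forall_mem (f := fun k : ℕ => FE^[k] (ω, ωs)) hmaps
        (red_fin D)
      exact this
    refine ⟨j - i, by omega, ?_⟩
    have := hcancel i (j - i) (by rw [show i + (j - i) = j by omega]; exact heq.symm)
    have h2 := fst_iter (ω, ωs) (j - i)
    rw [this] at h2
    exact h2.symm
  · rintro ⟨n, hn, hT⟩
    have hF : FE^[n] (ω, ωs) = (ω, ωs) :=
      conj_unique (PD_iter hP n) hP (by rw [fst_iter]; exact hT)
    have hall : ∀ k, |(FE^[k] (ω, ωs)).2| < 1 → |ωs| < 1 := by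
      intro k hk
      have h1 := hred _ (PD_iter hP k) hk (n * k - k)
      rw [← Function.iterate_add_apply, Nat.sub_add_cancel (Nat.le_mul_of_pos_left k hn),
        Function.iterate_mul, Function.iterate_fixed hF] at h1
      exact h1
    by_contra hcon
    have hge : ∀ k, 1 ≤ |(FE^[k] (ω, ωs)).2| := fun k => not_lt.1 (fun h => hcon (hall k h))
    have hmono : ∀ k, |ω - ωs| < |(FE^[k + 1] (ω, ωs)).1 - (FE^[k + 1] (ω, ωs)).2| := by
      intro k
      induction k with
      | zero => exact dist_incr (p := (ω, ωs)) hirr hω hne.symm (hge 1)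
      | succ k ih =>
        have hk := PD_iter hP (k + 1)
        have hg := hge (k + 1 + 1)
        rw [Function.iterate_succ_apply'] at hg ⊢
        refine ih.trans (dist_incr hk.1 hk.2.1 ?_ hg)
        intro h0
        rw [h0, sub_self, abs_zero] at ih
        exact absurd ih (not_lt.2 (abs_nonneg _))
    have := hmono (n - 1)
    rw [Nat.sub_add_cancel hn, hF] at this
    exact lt_irrefl _ this
end
end

section
/- For every ε > 0 there exists a constant C_ε > 0 such that the following holds: for all integers q ≥ 2 and h with gcd(h,q) = 1, every integer c, every sign s ∈ {±1}, and every interval I ⊆ ℝ with |I| < q such that the linear function f(x) = c + s·x satisfies f(I) ⊆ [0,q], one has | #{(x,y) ∈ ℤ² : x ∈ I, 0 ≤ y ≤ f(x), xy ≡ h (mod q)} − (φ(q)/q²)·∫_I f(x) dx | ≤ C_ε · q^{1/2+ε}, where φ is Euler's totient function. -/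
noncomputable section


open Polynomial in
theorem kl_indep {F : Type*} [Field F] {p : ℕ} [Fact p.Prime] [CharP F p] (μ : ℕ)
    (f : F[X]) (hsq : Squarefree f) (hm : 0 < f.natDegree) (h0 : f.coeff 0 ≠ 0) (B e : ℕ)
    (he : 2 * e = p ^ μ + 1) (hB : 2 * B + f.natDegree ≤ p ^ μ) (r s : F[X])
    (hr : r.degree < B) (hs : s.degree < B)
    (hdvd : X ^ (p ^ μ) ∣ r + s * f ^ e) : r = 0 ∧ s = 0 := by
  set q0 := p ^ μ with hq0
  have hf0 : f ≠ 0 := by rintro rfl; simp at hm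
  have h1 : X ^ q0 ∣ f ^ q0 - C (f.coeff 0 ^ q0) := by
    have : f ^ q0 - C (f.coeff 0 ^ q0) = (f - C (f.coeff 0)) ^ q0 := by
      rw [hq0, sub_pow_char_pow, C_pow]
    rw [this]
    apply pow_dvd_pow_of_dvd
    rw [X_dvd_iff]; simp
  have h2 : X ^ q0 ∣ r ^ 2 - C (f.coeff 0 ^ q0) * s ^ 2 * f := by
    have : r ^ 2 - C (f.coeff 0 ^ q0) * s ^ 2 * f =
        (r + s * f ^ e) * (r - s * f ^ e) + s ^ 2 * f * (f ^ q0 - C (f.coeff 0 ^ q0)) := by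
      have : (f ^ e) ^ 2 = f ^ q0 * f := by rw [← pow_mul, mul_comm, he, pow_succ]
      linear_combination (s ^ 2) * this
    rw [this]
    exact dvd_add (Dvd.dvd.mul_right hdvd _) (Dvd.dvd.mul_left h1 _)
  have h3 : r ^ 2 - C (f.coeff 0 ^ q0) * s ^ 2 * f = 0 := by
    by_contra hne
    have h4 := degree_le_of_dvd h2 hne
    rw [degree_X_pow] at h4
    have hBpos : r = 0 ∨ r.natDegree < B := by
      by_cases h : r = 0
      · left; exact h
      · right; exact (natDegree_lt_iff_degree_lt h).2 hr
    have hBpos' : s = 0 ∨ s.natDegree < B := by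
      by_cases h : s = 0
      · left; exact h
      · right; exact (natDegree_lt_iff_degree_lt h).2 hs
    have h5 : (r ^ 2 - C (f.coeff 0 ^ q0) * s ^ 2 * f).degree < (q0 : ℕ) := by
      refine lt_of_le_of_lt (degree_sub_le _ _) (max_lt ?_ ?_)
      · rcases hBpos with h | h
        · simp [h]
        · refine lt_of_le_of_lt degree_le_natDegree ?_
          have := natDegree_pow_le (p := r) (n := 2)
          exact_mod_cast (by omega : (r ^ 2).natDegree < q0)
      · rcases hBpos' with h | h
        · simp [h]
        · refine lt_of_le_of_lt degree_le_natDegree ?_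
          have := natDegree_pow_le (p := s) (n := 2)
          have h6 := natDegree_mul_le (p := C (f.coeff 0 ^ q0) * s ^ 2) (q := f)
          have h7 := natDegree_C_mul_le (f.coeff 0 ^ q0) (s ^ 2)
          exact_mod_cast (by omega : (C (f.coeff 0 ^ q0) * s ^ 2 * f).natDegree < q0)
    exact absurd h4 (not_le.2 h5)
  have hc : f.coeff 0 ^ q0 ≠ 0 := pow_ne_zero _ h0
  have hnu : ¬ IsUnit f := by
    intro h; rw [natDegree_eq_zero_of_isUnit h] at hm; exact lt_irrefl _ hm
  have hs0 : s = 0 := by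
    by_contra hs0
    have hr0 : r ≠ 0 := by
      rintro rfl
      have : C (f.coeff 0 ^ q0) * s ^ 2 * f = 0 := by linear_combination -h3
      simp only [mul_eq_zero, C_eq_zero, hc, false_or, hf0, or_false] at this
      exact hs0 (by simpa using this)
    obtain ⟨P, hP, hPf⟩ := WfDvdMonoid.exists_irreducible_factor hnu hf0
    have hPp : Prime P := hP.prime
    have e1 : emultiplicity P f = 1 := by
      apply le_antisymm
      · exact (squarefree_iff_emultiplicity_le_one f).1 hsq P |>.resolve_right hP.not_isUnit
      · rw [← Nat.cast_one, ← pow_dvd_iff_le_emultiplicity, pow_one]; exact hPf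
    have e2 : emultiplicity P (C (f.coeff 0 ^ q0)) = 0 := by
      rw [emultiplicity_eq_zero]
      intro h
      exact hP.not_isUnit (isUnit_of_dvd_unit h (isUnit_C.2 (isUnit_iff_ne_zero.2 hc)))
    have e3 : r ^ 2 = C (f.coeff 0 ^ q0) * s ^ 2 * f := by linear_combination h3
    have e4 := congrArg (emultiplicity P) e3
    rw [emultiplicity_mul hPp, emultiplicity_mul hPp, emultiplicity_pow hPp, emultiplicity_pow hPp,
      e1, e2] at e4
    have fr := (FiniteMultiplicity.of_prime_left hPp hr0).emultiplicity_eq_multiplicity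
    have fs := (FiniteMultiplicity.of_prime_left hPp hs0).emultiplicity_eq_multiplicity
    rw [fr, fs] at e4
    norm_cast at e4
    omega
  refine ⟨?_, hs0⟩
  rw [hs0] at h3
  simpa using h3

open Polynomial in
theorem kl_indep_sum {F : Type*} [Field F] {p : ℕ} [Fact p.Prime] [CharP F p] (μ : ℕ)
    (f : F[X]) (hsq : Squarefree f) (hm : 0 < f.natDegree) (h0 : f.coeff 0 ≠ 0) (B e : ℕ)
    (he : 2 * e = p ^ μ + 1) (hB : 2 * B + f.natDegree ≤ p ^ μ) (A : ℕ) :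
    ∀ (r s : ℕ → F[X]) (_ : ∀ i, (r i).degree < B) (_ : ∀ i, (s i).degree < B)
    (_ : ∑ i ∈ Finset.range A, X ^ (i * p ^ μ) * (r i + s i * f ^ e) = 0),
    ∀ i < A, r i = 0 ∧ s i = 0 := by
  induction A with
  | zero => intro r s _ _ _ i hi; omega
  | succ A ih =>
    intro r s hr hs hsum i hi
    rw [Finset.sum_range_succ'] at hsum
    have e1 : ∑ i ∈ Finset.range A, X ^ ((i + 1) * p ^ μ) * (r (i + 1) + s (i + 1) * f ^ e) =
        X ^ (p ^ μ) * ∑ i ∈ Finset.range A, X ^ (i * p ^ μ) * (r (i + 1) + s (i + 1) * f ^ e) := by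
      rw [Finset.mul_sum]
      apply Finset.sum_congr rfl
      intro i _
      rw [add_mul, pow_add]; ring
    rw [e1] at hsum
    have hd : X ^ (p ^ μ) ∣ r 0 + s 0 * f ^ e := by
      refine ⟨-∑ i ∈ Finset.range A, X ^ (i * p ^ μ) * (r (i + 1) + s (i + 1) * f ^ e), ?_⟩
      simp only [zero_mul, pow_zero, one_mul] at hsum
      linear_combination hsum
    obtain ⟨hr0, hs0⟩ := kl_indep μ f hsq hm h0 B e he hB _ _ (hr 0) (hs 0) hd
    rw [hr0, hs0] at hsum
    simp only [zero_mul, pow_zero, one_mul, add_zero, mul_eq_zero, pow_eq_zero_iff', X_ne_zero,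
      false_and, false_or] at hsum
    have := ih (fun i => r (i+1)) (fun i => s (i+1)) (fun i => hr _) (fun i => hs _) hsum
    rcases i with _ | i
    · exact ⟨hr0, hs0⟩
    · exact this i (by omega)

open Polynomial in
theorem kl_exists {F : Type*} [Field F] (q0 A B N : ℕ)
    (G : F[X]) (hN : A + B * q0 + G.natDegree ≤ N) (hlt : N < 2 * (A * B)) :
    ∃ ρ σ : ℕ → F[X], (∀ i, (ρ i).degree < B) ∧ (∀ i, (σ i).degree < B) ∧
      (∃ i < A, ρ i ≠ 0 ∨ σ i ≠ 0) ∧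
      ∑ i ∈ Finset.range A, X ^ i * (expand F q0 (ρ i) + expand F q0 (σ i) * G) = 0 := by
  let P : ((Fin A → degreeLT F B) × (Fin A → degreeLT F B)) →ₗ[F] F[X] := 
    { toFun := fun v => ∑ i : Fin A, X ^ (i : ℕ) * (expand F q0 (v.1 i : F[X]) + expand F q0 (v.2 i : F[X]) * G)
      map_add' := by
        intro v w
        rw [← Finset.sum_add_distrib]
        apply Finset.sum_congr rfl
        intro i _
        simp; ring
      map_smul' := by
        intro c v
        rw [RingHom.id_apply, Finset.smul_sum]
        apply Finset.sum_congr rfl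
        intro i _
        simp [smul_eq_C_mul]; ring }
  let Φ : ((Fin A → degreeLT F B) × (Fin A → degreeLT F B)) →ₗ[F] (Fin N → F) := LinearMap.pi (fun j => (lcoeff F j) ∘ₗ P)
  have hfr : Module.finrank F ((Fin A → degreeLT F B) × (Fin A → degreeLT F B)) = 2 * (A * B) := by
    have : Module.finrank F (degreeLT F B) = B := by
      rw [LinearEquiv.finrank_eq (degreeLTEquiv F B)]; simp
    have : Module.finrank F (Fin A → degreeLT F B) = A * B := by
      rw [Module.finrank_pi_fintype]; simp [this]
    have hfin : Module.Finite F (degreeLT F B) := Module.Finite.equiv (degreeLTEquiv F B).symm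
    rw [Module.finrank_prod, this]; ring
  have hfin : Module.Finite F (degreeLT F B) := Module.Finite.equiv (degreeLTEquiv F B).symm
  have hker : LinearMap.ker Φ ≠ ⊥ := by
    apply LinearMap.ker_ne_bot_of_finrank_lt
    rw [hfr]; simpa using hlt
  obtain ⟨v, hv, hv0⟩ := (Submodule.ne_bot_iff _).1 hker
  have hdeg : (P v).natDegree < N ∨ P v = 0 := by
    by_cases hz : P v = 0
    · right; exact hz
    left
    have hApos : 0 < A := by
      rcases Nat.eq_zero_or_pos A with h | h
      · subst h; simp at hlt
      · exact h
    have hBpos : 0 < B := by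
      rcases Nat.eq_zero_or_pos B with h | h
      · subst h; simp at hlt
      · exact h
    have key : ∀ w : degreeLT F B, (expand F q0 (w : F[X])).natDegree ≤ (B - 1) * q0 := by
      intro w
      rw [natDegree_expand]
      apply Nat.mul_le_mul_right
      by_cases h : (w : F[X]) = 0
      · rw [h]; simp
      · have := (natDegree_lt_iff_degree_lt h).2 (mem_degreeLT.1 w.2)
        omega
    have hle : (P v).natDegree ≤ (A - 1) + ((B - 1) * q0 + G.natDegree) := by
      change (∑ i : Fin A, X ^ (i : ℕ) * (expand F q0 (v.1 i : F[X]) + expand F q0 (v.2 i : F[X]) * G)).natDegree ≤ _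
      apply natDegree_sum_le_of_forall_le
      intro i _
      refine natDegree_mul_le_of_le ?_ ?_
      · rw [natDegree_X_pow]; omega
      · refine natDegree_add_le_of_degree_le ?_ ?_
        · exact (key _).trans (by omega)
        · exact natDegree_mul_le_of_le (key _) le_rfl
    have : (B - 1) * q0 ≤ B * q0 := Nat.mul_le_mul_right _ (by omega)
    omega
  have hP : P v = 0 := by
    rcases hdeg with h | h
    · ext j
      by_cases hj : j < N
      · have := congrFun (LinearMap.mem_ker.1 hv) ⟨j, hj⟩
        simpa [Φ] using this
      · rw [coeff_eq_zero_of_natDegree_lt (by omega)]; simp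
    · exact h
  refine ⟨fun i => if h : i < A then (v.1 ⟨i, h⟩ : F[X]) else 0,
    fun i => if h : i < A then (v.2 ⟨i, h⟩ : F[X]) else 0, ?_, ?_, ?_, ?_⟩
  · intro i
    dsimp only
    split_ifs with h
    · exact mem_degreeLT.1 (v.1 _).2
    · simp
  · intro i
    dsimp only
    split_ifs with h
    · exact mem_degreeLT.1 (v.2 _).2
    · simp
  · by_contra! hcon
    apply hv0
    ext i : 2
    · have := (hcon i i.2).1
      simpa using this
    · have := (hcon i i.2).2
      simpa using this
  · rw [Finset.sum_range]
    simpa [P] using hP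

open Polynomial in
theorem kl_stepanov {F : Type*} [Field F] [Fintype F] [DecidableEq F] {p : ℕ} [Fact p.Prime] [CharP F p] (μ : ℕ)
    (hcard : Fintype.card F = (p ^ μ) ^ 2)
    (f : F[X]) (hsq : Squarefree f) (hm : 0 < f.natDegree) (h0 : f.coeff 0 ≠ 0) (A B e : ℕ)
    (he : 2 * e = p ^ μ + 1) (hB : 2 * B + f.natDegree ≤ p ^ μ)
    (hAB : A + B * p ^ μ + e * f.natDegree < 2 * (A * B)) :
    (Finset.univ.filter (fun x : F => f.eval x ^ (((p ^ μ) ^ 2 - 1) / 2) = 1)).card ≤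
      A * p ^ μ + B + e * f.natDegree := by
  have hq0 : 0 < p ^ μ := pow_pos (Fact.out : p.Prime).pos _
  obtain ⟨ρ, σ, hρ, hσ, hne, hsum⟩ := kl_exists (p ^ μ) A B _ (f ^ e)
    (by rw [natDegree_pow]) hAB
  have hbij : Function.Bijective (iterateFrobenius F p μ) :=
    (Finite.injective_iff_bijective).1 (iterateFrobenius F p μ).injective
  have hsurj := Polynomial.map_surjective (iterateFrobenius F p μ) hbij.2
  choose r hr using fun i => hsurj (ρ i)
  choose s hs using fun i => hsurj (σ i)
  have hrd : ∀ i, (r i).degree < B := by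
    intro i; rw [← degree_map (r i) (iterateFrobenius F p μ), hr]; exact hρ i
  have hsd : ∀ i, (s i).degree < B := by
    intro i; rw [← degree_map (s i) (iterateFrobenius F p μ), hs]; exact hσ i
  have hpow : ∀ g : F[X], expand F (p ^ μ) (map (iterateFrobenius F p μ) g) = g ^ (p ^ μ) := by
    intro g
    rw [← Polynomial.map_expand]
    exact map_iterateFrobenius_expand p g μ
  simp only [← hr, ← hs, hpow] at hsum
  set T := ∑ i ∈ Finset.range A, X ^ (i * p ^ μ) * (r i + s i * f ^ e) with hT
  have hT0 : T ≠ 0 := by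
    intro h
    obtain ⟨i, hi, h'⟩ := hne
    obtain ⟨h1, h2⟩ := kl_indep_sum μ f hsq hm h0 B e he hB A r s hrd hsd h i hi
    rw [← hr, ← hs, h1, h2] at h'
    simp at h'
  have hexp : e * p ^ μ = ((p ^ μ) ^ 2 - 1) / 2 + e := by
    have h1 : 2 * (e * p ^ μ) = (p^μ)^2 + p ^ μ := by
      rw [← mul_assoc, he]; ring
    have : 1 ≤ (p^μ)^2 := Nat.one_le_pow _ _ hq0
    omega
  have hsub : (Finset.univ.filter (fun x : F => f.eval x ^ (((p ^ μ) ^ 2 - 1) / 2) = 1)) ⊆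
      T.roots.toFinset := by
    intro x hx
    simp only [Finset.mem_filter, Finset.mem_univ, true_and] at hx
    rw [Multiset.mem_toFinset, mem_roots hT0, IsRoot.def]
    have hz : (T.eval x) ^ (p ^ μ) = 0 := by
      have h1 := congrArg (eval x) hsum
      rw [hT, eval_finsetSum, sum_pow_char_pow]
      rw [eval_finsetSum] at h1
      rw [eval_zero] at h1
      rw [← h1]
      apply Finset.sum_congr rfl
      intro i _
      have hx1 : (x ^ (i * p ^ μ)) ^ (p ^ μ) = x ^ i := by
        have : x ^ ((p^μ)^2) = x := by rw [← hcard]; exact FiniteField.pow_card x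
        calc (x ^ (i * p ^ μ)) ^ (p ^ μ) = (x ^ ((p^μ)^2)) ^ i := by
              rw [← pow_mul, ← pow_mul]; ring_nf
          _ = x ^ i := by rw [this]
      have hx2 : ((f.eval x) ^ e) ^ (p ^ μ) = (f.eval x) ^ e := by
        rw [← pow_mul, hexp, pow_add, hx, one_mul]
      simp only [eval_mul, eval_add, eval_pow, eval_X]
      rw [mul_pow, hx1, add_pow_char_pow, mul_pow, hx2]
    exact pow_eq_zero_iff (by omega) |>.1 hz
  have hdegT : T.natDegree ≤ A * p ^ μ + (B + e * f.natDegree) := by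
    apply natDegree_sum_le_of_forall_le
    intro i hi
    have hi' := Finset.mem_range.1 hi
    refine natDegree_mul_le_of_le ?_ ?_
    · rw [natDegree_X_pow]; exact Nat.mul_le_mul_right _ hi'.le
    · have h1 : ∀ g : F[X], g.degree < B → g.natDegree ≤ B := fun g hg =>
        natDegree_le_of_degree_le hg.le
      refine natDegree_add_le_of_degree_le ?_ ?_
      · exact (h1 _ (hrd i)).trans (by omega)
      · refine natDegree_mul_le_of_le (h1 _ (hsd i)) (natDegree_pow_le)
  calc _ ≤ T.roots.toFinset.card := Finset.card_le_card hsub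
    _ ≤ Multiset.card T.roots := Multiset.toFinset_card_le _
    _ ≤ T.natDegree := card_roots' T
    _ ≤ _ := by omega

open Polynomial in
/-- Clean version of the Stepanov bound. -/
theorem kl_stepanov' {F : Type*} [Field F] [Fintype F] [DecidableEq F] {p : ℕ} [Fact p.Prime] [CharP F p]
    (hp2 : p ≠ 2) (μ : ℕ)
    (hcard : Fintype.card F = (p ^ μ) ^ 2)
    (f : F[X]) (hsq : Squarefree f) (hm : 0 < f.natDegree) (h0 : f.coeff 0 ≠ 0)
    (hbig : 4 * f.natDegree + 8 ≤ p ^ μ) :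
    2 * (Finset.univ.filter (fun x : F => f.eval x ^ (((p ^ μ) ^ 2 - 1) / 2) = 1)).card ≤
      (p ^ μ) ^ 2 + (6 * f.natDegree + 10) * p ^ μ := by
  have hodd : Odd (p ^ μ) := ((Fact.out : p.Prime).odd_of_ne_two hp2).pow
  have h := kl_stepanov (F := F) (p := p) μ hcard f hsq hm h0
  generalize p ^ μ = q0 at *
  generalize f.natDegree = m at *
  obtain ⟨k, hk⟩ := hodd
  obtain ⟨B, hB⟩ : ∃ B, 2 * B + m = q0 ∨ 2 * B + m + 1 = q0 := ⟨(q0 - m) / 2, by omega⟩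
  have h2 := h (k + 1 + (2 * m + 2)) B (k + 1) (by omega) (by omega) (by
    have : 3 * q0 ≤ 8 * B := by omega
    subst hk
    nlinarith)
  have h3 : B ≤ q0 := by omega
  have : k + 1 ≤ q0 := by omega
  subst hk
  nlinarith


theorem kl_trace_pow {F : Type*} [Field F] [Fintype F] {p : ℕ} [Fact p.Prime] [Algebra (ZMod p) F] (y : F) :
    Algebra.trace (ZMod p) F (y ^ p) = Algebra.trace (ZMod p) F y := by
  have : CharP F p := charP_of_injective_algebraMap (algebraMap (ZMod p) F).injective p
  have := Algebra.trace_eq_of_algEquiv (FiniteField.frobeniusAlgEquivOfAlgebraic (ZMod p) F) y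
  simpa [ZMod.card] using this

theorem kl_as {F : Type*} [Field F] [Fintype F] {p : ℕ} [Fact p.Prime] [Algebra (ZMod p) F] (z : F)
    (hz : Algebra.trace (ZMod p) F z = 0) : ∃ y, y ^ p - y = z := by
  classical
  have : CharP F p := charP_of_injective_algebraMap (algebraMap (ZMod p) F).injective p
  let φ : F →+ F := 
    { toFun := fun y => y ^ p - y
      map_zero' := by simp [(Fact.out : p.Prime).ne_zero]
      map_add' := by intro a b; rw [add_pow_char]; ring }
  let τ : F →+ ZMod p := (Algebra.trace (ZMod p) F).toAddMonoidHom
  have hle : φ.range ≤ τ.ker := by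
    rintro _ ⟨y, rfl⟩
    rw [AddMonoidHom.mem_ker]
    change Algebra.trace (ZMod p) F (y ^ p - y) = 0
    rw [map_sub, kl_trace_pow, sub_self]
  have hsurj : Function.Surjective τ := by
    exact Algebra.trace_surjective (ZMod p) F
  have h1 : Nat.card φ.range * Nat.card φ.ker = Nat.card F := by
    rw [← AddSubgroup.index_ker, mul_comm]; exact AddSubgroup.card_mul_index _
  have h2 : p * Nat.card τ.ker = Nat.card F := by
    have : τ.ker.index = p := by
      rw [AddSubgroup.index_ker, AddMonoidHom.range_eq_top_of_surjective _ hsurj]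
      simp
    have h := AddSubgroup.card_mul_index τ.ker
    rw [this] at h
    rw [mul_comm]; exact h
  have h3 : Nat.card φ.ker ≤ p := by
    have hp1 : 1 < p := (Fact.out : p.Prime).one_lt
    have hX : (Polynomial.X ^ p - Polynomial.X : Polynomial F) ≠ 0 := FiniteField.X_pow_card_sub_X_ne_zero F hp1
    have hsub : (φ.ker : Set F) ⊆ ((Polynomial.X ^ p - Polynomial.X : Polynomial F).roots.toFinset : Set F) := by
      intro x hx
      have hx' : x ^ p - x = 0 := hx
      simp [hX, hx']
    calc Nat.card φ.ker = (φ.ker : Set F).ncard := rfl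
      _ ≤ _ := Set.ncard_le_ncard hsub (Set.toFinite _)
      _ = _ := Set.ncard_coe_finset _
      _ ≤ _ := Multiset.toFinset_card_le _
      _ ≤ _ := Polynomial.card_roots' _
      _ = p := FiniteField.X_pow_card_sub_X_natDegree_eq F hp1
  have h4 : Nat.card τ.ker ≤ Nat.card φ.range := by
    by_contra hcon
    push Not at hcon
    have : Nat.card φ.range * Nat.card φ.ker < p * Nat.card τ.ker := by
      calc _ ≤ Nat.card φ.range * p := Nat.mul_le_mul_left _ h3
        _ < Nat.card τ.ker * p := Nat.mul_lt_mul_of_pos_right hcon (Fact.out : p.Prime).pos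
        _ = _ := mul_comm _ _
    omega
  have h5 : φ.range = τ.ker := AddSubgroup.eq_of_le_of_card_ge hle h4
  have : z ∈ φ.range := by rw [h5]; exact hz
  obtain ⟨y, hy⟩ := this
  exact ⟨y, hy⟩

theorem kl_count_le {F : Type*} [Field F] [Fintype F] [DecidableEq F] {p : ℕ} [Fact p.Prime] [Algebra (ZMod p) F]
    (Q : ℕ) (hp2 : p ≠ 2) (hQ : Fintype.card F = Q) (b γ : F) :
    p * (Finset.univ.filter (fun x : F => x ≠ 0 ∧ Algebra.trace (ZMod p) F (x + b * x⁻¹) =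
      Algebra.trace (ZMod p) F γ)).card ≤
    2 * (Finset.univ.filter (fun y : F => ((y ^ p - y + γ) ^ 2 - 4 * b) ^ ((Q - 1) / 2) = 1)).card +
     (Finset.univ.filter (fun y : F => ((y ^ p - y + γ) ^ 2 - 4 * b) = 0)).card := by
  have : CharP F p := charP_of_injective_algebraMap (algebraMap (ZMod p) F).injective p
  have h2 : (2 : F) ≠ 0 := by
    intro h
    have : ((2 : ℕ) : F) = 0 := by exact_mod_cast h
    rw [CharP.cast_eq_zero_iff F p] at this
    exact hp2 ((Nat.prime_dvd_prime_iff_eq Fact.out Nat.prime_two).1 this)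
  set S := (Finset.univ.filter (fun x : F => x ≠ 0 ∧ Algebra.trace (ZMod p) F (x + b * x⁻¹) =
      Algebra.trace (ZMod p) F γ)) with hS
  let D : Finset (F × F) := Finset.univ.filter (fun z => z.1 ≠ 0 ∧ z.1 + b * z.1⁻¹ = z.2 ^ p - z.2 + γ)
  have hD1 : p * S.card ≤ D.card := by
    have hmaps : ∀ z ∈ D, z.1 ∈ S := by
      intro z hz
      simp only [D, Finset.mem_filter, Finset.mem_univ, true_and] at hz
      simp only [hS, Finset.mem_filter, Finset.mem_univ, true_and]
      refine ⟨hz.1, ?_⟩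
      rw [hz.2, map_add, map_sub, kl_trace_pow, sub_self, zero_add]
    rw [Finset.card_eq_sum_card_fiberwise hmaps, mul_comm, ← smul_eq_mul]
    apply Finset.card_nsmul_le_sum
    intro x hx
    simp only [hS, Finset.mem_filter, Finset.mem_univ, true_and] at hx
    obtain ⟨y, hy⟩ := kl_as (p := p) (x + b * x⁻¹ - γ) (by rw [map_sub, hx.2, sub_self])
    have hinj : Function.Injective (fun c : ZMod p => (x, y + algebraMap (ZMod p) F c)) := by
      intro c c' hcc
      simp only [Prod.mk.injEq, add_right_inj, true_and] at hcc
      exact (algebraMap (ZMod p) F).injective hcc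
    calc p = (Finset.univ : Finset (ZMod p)).card := by simp [ZMod.card]
      _ = (Finset.univ.image (fun c : ZMod p => (x, y + algebraMap (ZMod p) F c))).card :=
        (Finset.card_image_of_injective _ hinj).symm
      _ ≤ _ := by
        apply Finset.card_le_card
        intro z hz
        simp only [Finset.mem_image, Finset.mem_univ, true_and] at hz
        obtain ⟨c, rfl⟩ := hz
        simp only [D, Finset.mem_filter, Finset.mem_univ, true_and, and_true]
        refine ⟨hx.1, ?_⟩
        rw [add_pow_char, ← map_pow, ZMod.pow_card]
        linear_combination -hy
  have hD2 : D.card = ∑ y : F, (D.filter (fun z => z.2 = y)).card :=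
    Finset.card_eq_sum_card_fiberwise (fun z _ => Finset.mem_univ _)
  have hD3 : ∀ y : F, (D.filter (fun z => z.2 = y)).card ≤
      2 * (if ((y ^ p - y + γ) ^ 2 - 4 * b) ^ ((Q - 1) / 2) = 1 then 1 else 0) +
      (if ((y ^ p - y + γ) ^ 2 - 4 * b) = 0 then 1 else 0) := by
    intro y
    rcases (D.filter (fun z => z.2 = y)).eq_empty_or_nonempty with he | ⟨z, hz⟩
    · rw [he]; simp
    obtain ⟨x, y'⟩ := z
    simp only [D, Finset.mem_filter, Finset.mem_univ, true_and] at hz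
    obtain ⟨⟨hx0, hx⟩, rfl⟩ := hz
    set g := y' ^ p - y' + γ with hg
    have hx' : x ^ 2 + b = g * x := by
      rw [← hx]; field_simp
    have hsub : D.filter (fun z => z.2 = y') ⊆ {(x, y'), (g - x, y')} := by
      intro z hz
      obtain ⟨x2, y2⟩ := z
      simp only [D, Finset.mem_filter, Finset.mem_univ, true_and] at hz
      obtain ⟨⟨hx20, hx2⟩, rfl⟩ := hz
      have hx2' : x2 ^ 2 + b = g * x2 := by
        rw [hg, ← hx2]; field_simp
      have : (x2 - x) * (x2 - (g - x)) = 0 := by linear_combination hx2' - hx'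
      rcases mul_eq_zero.1 this with h | h
      · simp [sub_eq_zero.1 h]
      · simp [sub_eq_zero.1 h]
    have hsqr : g ^ 2 - 4 * b = (2 * x - g) ^ 2 := by linear_combination -4 * hx'
    by_cases hz : g ^ 2 - 4 * b = 0
    · have hgx : g - x = x := by
        rw [hz] at hsqr
        have := pow_eq_zero_iff (two_ne_zero) |>.1 hsqr.symm
        linear_combination -this
      rw [hgx] at hsub
      have := Finset.card_le_card hsub
      simp only [Finset.pair_eq_singleton, Finset.card_singleton] at this
      rw [if_pos hz]; omega
    · have h1 : (g ^ 2 - 4 * b) ^ ((Q - 1) / 2) = 1 := by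
        have hw : 2 * x - g ≠ 0 := by
          intro h; rw [h] at hsqr; exact hz (by simpa using hsqr)
        have hodd : Q % 2 = 1 := by
          rw [← hQ]
          apply FiniteField.odd_card_of_char_ne_two
          rw [ringChar.eq F p]; exact hp2
        have : 2 * ((Q - 1) / 2) = Q - 1 := by omega
        rw [hsqr, ← pow_mul, this, ← hQ]
        exact FiniteField.pow_card_sub_one_eq_one _ hw
      rw [if_pos h1]
      have := Finset.card_le_card hsub
      have h3 := Finset.card_le_two (a := (x, y')) (b := (g - x, y'))
      omega
  calc _ ≤ D.card := hD1
    _ = _ := hD2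
    _ ≤ _ := Finset.sum_le_sum (fun y _ => hD3 y)
    _ = _ := by
      rw [Finset.sum_add_distrib, ← Finset.mul_sum]
      simp

open Polynomial in
theorem kl_count_bound {F : Type*} [Field F] [Fintype F] [DecidableEq F] {p : ℕ} [Fact p.Prime] [Algebra (ZMod p) F]
    (hp2 : p ≠ 2) (μ : ℕ) (hcard : Fintype.card F = (p ^ μ) ^ 2) (hbig : 8 * p + 8 ≤ p ^ μ)
    (b : F) (hb : b ≠ 0) (t : ZMod p) :
    p * (Finset.univ.filter (fun x : F => x ≠ 0 ∧ Algebra.trace (ZMod p) F (x + b * x⁻¹) = t)).card ≤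
      (p ^ μ) ^ 2 + (14 * p + 10) * p ^ μ := by
  have : CharP F p := charP_of_injective_algebraMap (algebraMap (ZMod p) F).injective p
  have hp1 : 1 < p := (Fact.out : p.Prime).one_lt
  have h2 : (2 : F) ≠ 0 := by
    intro h
    have : ((2 : ℕ) : F) = 0 := by exact_mod_cast h
    rw [CharP.cast_eq_zero_iff F p] at this
    exact hp2 ((Nat.prime_dvd_prime_iff_eq Fact.out Nat.prime_two).1 this)
  have h4b : (4 : F) * b ≠ 0 := by
    refine mul_ne_zero ?_ hb
    rw [show (4 : F) = 2 * 2 by norm_num]; exact mul_ne_zero h2 h2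
  have hgdeg : ∀ γ : F, (X ^ p - X + C γ : F[X]).natDegree = p := by
    intro γ
    rw [natDegree_add_C, FiniteField.X_pow_card_sub_X_natDegree_eq F hp1]
  have hdeg : ∀ γ : F, ((X ^ p - X + C γ) ^ 2 - C (4 * b) : F[X]).natDegree = 2 * p := by
    intro γ
    rw [natDegree_sub_C, natDegree_pow, hgdeg]
  -- choose γ
  obtain ⟨γ, hγt, hγ0⟩ : ∃ γ : F, Algebra.trace (ZMod p) F γ = t ∧ γ ^ 2 - 4 * b ≠ 0 := by
    obtain ⟨γ0, hγ0⟩ := Algebra.trace_surjective (ZMod p) F t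
    have hne : ((X ^ p - X + C γ0) ^ 2 - C (4 * b) : F[X]) ≠ 0 := by
      intro h; have := hdeg γ0; rw [h] at this; simp at this; omega
    obtain ⟨x, hx⟩ : ∃ x : F, eval x ((X ^ p - X + C γ0) ^ 2 - C (4 * b) : F[X]) ≠ 0 := by
      by_contra! hcon
      have h1 : (Finset.univ : Finset F) ⊆ ((X ^ p - X + C γ0) ^ 2 - C (4 * b) : F[X]).roots.toFinset := by
        intro x _
        rw [Multiset.mem_toFinset, mem_roots hne]
        exact hcon x
      have h3 := (Finset.card_le_card h1).trans ((Multiset.toFinset_card_le _).trans (card_roots' _))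
      rw [hdeg, Finset.card_univ, hcard] at h3
      nlinarith
    refine ⟨γ0 + (x ^ p - x), ?_, ?_⟩
    · rw [map_add, map_sub, kl_trace_pow, hγ0]; simp
    · intro h
      apply hx
      simp only [eval_sub, eval_pow, eval_add, eval_X, eval_C]
      rw [← h]; ring
  set f : F[X] := (X ^ p - X + C γ) ^ 2 - C (4 * b) with hf
  have hfe : ∀ y, f.eval y = (y ^ p - y + γ) ^ 2 - 4 * b := by
    intro y; simp [hf]
  have hsq : Squarefree f := by
    apply Separable.squarefree
    rw [separable_def]
    have hder : derivative f = - (C 2 * (X ^ p - X + C γ)) := by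
      rw [hf]
      simp only [derivative_sub, derivative_C, derivative_pow, derivative_add, derivative_X]
      simp
    rw [hder]
    refine ⟨C (-(4 * b)⁻¹), C (-(4 * b)⁻¹ * 2⁻¹) * (X ^ p - X + C γ), ?_⟩
    rw [hf]
    have e1 : (C (4 * b)⁻¹ : F[X]) * C (4 * b) = 1 := by rw [← C_mul, inv_mul_cancel₀ h4b, C_1]
    have e2 : (C 2⁻¹ : F[X]) * C 2 = 1 := by rw [← C_mul, inv_mul_cancel₀ h2, C_1]
    rw [C_mul (a := -(4 * b)⁻¹), C_neg]
    linear_combination e1 + (C (4*b)⁻¹) * (X ^ p - X + C γ)^2 * e2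
  have hf0 : f.coeff 0 ≠ 0 := by
    rw [coeff_zero_eq_eval_zero, hfe]
    simpa [(Fact.out : p.Prime).ne_zero] using hγ0
  have hst := kl_stepanov' (F := F) (p := p) hp2 μ hcard f hsq (by rw [hdeg]; omega) hf0 (by rw [hdeg]; omega)
  rw [hdeg] at hst
  have hc := kl_count_le (F := F) (p := p) _ hp2 hcard b γ
  rw [hγt] at hc
  simp only [← hfe] at hc
  have hroots : (Finset.univ.filter (fun y : F => f.eval y = 0)).card ≤ 2 * p := by
    have hne : f ≠ 0 := by
      intro h; apply hf0; rw [h]; simp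
    have h1 : (Finset.univ.filter (fun y : F => f.eval y = 0)) ⊆ f.roots.toFinset := by
      intro x hx
      rw [Multiset.mem_toFinset, mem_roots hne]
      simpa using hx
    have h3 := (Finset.card_le_card h1).trans ((Multiset.toFinset_card_le _).trans (card_roots' _))
    rwa [hdeg] at h3
  have : 1 ≤ p ^ μ := Nat.one_le_pow _ _ (by omega)
  nlinarith

/-- bound for Kloosterman sums over extension -/
theorem kl_ext_bound {F : Type*} [Field F] [Fintype F] [DecidableEq F] {p : ℕ} [Fact p.Prime] [Algebra (ZMod p) F]
    (hp2 : p ≠ 2) (μ : ℕ) (hcard : Fintype.card F = (p ^ μ) ^ 2) (hbig : 8 * p + 8 ≤ p ^ μ)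
    (b : F) (hb : b ≠ 0) (ψ : AddChar (ZMod p) ℂ) (hψ : ψ ≠ 1) :
    ‖∑ x ∈ Finset.univ.filter (fun x : F => x ≠ 0), ψ (Algebra.trace (ZMod p) F (x + b * x⁻¹))‖ ≤
      (14 * p + 11) * (p : ℝ) ^ μ := by
  set N : ZMod p → ℕ := fun t =>
    (Finset.univ.filter (fun x : F => x ≠ 0 ∧ Algebra.trace (ZMod p) F (x + b * x⁻¹) = t)).card with hN
  have hp0 : (0 : ℝ) < p := by exact_mod_cast (Fact.out : p.Prime).pos
  have hp1 : 1 < p := (Fact.out : p.Prime).one_lt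
  set M : ℝ := ((p : ℝ) ^ μ) ^ 2 / p + (14 * p + 10) * (p : ℝ) ^ μ / p with hM
  have hNM : ∀ t, (N t : ℝ) ≤ M := by
    intro t
    have := kl_count_bound (F := F) (p := p) hp2 μ hcard hbig b hb t
    rw [hM, ← add_div, le_div_iff₀ hp0, mul_comm]
    exact_mod_cast this
  have hsumN : ∑ t, (N t : ℝ) = ((p : ℝ) ^ μ) ^ 2 - 1 := by
    have h1 : (Finset.univ.filter (fun x : F => x ≠ 0)).card = ∑ t, N t := by
      rw [Finset.card_eq_sum_card_fiberwise (f := fun x => Algebra.trace (ZMod p) F (x + b * x⁻¹)) (t := Finset.univ) (fun _ _ => Finset.mem_univ _)]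
      apply Finset.sum_congr rfl
      intro t _
      rw [hN, Finset.filter_filter]
    have h2 : (Finset.univ.filter (fun x : F => x ≠ 0)).card + 1 = (p ^ μ) ^ 2 := by
      rw [Finset.filter_ne', Finset.card_erase_of_mem (Finset.mem_univ _), Finset.card_univ, hcard]
      have : 1 ≤ (p ^ μ)^2 := Nat.one_le_pow _ _ (Nat.pow_pos (by omega))
      omega
    rw [h1] at h2
    have : (∑ t, (N t : ℝ)) + 1 = ((p : ℝ) ^ μ) ^ 2 := by exact_mod_cast h2
    linarith
  have hsum : ∑ x ∈ Finset.univ.filter (fun x : F => x ≠ 0), ψ (Algebra.trace (ZMod p) F (x + b * x⁻¹)) =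
      ∑ t, ((N t : ℝ) - M : ℝ) * ψ t := by
    have h0 : ∑ t, (M : ℂ) * ψ t = 0 := by
      rw [← Finset.mul_sum, AddChar.sum_eq_zero_of_ne_one hψ, mul_zero]
    have h1 : ∑ x ∈ Finset.univ.filter (fun x : F => x ≠ 0), ψ (Algebra.trace (ZMod p) F (x + b * x⁻¹)) =
        ∑ t, (N t : ℂ) * ψ t := by
      rw [← Finset.sum_fiberwise_of_maps_to (g := fun x => Algebra.trace (ZMod p) F (x + b * x⁻¹)) (t := Finset.univ) (fun _ _ => Finset.mem_univ _)]
      apply Finset.sum_congr rfl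
      intro t _
      rw [Finset.filter_filter, hN, ← nsmul_eq_mul]
      apply Finset.sum_eq_card_nsmul
      intro x hx
      simp only [Finset.mem_filter, Finset.mem_univ, true_and] at hx
      rw [hx.2]
    rw [h1, ← sub_zero (∑ t, (N t : ℂ) * ψ t), ← h0, ← Finset.sum_sub_distrib]
    apply Finset.sum_congr rfl
    intro t _
    push_cast; ring
  rw [hsum]
  calc _ ≤ ∑ t, ‖(((N t : ℝ) - M : ℝ) : ℂ) * ψ t‖ := norm_sum_le _ _
    _ = ∑ t, (M - N t) := by
      apply Finset.sum_congr rfl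
      intro t _
      rw [norm_mul, AddChar.norm_apply, mul_one, Complex.norm_real, Real.norm_eq_abs, abs_sub_comm,
        abs_of_nonneg (by linarith [hNM t])]
    _ = p * M - (((p : ℝ) ^ μ) ^ 2 - 1) := by
      rw [Finset.sum_sub_distrib, hsumN]; simp [ZMod.card]
    _ = (14 * p + 10) * (p : ℝ) ^ μ + 1 := by
      rw [hM]; field_simp; ring
    _ ≤ _ := by
      have : (1 : ℝ) ≤ (p : ℝ) ^ μ := one_le_pow₀ (by exact_mod_cast hp1.le)
      linarith


section klC
open Polynomial

theorem kl_mon_finite (k : Type*) [Field k] [Fintype k] (n : ℕ) :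
    {h : k[X] | h.Monic ∧ h.natDegree = n}.Finite := by
  have : Finite (degreeLT k (n + 1)) := Finite.of_equiv _ (degreeLTEquiv k (n + 1)).toEquiv.symm
  refine Set.Finite.subset (s := (degreeLT k (n+1) : Set k[X])) (Set.toFinite _) ?_
  rintro h ⟨hm, hn⟩
  rw [SetLike.mem_coe, mem_degreeLT, degree_eq_natDegree hm.ne_zero, hn]
  exact_mod_cast Nat.lt_succ_self n

def klMon (k : Type*) [Field k] [Fintype k] (n : ℕ) : Finset k[X] := (kl_mon_finite k n).toFinset

open Classical in
def klIrr (k : Type*) [Field k] [Fintype k] (n : ℕ) : Finset k[X] := (klMon k n).filter Irreducible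

theorem mem_klMon {k : Type*} [Field k] [Fintype k] {n : ℕ} {h : k[X]} :
    h ∈ klMon k n ↔ h.Monic ∧ h.natDegree = n := by simp [klMon]

theorem mem_klIrr {k : Type*} [Field k] [Fintype k] {n : ℕ} {h : k[X]} :
    h ∈ klIrr k n ↔ (h.Monic ∧ h.natDegree = n) ∧ Irreducible h := by
  classical
  simp [klIrr, mem_klMon]

open Classical in
def klLam {k : Type*} [Field k] (ψ : AddChar k ℂ) (b : k) (h : k[X]) : ℂ :=
  if h.coeff 0 = 0 then 0 else ψ (-h.nextCoeff - b * (h.coeff 1 / h.coeff 0))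

theorem klLam_one {k : Type*} [Field k] (ψ : AddChar k ℂ) (b : k) : klLam ψ b 1 = 1 := by
  have h1 : (1 : k[X]).nextCoeff = 0 := by
    have := nextCoeff_C_eq_zero (1 : k)
    simpa using this
  simp [klLam, h1, coeff_one]

theorem klLam_mul {k : Type*} [Field k] (ψ : AddChar k ℂ) (b : k) {g h : k[X]}
    (hg : g.Monic) (hh : h.Monic) : klLam ψ b (g * h) = klLam ψ b g * klLam ψ b h := by
  unfold klLam
  rw [hg.nextCoeff_mul hh, mul_coeff_zero, mul_coeff_one]
  by_cases h1 : g.coeff 0 = 0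
  · simp [h1]
  by_cases h2 : h.coeff 0 = 0
  · simp [h2]
  rw [if_neg (mul_ne_zero h1 h2), if_neg h1, if_neg h2, ← AddChar.map_add_eq_mul]
  congr 1
  field_simp
  ring

theorem klLam_pow {k : Type*} [Field k] (ψ : AddChar k ℂ) (b : k) {g : k[X]}
    (hg : g.Monic) (j : ℕ) : klLam ψ b (g ^ j) = klLam ψ b g ^ j := by
  induction j with
  | zero => simp [klLam_one]
  | succ j ih => rw [pow_succ, klLam_mul ψ b (hg.pow j) hg, ih, pow_succ]

def klc {k : Type*} [Field k] [Fintype k] (ψ : AddChar k ℂ) (b : k) (n : ℕ) : ℂ :=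
  ∑ h ∈ klMon k n, klLam ψ b h

theorem klc_zero {k : Type*} [Field k] [Fintype k] (ψ : AddChar k ℂ) (b : k) : klc ψ b 0 = 1 := by
  have : klMon k 0 = {1} := by
    ext h
    rw [mem_klMon, Finset.mem_singleton]
    constructor
    · rintro ⟨h1, h2⟩; exact eq_one_of_monic_natDegree_zero h1 h2
    · rintro rfl; simp
  rw [klc, this, Finset.sum_singleton, klLam_one]

theorem klc_ge_three {k : Type*} [Field k] [Fintype k] (ψ : AddChar k ℂ) (hψ : ψ ≠ 1) (b : k) (n : ℕ)
    (hn : 3 ≤ n) : klc ψ b n = 0 := by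
  obtain ⟨u, hu⟩ := AddChar.ne_one_iff.1 hψ
  have hlt : ∀ v : k, (C v * X ^ (n - 1) : k[X]).natDegree < n := fun v =>
    lt_of_le_of_lt (natDegree_C_mul_X_pow_le v (n-1)) (by omega)
  have hmem : ∀ (v : k) (h : k[X]), h ∈ klMon k n → h + C v * X ^ (n - 1) ∈ klMon k n := by
    intro v h hh
    rw [mem_klMon] at hh ⊢
    obtain ⟨h1, h2⟩ := hh
    have hd : (C v * X ^ (n - 1) : k[X]).natDegree < h.natDegree := by rw [h2]; exact hlt v
    have hd' : (C v * X ^ (n - 1) : k[X]).degree < h.degree := degree_lt_degree hd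
    exact ⟨h1.add_of_left hd', by rw [natDegree_add_eq_left_of_natDegree_lt hd, h2]⟩
  have key : klc ψ b n = ψ u * klc ψ b n := by
    unfold klc
    rw [Finset.mul_sum]
    symm
    refine Finset.sum_nbij' (fun h => h + C (-u) * X ^ (n - 1)) (fun h => h + C u * X ^ (n - 1))
      (hmem _) (hmem _) ?_ ?_ ?_
    · intro h _; simp
    · intro h _; simp
    · intro h hh
      have hh' := hmem (-u) h hh
      rw [mem_klMon] at hh hh'
      unfold klLam
      have c0 : (h + C (-u) * X ^ (n - 1)).coeff 0 = h.coeff 0 := by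
        rw [coeff_add, coeff_C_mul_X_pow, if_neg (by omega), add_zero]
      have c1 : (h + C (-u) * X ^ (n - 1)).coeff 1 = h.coeff 1 := by
        rw [coeff_add, coeff_C_mul_X_pow, if_neg (by omega), add_zero]
      have c2 : (h + C (-u) * X ^ (n - 1)).nextCoeff = h.nextCoeff - u := by
        rw [nextCoeff_of_natDegree_pos (by omega), nextCoeff_of_natDegree_pos (by omega), hh.2, hh'.2,
          coeff_add, coeff_C_mul_X_pow, if_pos rfl]; ring
      rw [c0, c1, c2]
      split_ifs with h0
      · simp
      · rw [← AddChar.map_add_eq_mul]; congr 1; ring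
  have : (1 - ψ u) * klc ψ b n = 0 := by linear_combination key
  rcases mul_eq_zero.1 this with h | h
  · exact absurd (sub_eq_zero.1 h).symm hu
  · exact h

theorem klc_two {k : Type*} [Field k] [Fintype k] (ψ : AddChar k ℂ) (hψ : ψ.IsPrimitive) (b : k) (hb : b ≠ 0) :
    klc ψ b 2 = Fintype.card k := by
  classical
  have hmon : ∀ a c : k, (X ^ 2 + (C a * X + C c) : k[X]).Monic ∧ (X ^ 2 + (C a * X + C c) : k[X]).natDegree = 2 := by
    intro a c
    have hd : (C a * X + C c : k[X]).degree < 2 := lt_of_le_of_lt degree_linear_le (by norm_num)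
    have h1 : (X ^ 2 + (C a * X + C c) : k[X]).Monic := monic_X_pow_add hd
    refine ⟨h1, ?_⟩
    apply natDegree_eq_of_degree_eq_some
    rw [degree_add_eq_left_of_degree_lt (by rw [degree_X_pow]; exact hd), degree_X_pow]
  have h1 : klc ψ b 2 = ∑ z : k × k, (if z.2 = 0 then 0 else ψ (z.1 * (-1 - b / z.2))) := by
    unfold klc
    refine Finset.sum_bij' (fun h _ => (h.coeff 1, h.coeff 0)) (fun z _ => X ^ 2 + (C z.1 * X + C z.2))
      (fun _ _ => Finset.mem_univ _) ?_ ?_ ?_ ?_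
    · rintro ⟨a, c⟩ _
      rw [mem_klMon]; exact hmon a c
    · intro h hh
      rw [mem_klMon] at hh
      dsimp only
      conv_rhs => rw [hh.1.as_sum, hh.2]
      simp [Finset.sum_range_succ]; ring
    · rintro ⟨a, c⟩ _
      simp [coeff_X, coeff_C, coeff_X_pow]
    · intro h hh
      rw [mem_klMon] at hh
      unfold klLam
      rw [nextCoeff_of_natDegree_pos (by omega), hh.2]
      dsimp only
      split_ifs with h0
      · rfl
      · congr 1; field_simp
  rw [h1, Fintype.sum_prod_type_right]
  have h2 : ∀ c : k, (∑ a : k, (if c = 0 then 0 else ψ (a * (-1 - b / c)))) =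
      if c = -b then (Fintype.card k : ℂ) else 0 := by
    intro c
    by_cases hc : c = 0
    · rw [if_neg (by rw [hc]; intro h; exact hb (by simpa using h.symm))]
      simp [hc]
    simp only [if_neg hc]
    rw [AddChar.sum_mulShift _ hψ]
    have : (-1 - b / c = 0) ↔ c = -b := by
      constructor
      · intro h; field_simp at h; linear_combination -h
      · intro h; rw [h]; field_simp; ring
    simp only [this]
    push_cast; rfl
  rw [Finset.sum_congr rfl (fun c _ => h2 c)]
  simp

open Classical in
theorem kl_sum_deg {k : Type*} [Field k] [Fintype k] (n : ℕ) (h : k[X]) (hh : h ∈ klMon k n) :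
    ∑ m ∈ Finset.Icc 1 n, ∑ d ∈ m.divisors, ∑ P ∈ klIrr k d, (if P ^ (m / d) ∣ h then (d : ℂ) else 0) = n := by
  rw [mem_klMon] at hh
  obtain ⟨hm, hn⟩ := hh
  have hne := hm.ne_zero
  have hswap : ∑ m ∈ Finset.Icc 1 n, ∑ d ∈ m.divisors, ∑ P ∈ klIrr k d, (if P ^ (m / d) ∣ h then (d : ℂ) else 0)
     = ∑ d ∈ Finset.Icc 1 n, ∑ P ∈ klIrr k d, ∑ m ∈ (Finset.Icc 1 n).filter (fun m => d ∣ m),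
        (if P ^ (m / d) ∣ h then (d : ℂ) else 0) := by
    rw [Finset.sum_comm' (t' := Finset.Icc 1 n) (s' := fun d => (Finset.Icc 1 n).filter (fun m => d ∣ m))]
    · apply Finset.sum_congr rfl
      intro d _
      rw [Finset.sum_comm]
    · intro m d
      simp only [Finset.mem_Icc, Nat.mem_divisors, Finset.mem_filter]
      constructor
      · rintro ⟨⟨h1, h2⟩, h3, h4⟩
        exact ⟨⟨⟨h1, h2⟩, h3⟩, Nat.pos_of_dvd_of_pos h3 h1, (Nat.le_of_dvd h1 h3).trans h2⟩
      · rintro ⟨⟨⟨h1, h2⟩, h3⟩, h4, h5⟩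
        exact ⟨⟨h1, h2⟩, h3, by omega⟩
  rw [hswap]
  have hinner : ∀ d ∈ Finset.Icc 1 n, ∀ P ∈ klIrr k d, ∑ m ∈ (Finset.Icc 1 n).filter (fun m => d ∣ m),
        (if P ^ (m / d) ∣ h then (d : ℂ) else 0) =
        ((P.natDegree * (UniqueFactorizationMonoid.normalizedFactors h).count P : ℕ) : ℂ) := by
    intro d hd P hP
    rw [mem_klIrr] at hP
    obtain ⟨⟨hPm, hPd⟩, hPi⟩ := hP
    rw [Finset.mem_Icc] at hd
    set ct := (UniqueFactorizationMonoid.normalizedFactors h).count P with hct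
    have hdiv : ∀ j, P ^ j ∣ h ↔ j ≤ ct := by
      intro j
      rw [pow_dvd_iff_le_emultiplicity, UniqueFactorizationMonoid.emultiplicity_eq_count_normalizedFactors hPi hne,
        hPm.normalize_eq_self]
      exact_mod_cast Iff.rfl
    rw [← Finset.sum_filter, Finset.sum_const, nsmul_eq_mul, hPd]
    have hset : ((Finset.Icc 1 n).filter (fun m => d ∣ m)).filter (fun m => P ^ (m / d) ∣ h) =
        (Finset.Icc 1 ct).image (fun j => d * j) := by
      ext m
      simp only [Finset.mem_filter, Finset.mem_Icc, Finset.mem_image]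
      constructor
      · rintro ⟨⟨⟨h1, h2⟩, j, rfl⟩, h4⟩
        rw [Nat.mul_div_cancel_left _ (by omega), hdiv] at h4
        refine ⟨j, ⟨?_, h4⟩, rfl⟩
        rcases Nat.eq_zero_or_pos j with h | h
        · subst h; simp at h1
        · exact h
      · rintro ⟨j, ⟨h1, h2⟩, rfl⟩
        rw [Nat.mul_div_cancel_left _ (by omega), hdiv]
        have h3 := natDegree_le_of_dvd ((hdiv j).2 h2) hne
        rw [hPm.natDegree_pow, hPd, hn] at h3
        refine ⟨⟨⟨?_, by rw [mul_comm]; exact h3⟩, dvd_mul_right _ _⟩, h2⟩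
        exact Nat.mul_pos (by omega) h1
    rw [hset, Finset.card_image_of_injective _ (fun a b hab => Nat.eq_of_mul_eq_mul_left (by omega) hab)]
    simp; ring
  rw [Finset.sum_congr rfl (fun d hd => Finset.sum_congr rfl (hinner d hd))]
  norm_cast
  rw [← Finset.sum_biUnion]
  · have hprod := UniqueFactorizationMonoid.prod_normalizedFactors_eq hne
    rw [hm.normalize_eq_self] at hprod
    have hmon : ∀ P ∈ UniqueFactorizationMonoid.normalizedFactors h, P.Monic := by
      intro P hP
      have h1 := UniqueFactorizationMonoid.normalize_normalized_factor P hP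
      rw [← h1]
      exact monic_normalize (UniqueFactorizationMonoid.irreducible_of_normalized_factor P hP).ne_zero
    have hdeg : n = ((UniqueFactorizationMonoid.normalizedFactors h).map natDegree).sum := by
      rw [← natDegree_multiset_prod_of_monic _ hmon, hprod, hn]
    conv_rhs => rw [hdeg, Finset.sum_multiset_map_count]
    symm
    simp only [smul_eq_mul, mul_comm]
    apply Finset.sum_subset
    · intro P hP
      rw [Multiset.mem_toFinset] at hP
      have hi := UniqueFactorizationMonoid.irreducible_of_normalized_factor P hP
      have hdvd := UniqueFactorizationMonoid.dvd_of_mem_normalizedFactors hP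
      rw [Finset.mem_biUnion]
      refine ⟨P.natDegree, ?_, mem_klIrr.2 ⟨⟨hmon P hP, rfl⟩, hi⟩⟩
      rw [Finset.mem_Icc]
      exact ⟨hi.natDegree_pos, by rw [← hn]; exact natDegree_le_of_dvd hdvd hne⟩
    · intro P _ hP
      rw [Multiset.mem_toFinset] at hP
      rw [Multiset.count_eq_zero_of_notMem hP, mul_zero]
  · intro d _ d' _ hdd
    rw [Function.onFun, Finset.disjoint_left]
    intro P hP hP'
    rw [mem_klIrr] at hP hP'
    exact hdd (hP.1.2.symm.trans hP'.1.2)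

def klW {k : Type*} [Field k] [Fintype k] (ψ : AddChar k ℂ) (b : k) (m : ℕ) : ℂ :=
  ∑ d ∈ m.divisors, ∑ P ∈ klIrr k d, (d : ℂ) * klLam ψ b P ^ (m / d)

theorem kl_newton {k : Type*} [Field k] [Fintype k] (ψ : AddChar k ℂ) (b : k) (n : ℕ) :
    n * klc ψ b n = ∑ m ∈ Finset.Icc 1 n, klW ψ b m * klc ψ b (n - m) := by
  classical
  have h1 : n * klc ψ b n = ∑ h ∈ klMon k n, ∑ m ∈ Finset.Icc 1 n, ∑ d ∈ m.divisors, ∑ P ∈ klIrr k d,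
      (if P ^ (m / d) ∣ h then (d : ℂ) * klLam ψ b h else 0) := by
    unfold klc
    rw [Finset.mul_sum]
    apply Finset.sum_congr rfl
    intro h hh
    conv_lhs => rw [← kl_sum_deg n h hh]
    simp only [Finset.sum_mul, ite_mul, zero_mul]
  rw [h1, Finset.sum_comm]
  apply Finset.sum_congr rfl
  intro m hm
  rw [Finset.mem_Icc] at hm
  rw [Finset.sum_comm, klW, Finset.sum_mul]
  apply Finset.sum_congr rfl
  intro d hd
  rw [Nat.mem_divisors] at hd
  rw [Finset.sum_comm, Finset.sum_mul]
  apply Finset.sum_congr rfl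
  intro P hP
  rw [mem_klIrr] at hP
  obtain ⟨⟨hPm, hPd⟩, hPi⟩ := hP
  rw [← Finset.sum_filter, klc, Finset.mul_sum]
  symm
  have hdeg : (P ^ (m / d)).natDegree = m := by
    rw [hPm.natDegree_pow, hPd, Nat.div_mul_cancel hd.1]
  refine Finset.sum_bij (fun g _ => P ^ (m / d) * g) ?_ ?_ ?_ ?_
  · intro g hg
    rw [mem_klMon] at hg
    rw [Finset.mem_filter, mem_klMon]
    refine ⟨⟨(hPm.pow _).mul hg.1, ?_⟩, dvd_mul_right _ _⟩
    rw [(hPm.pow _).natDegree_mul hg.1, hdeg, hg.2]; omega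
  · intro g _ g' _ h
    exact mul_left_cancel₀ (hPm.pow _).ne_zero h
  · intro h hh
    rw [Finset.mem_filter, mem_klMon] at hh
    obtain ⟨⟨h1, h2⟩, g, rfl⟩ := hh
    have hgm : g.Monic := (hPm.pow _).of_mul_monic_left h1
    refine ⟨g, ?_, rfl⟩
    rw [mem_klMon]
    refine ⟨hgm, ?_⟩
    rw [(hPm.pow _).natDegree_mul hgm, hdeg] at h2
    omega
  · intro g hg
    rw [mem_klMon] at hg
    rw [klLam_mul ψ b (hPm.pow _) hg.1, klLam_pow ψ b hPm]; ring
end klC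


section klD
open Polynomial

theorem kl_minpoly_inv {k F : Type*} [Field k] [Field F] [Algebra k F] [FiniteDimensional k F] (x : F) (hx : x ≠ 0) :
    (minpoly k x⁻¹).nextCoeff = (minpoly k x).coeff 1 / (minpoly k x).coeff 0 ∧
    (minpoly k x⁻¹).natDegree = (minpoly k x).natDegree := by
  have hinteg : IsIntegral k x := .of_finite k x
  have hinteg' : IsIntegral k x⁻¹ := .of_finite k _
  set P := minpoly k x with hP
  have hP0 : P.coeff 0 ≠ 0 := minpoly.coeff_zero_ne_zero hinteg hx
  have hdeg : (minpoly k x⁻¹).natDegree = P.natDegree := by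
    rw [hP, ← IntermediateField.adjoin.finrank hinteg, ← IntermediateField.adjoin.finrank hinteg']
    have : IntermediateField.adjoin k {x⁻¹} = IntermediateField.adjoin k {x} := by
      apply le_antisymm
      · rw [IntermediateField.adjoin_simple_le_iff]
        exact inv_mem (IntermediateField.mem_adjoin_simple_self k x)
      · rw [IntermediateField.adjoin_simple_le_iff]
        have := inv_mem (IntermediateField.mem_adjoin_simple_self k x⁻¹)
        rwa [inv_inv] at this
    rw [this]
  refine ⟨?_, hdeg⟩
  have hrd : P.reverse.natDegree = P.natDegree := by
    rw [reverse_natDegree, natTrailingDegree_eq_zero.2 (Or.inr hP0), Nat.sub_zero]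
  have hpos : 0 < P.natDegree := minpoly.natDegree_pos hinteg
  have hrl : P.reverse.leadingCoeff = P.coeff 0 := by
    rw [leadingCoeff, hrd, coeff_reverse]; simp
  have hmon : (C (P.coeff 0)⁻¹ * P.reverse).Monic := by
    rw [Monic, leadingCoeff_mul, hrl, leadingCoeff_C, inv_mul_cancel₀ hP0]
  have hnd : (C (P.coeff 0)⁻¹ * P.reverse).natDegree = P.natDegree := by
    rw [natDegree_C_mul (inv_ne_zero hP0), hrd]
  have hev : aeval x⁻¹ (C (P.coeff 0)⁻¹ * P.reverse) = 0 := by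
    rw [map_mul]
    have : aeval x⁻¹ P.reverse = 0 := by
      letI : Invertible x := invertibleOfNonzero hx
      have h1 := (eval₂_reverse_eq_zero_iff (algebraMap k F) x P).2 (by
        have := minpoly.aeval k x
        rwa [aeval_def] at this)
      rw [invOf_eq_inv] at h1
      rw [aeval_def]; exact h1
    rw [this, mul_zero]
  have heq : C (P.coeff 0)⁻¹ * P.reverse = minpoly k x⁻¹ := by
    apply minpoly.unique' k x⁻¹ hmon hev
    intro q hq
    by_contra hcon
    push Not at hcon
    have h1 := natDegree_le_natDegree (minpoly.degree_le_of_ne_zero k x⁻¹ hcon.1 hcon.2)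
    rw [hdeg] at h1
    have h2 := natDegree_lt_natDegree hcon.1 hq
    omega
  rw [← heq, nextCoeff_of_natDegree_pos (by omega), hnd, coeff_C_mul, coeff_reverse,
    revAt_le (by omega), show P.natDegree - (P.natDegree - 1) = 1 by omega, div_eq_inv_mul]

theorem kl_W_eq {k F : Type*} [Field k] [Fintype k] [Field F] [Fintype F] [DecidableEq F] [Algebra k F]
    (ψ : AddChar k ℂ) (b : k) :
    ∑ x ∈ Finset.univ.filter (fun x : F => x ≠ 0), ψ (Algebra.trace k F (x + algebraMap k F b * x⁻¹)) =
    klW ψ b (Module.finrank k F) := by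
  classical
  set m := Module.finrank k F with hm
  have hmpos : 0 < m := Module.finrank_pos
  have hdvd : ∀ x : F, (minpoly k x).natDegree ∣ m := fun x => minpoly.degree_dvd (.of_finite k x)
  have hfr : ∀ x : F, Module.finrank (IntermediateField.adjoin k {x}) F = m / (minpoly k x).natDegree := by
    intro x
    rw [← IntermediateField.adjoin.finrank (.of_finite k x), hm,
      ← Module.finrank_mul_finrank k (IntermediateField.adjoin k {x}) F,
      Nat.mul_div_cancel_left _ Module.finrank_pos]
  have hterm : ∀ x : F, x ≠ 0 → ψ (Algebra.trace k F (x + algebraMap k F b * x⁻¹)) =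
      klLam ψ b (minpoly k x) ^ (m / (minpoly k x).natDegree) := by
    intro x hx
    obtain ⟨h1, h2⟩ := kl_minpoly_inv (k := k) x hx
    have hP0 : (minpoly k x).coeff 0 ≠ 0 := minpoly.coeff_zero_ne_zero (.of_finite k x) hx
    rw [klLam, if_neg hP0, ← AddChar.map_nsmul_eq_pow]
    congr 1
    rw [map_add, ← Algebra.smul_def, map_smul, trace_eq_finrank_mul_minpoly_nextCoeff,
      trace_eq_finrank_mul_minpoly_nextCoeff, hfr, hfr, h1, h2]
    rw [nsmul_eq_mul, smul_eq_mul]; ring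
  have hsum : ∑ x ∈ Finset.univ.filter (fun x : F => x ≠ 0), ψ (Algebra.trace k F (x + algebraMap k F b * x⁻¹)) =
      ∑ x : F, klLam ψ b (minpoly k x) ^ (m / (minpoly k x).natDegree) := by
    rw [Finset.sum_filter]
    apply Finset.sum_congr rfl
    intro x _
    split_ifs with hx
    · exact hterm x hx
    · push Not at hx
      rw [hx, minpoly.zero, natDegree_X, Nat.div_one, klLam, if_pos (by simp), zero_pow hmpos.ne']
  rw [hsum, klW]
  rw [← Finset.sum_fiberwise_of_maps_to (g := fun x : F => minpoly k x)
    (t := m.divisors.biUnion (fun d => klIrr k d))]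
  · rw [Finset.sum_biUnion]
    · apply Finset.sum_congr rfl
      intro d hd
      apply Finset.sum_congr rfl
      intro P hP
      rw [Nat.mem_divisors] at hd
      rw [mem_klIrr] at hP
      obtain ⟨⟨hPm, hPd⟩, hPi⟩ := hP
      have hcardF : Nat.card k ^ m = Fintype.card F := by
        rw [hm, Nat.card_eq_fintype_card]; exact (Module.card_eq_pow_finrank (K := k) (V := F)).symm
      have hdv : P ∣ X ^ (Nat.card k ^ m) - X :=
        hPi.natDegree_dvd_iff_dvd_X_pow_card_pow_sub_X.1 (by rw [hPd]; exact hd.1)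
      rw [hcardF] at hdv
      have hdv' : P.map (algebraMap k F) ∣ X ^ Fintype.card F - X := by
        have := map_dvd (mapRingHom (algebraMap k F)) hdv
        simpa using this
      have hX0 : (X ^ Fintype.card F - X : F[X]) ≠ 0 :=
        FiniteField.X_pow_card_sub_X_ne_zero F Fintype.one_lt_card
      have hsplX : (X ^ Fintype.card F - X : F[X]).Splits := by
        rw [splits_iff_card_roots, FiniteField.roots_X_pow_card_sub_X,
          FiniteField.X_pow_card_sub_X_natDegree_eq F Fintype.one_lt_card]
        rfl
      have hspl : (P.map (algebraMap k F)).Splits := hsplX.of_dvd hX0 hdv'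
      have hnd : (P.map (algebraMap k F)).roots.Nodup := by
        have h1 := Polynomial.roots.le_of_dvd hX0 hdv'
        rw [FiniteField.roots_X_pow_card_sub_X] at h1
        exact Multiset.nodup_of_le h1 Finset.univ.nodup
      have hfib : Finset.univ.filter (fun x : F => minpoly k x = P) = (P.map (algebraMap k F)).roots.toFinset := by
        ext x
        rw [Finset.mem_filter, Multiset.mem_toFinset, mem_roots (hPm.map _).ne_zero, IsRoot.def, eval_map_algebraMap]
        constructor
        · rintro ⟨_, rfl⟩; exact minpoly.aeval k x
        · intro h
          exact ⟨Finset.mem_univ _, (minpoly.eq_of_irreducible_of_monic hPi h hPm).symm⟩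
      have hcard : (Finset.univ.filter (fun x : F => minpoly k x = P)).card = d := by
        rw [hfib, Multiset.toFinset_card_of_nodup hnd, splits_iff_card_roots.1 hspl, natDegree_map, hPd]
      rw [Finset.sum_congr rfl (g := fun _ => klLam ψ b P ^ (m / d))]
      · rw [Finset.sum_const, hcard, nsmul_eq_mul]
      · intro x hx
        rw [Finset.mem_filter] at hx
        rw [hx.2, hPd]
    · intro d _ d' _ hdd
      rw [Function.onFun, Finset.disjoint_left]
      intro P hP hP'
      rw [mem_klIrr] at hP hP'
      exact hdd (hP.1.2.symm.trans hP'.1.2)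
  · intro x _
    rw [Finset.mem_biUnion]
    exact ⟨(minpoly k x).natDegree, Nat.mem_divisors.2 ⟨hdvd x, hmpos.ne'⟩,
      mem_klIrr.2 ⟨⟨minpoly.monic (.of_finite k x), rfl⟩, minpoly.irreducible (.of_finite k x)⟩⟩

theorem kl_W_formula {k : Type*} [Field k] [Fintype k] (ψ : AddChar k ℂ) (hψ : ψ.IsPrimitive) (hψ1 : ψ ≠ 1) (b : k) (hb : b ≠ 0)
    (α β : ℂ) (h1 : α + β = - klW ψ b 1) (h2 : α * β = Fintype.card k) :
    ∀ n, 1 ≤ n → klW ψ b n = -(α ^ n + β ^ n) := by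
  have c0 := klc_zero ψ b
  have c1 : klc ψ b 1 = klW ψ b 1 := by
    have := kl_newton ψ b 1
    simpa [c0] using this
  have c2 := klc_two ψ hψ b hb
  intro n
  induction n using Nat.strong_induction_on with
  | _ n ih =>
    intro hn
    rcases (by omega : n = 1 ∨ n = 2 ∨ 3 ≤ n) with rfl | rfl | h3
    · rw [pow_one, pow_one, h1, neg_neg]
    · have := kl_newton ψ b 2
      rw [show Finset.Icc 1 2 = {1, 2} by rfl, Finset.sum_pair (by norm_num)] at this
      simp only [show 2 - 1 = 1 by rfl, Nat.sub_self, c0, c1, c2] at this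
      rw [← h2] at this
      push_cast at this
      have e : klW ψ b 1 = -(α + β) := by rw [h1, neg_neg]
      rw [e] at this
      linear_combination -this
    · have := kl_newton ψ b n
      rw [klc_ge_three ψ hψ1 b n h3, mul_zero] at this
      rw [← Finset.sum_subset (s₁ := {n - 2, n - 1, n})] at this
      · rw [Finset.sum_insert (by simp; omega), Finset.sum_pair (by omega)] at this
        rw [show n - (n - 2) = 2 by omega, show n - (n - 1) = 1 by omega, Nat.sub_self, c0, c1, c2, ← h2,
          ih (n - 2) (by omega) (by omega), ih (n - 1) (by omega) (by omega)] at this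
        have e : klW ψ b 1 = -(α + β) := by rw [h1, neg_neg]
        rw [e] at this
        obtain ⟨l, rfl⟩ : ∃ l, n = l + 2 := ⟨n - 2, by omega⟩
        simp only [show l + 2 - 2 = l by omega, show l + 2 - 1 = l + 1 by omega] at this
        linear_combination -this
      · intro x hx
        simp only [Finset.mem_insert, Finset.mem_singleton] at hx
        rw [Finset.mem_Icc]; omega
      · intro x hx hx'
        simp only [Finset.mem_insert, Finset.mem_singleton, not_or] at hx'
        rw [Finset.mem_Icc] at hx
        rw [klc_ge_three ψ hψ1 b (n - x) (by omega), mul_zero]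

theorem kl_root_bound (p : ℕ) (hp : 1 < p) (α β : ℂ) (C : ℝ) (N : ℕ) (h2 : α * β = p)
    (hb : ∀ μ, N ≤ μ → ‖α ^ (2 * μ) + β ^ (2 * μ)‖ ≤ C * (p : ℝ) ^ μ) : ‖α‖ ≤ √p := by
  by_contra! hcon
  have hp0 : (0 : ℝ) < p := by positivity
  have hsq : (p : ℝ) < ‖α‖ ^ 2 := by
    rw [Real.sqrt_lt' (lt_of_le_of_lt (Real.sqrt_nonneg _) hcon)] at hcon
    exact hcon
  have hab : ‖α‖ * ‖β‖ = p := by rw [← norm_mul, h2]; simp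
  have hβ : ‖β‖ ^ 2 ≤ p := by
    have : (‖α‖ * ‖β‖) ^ 2 = (p : ℝ) ^ 2 := by rw [hab]
    rw [mul_pow] at this
    by_contra! h
    nlinarith
  have hkey : ∀ μ, N ≤ μ → (‖α‖ ^ 2 / p) ^ μ ≤ C + 1 := by
    intro μ hμ
    have h := hb μ hμ
    have h3 : ‖α‖ ^ (2 * μ) ≤ ‖α ^ (2 * μ) + β ^ (2 * μ)‖ + ‖β‖ ^ (2 * μ) := by
      have := norm_sub_le (α ^ (2 * μ) + β ^ (2 * μ)) (β ^ (2 * μ))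
      rw [add_sub_cancel_right, norm_pow, norm_pow] at this
      exact this
    have h4 : ‖β‖ ^ (2 * μ) ≤ (p : ℝ) ^ μ := by
      rw [pow_mul]; exact pow_le_pow_left₀ (by positivity) hβ μ
    rw [div_pow, div_le_iff₀ (by positivity), ← pow_mul]
    linarith
  have hgt : 1 < ‖α‖ ^ 2 / p := by rwa [one_lt_div hp0]
  have ht := tendsto_pow_atTop_atTop_of_one_lt hgt
  obtain ⟨M, hM⟩ := (Filter.tendsto_atTop.1 ht (C + 2)).exists_forall_of_atTop
  have h5 := hM (max M N) (le_max_left _ _)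
  have h6 := hkey (max M N) (le_max_right _ _)
  linarith

theorem kl_prime {p : ℕ} [Fact p.Prime] (hp2 : p ≠ 2) (ψ : AddChar (ZMod p) ℂ) (hψ : ψ ≠ 1)
    (b : ZMod p) (hb : b ≠ 0) :
    ‖∑ x ∈ Finset.univ.filter (fun x : ZMod p => x ≠ 0), ψ (x + b * x⁻¹)‖ ≤ 2 * √p := by
  classical
  have hprim : ψ.IsPrimitive := AddChar.IsPrimitive.of_ne_one hψ
  have hp1 : 1 < p := (Fact.out : p.Prime).one_lt
  have hW1 : ∑ x ∈ Finset.univ.filter (fun x : ZMod p => x ≠ 0), ψ (x + b * x⁻¹) = klW ψ b 1 := by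
    have := kl_W_eq (k := ZMod p) (F := ZMod p) ψ b
    rw [Module.finrank_self] at this
    rw [← this]
    apply Finset.sum_congr rfl
    intro x _
    rw [Algebra.trace_self_apply]; rfl
  obtain ⟨δ, hδ⟩ := IsAlgClosed.exists_pow_nat_eq ((klW ψ b 1) ^ 2 - 4 * p : ℂ) (n := 2) (by norm_num)
  set α : ℂ := (-(klW ψ b 1) + δ) / 2 with hα
  set β : ℂ := (-(klW ψ b 1) - δ) / 2 with hβ
  have h1 : α + β = - klW ψ b 1 := by rw [hα, hβ]; ring
  have h2 : α * β = p := by rw [hα, hβ]; linear_combination (-1/4) * hδ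
  have hform := kl_W_formula ψ hprim hψ b hb α β h1 (by rw [h2, ZMod.card])
  have hbound : ∀ μ, 8 * p + 8 ≤ μ → ‖α ^ (2 * μ) + β ^ (2 * μ)‖ ≤ (14 * p + 11 : ℝ) * (p : ℝ) ^ μ := by
    intro μ hμ
    have hne : 2 * μ ≠ 0 := by omega
    letI : Fintype (GaloisField p (2 * μ)) := Fintype.ofFinite _
    have hfin : Module.finrank (ZMod p) (GaloisField p (2 * μ)) = 2 * μ := GaloisField.finrank p hne
    have hcard : Fintype.card (GaloisField p (2 * μ)) = (p ^ μ) ^ 2 := by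
      rw [← Nat.card_eq_fintype_card, GaloisField.card p _ hne, ← pow_mul, mul_comm]
    have hbig : 8 * p + 8 ≤ p ^ μ := hμ.trans (Nat.lt_pow_self hp1).le
    have hx := kl_ext_bound (F := GaloisField p (2 * μ)) hp2 μ hcard hbig (algebraMap (ZMod p) _ b)
      (by rwa [Ne, map_eq_zero]) ψ hψ
    rw [kl_W_eq, hfin, hform _ (by omega), norm_neg] at hx
    exact hx
  have hA := kl_root_bound p hp1 α β _ _ h2 hbound
  have hB := kl_root_bound p hp1 β α _ _ (by rw [mul_comm, h2]) (fun μ hμ => by rw [add_comm]; exact hbound μ hμ)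
  rw [hW1, ← norm_neg, ← h1]
  calc _ ≤ ‖α‖ + ‖β‖ := norm_add_le _ _
    _ ≤ _ := by linarith
end klD


def klS {R : Type*} [CommRing R] [Fintype R] [DecidableEq R] (ψ : AddChar R ℂ) (a b : R) : ℂ :=
  ∑ u : Rˣ, ψ (a * u + b * (↑u⁻¹ : R))

def klg {R : Type*} [CommRing R] [Fintype R] [DecidableEq R] (b : R) : ℕ :=
  (Finset.univ.filter (fun x : R => b * x = 0)).card

/-- general averaging -/
theorem klS_shift {R : Type*} [CommRing R] [Fintype R] [DecidableEq R] (ψ : AddChar R ℂ) (a b : R)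
    (w w' : R) (hw : w * w' = 1) :
    klS ψ a b = ∑ u : Rˣ, ψ (a * (u * w) + b * ((↑u⁻¹ : R) * w')) := by
  let W : Rˣ := ⟨w, w', hw, by rw [mul_comm, hw]⟩
  have := Equiv.sum_comp (Equiv.mulRight W) (fun u : Rˣ => ψ (a * u + b * (↑u⁻¹ : R)))
  rw [klS, ← this]
  apply Finset.sum_congr rfl
  intro u _
  simp only [Equiv.coe_mulRight, mul_inv_rev, Units.val_mul]
  rw [mul_comm (↑W⁻¹ : R)]
  rfl

theorem klS_E1 {R : Type*} [CommRing R] [Fintype R] [DecidableEq R] (ψ : AddChar R ℂ)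
    (hψ : ψ.IsPrimitive) (a b π : R) (hπ : π * π = 0) :
    ‖klS ψ a b‖ ≤ ((Finset.univ.filter
      (fun u : Rˣ => π * (a * u - b * (↑u⁻¹ : R)) = 0)).card : ℝ) := by
  have h1 : (Fintype.card R : ℂ) * klS ψ a b = ∑ u : Rˣ, ψ (a * u + b * (↑u⁻¹ : R)) *
      ∑ v : R, ψ (v * (π * (a * u - b * (↑u⁻¹ : R)))) := by
    have : (Fintype.card R : ℂ) * klS ψ a b = ∑ v : R, klS ψ a b := by simp
    rw [this]
    simp_rw [Finset.mul_sum]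
    rw [Finset.sum_comm]
    apply Finset.sum_congr rfl
    intro v _
    rw [klS_shift ψ a b (1 + π * v) (1 - π * v) (by linear_combination (-v^2) * hπ)]
    apply Finset.sum_congr rfl
    intro u _
    rw [← AddChar.map_add_eq_mul]
    congr 1
    ring
  simp_rw [AddChar.sum_mulShift _ hψ] at h1
  have hc : (0 : ℝ) < Fintype.card R := by exact_mod_cast Fintype.card_pos
  have h2 : (Fintype.card R : ℝ) * ‖klS ψ a b‖ ≤ (Fintype.card R : ℝ) * ((Finset.univ.filter
      (fun u : Rˣ => π * (a * u - b * (↑u⁻¹ : R)) = 0)).card : ℝ) := by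
    calc (Fintype.card R : ℝ) * ‖klS ψ a b‖ = ‖(Fintype.card R : ℂ) * klS ψ a b‖ := by simp
      _ ≤ _ := by
        rw [h1]
        refine (norm_sum_le _ _).trans ?_
        rw [Finset.card_filter, Nat.cast_sum, Finset.mul_sum]
        apply Finset.sum_le_sum
        intro u _
        rw [norm_mul, AddChar.norm_apply, one_mul]
        split_ifs <;> simp
  exact le_of_mul_le_mul_left h2 hc

theorem kl_gauss {R : Type*} [CommRing R] [Fintype R] [DecidableEq R] (ψ : AddChar R ℂ)
    (hψ : ψ.IsPrimitive) (A B : R) :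
    ‖∑ v : R, ψ (A * v + B * v ^ 2)‖ ^ 2 ≤ (Fintype.card R : ℝ) * klg (2 * B) := by
  have h0 : ((‖∑ v : R, ψ (A * v + B * v ^ 2)‖ ^ 2 : ℝ) : ℂ) = 
      ∑ t : R, ψ (A * t + B * t ^ 2) * ∑ w : R, ψ (w * (2 * B * t)) := by
    push_cast
    rw [← Complex.mul_conj', map_sum, Finset.sum_mul_sum, Finset.sum_comm]
    simp_rw [Finset.mul_sum]
    rw [Finset.sum_comm (s := (Finset.univ : Finset R)) (t := Finset.univ) (f := fun t w => ψ (A * t + B * t ^ 2) * ψ (w * (2 * B * t)))]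
    apply Finset.sum_congr rfl
    intro w _
    rw [← Equiv.sum_comp (Equiv.addRight w)]
    apply Finset.sum_congr rfl
    intro t _
    rw [← AddChar.map_neg_eq_conj, ← AddChar.map_add_eq_mul, ← AddChar.map_add_eq_mul]
    congr 1
    simp only [Equiv.coe_addRight]
    ring
  simp_rw [AddChar.sum_mulShift _ hψ] at h0
  have h1 := congrArg norm h0
  rw [Complex.norm_real, Real.norm_of_nonneg (by positivity)] at h1
  rw [h1]
  refine (norm_sum_le _ _).trans ?_
  rw [klg, Finset.card_filter, Nat.cast_sum, Finset.mul_sum]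
  apply Finset.sum_le_sum
  intro u _
  rw [norm_mul, AddChar.norm_apply, one_mul]
  split_ifs <;> simp

theorem klg_unit_mul {R : Type*} [CommRing R] [Fintype R] [DecidableEq R] (b c : R) (hc : IsUnit c) :
    klg (c * b) = klg b := by
  unfold klg
  congr 1
  ext x
  simp only [Finset.mem_filter, Finset.mem_univ, true_and]
  rw [mul_assoc, hc.mul_right_eq_zero]

theorem klS_E2 {R : Type*} [CommRing R] [Fintype R] [DecidableEq R] (ψ : AddChar R ℂ)
    (hψ : ψ.IsPrimitive) (a b π p : R) (hb : IsUnit b) (hπ : π * π * p = 0) (hπ3 : π * π * π = 0) 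
    (M : ℝ) (hM : 0 ≤ M) (hM2 : (Fintype.card R : ℝ) * klg (2 * (π * π)) ≤ ((Fintype.card R : ℝ) * M) ^ 2) :
    ‖klS ψ a b‖ ≤ M * ((Finset.univ.filter
      (fun u : Rˣ => (π * p) * (a * u - b * (↑u⁻¹ : R)) = 0)).card : ℝ) := by
  have h1 : (Fintype.card R : ℂ) * klS ψ a b = ∑ u : Rˣ, ψ (a * u + b * (↑u⁻¹ : R)) *
      ∑ v : R, ψ ((π * (a * u - b * (↑u⁻¹ : R))) * v + (π * π * b * (↑u⁻¹ : R)) * v ^ 2) := by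
    have : (Fintype.card R : ℂ) * klS ψ a b = ∑ v : R, klS ψ a b := by simp
    rw [this]
    simp_rw [Finset.mul_sum]
    rw [Finset.sum_comm]
    apply Finset.sum_congr rfl
    intro v _
    rw [klS_shift ψ a b (1 + π * v) (1 - π * v + π * π * v ^ 2) (by linear_combination (v^3) * hπ3)]
    apply Finset.sum_congr rfl
    intro u _
    rw [← AddChar.map_add_eq_mul]
    congr 1
    ring
  have hc : (0 : ℝ) < Fintype.card R := by exact_mod_cast Fintype.card_pos
  have hG : ∀ u : Rˣ, ‖∑ v : R, ψ ((π * (a * u - b * (↑u⁻¹ : R))) * v + (π * π * b * (↑u⁻¹ : R)) * v ^ 2)‖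
      ≤ if (π * p) * (a * u - b * (↑u⁻¹ : R)) = 0 then (Fintype.card R : ℝ) * M else 0 := by
    intro u
    split_ifs with h
    · have h2 := kl_gauss ψ hψ (π * (a * u - b * (↑u⁻¹ : R))) (π * π * b * (↑u⁻¹ : R))
      rw [show 2 * (π * π * b * (↑u⁻¹ : R)) = (b * ↑u⁻¹) * (2 * (π * π)) by ring,
        klg_unit_mul _ _ (hb.mul (Units.isUnit _))] at h2
      exact le_of_sq_le_sq (h2.trans hM2) (by positivity)
    · have hs : (Fintype.card R : ℂ) * ∑ v : R, ψ ((π * (a * u - b * (↑u⁻¹ : R))) * v + (π * π * b * (↑u⁻¹ : R)) * v ^ 2) =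
        ∑ v : R, ψ ((π * (a * u - b * (↑u⁻¹ : R))) * v + (π * π * b * (↑u⁻¹ : R)) * v ^ 2) *
          ∑ w : R, ψ (w * ((π * p) * (a * u - b * (↑u⁻¹ : R)))) := by
        have : ∀ z : ℂ, (Fintype.card R : ℂ) * z = ∑ v : R, z := by simp
        rw [this]
        simp_rw [Finset.mul_sum]
        symm
        rw [Finset.sum_comm]
        symm
        apply Finset.sum_congr rfl
        intro w _
        rw [← Equiv.sum_comp (Equiv.addRight (p * w))]
        apply Finset.sum_congr rfl
        intro v _
        rw [← AddChar.map_add_eq_mul]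
        congr 1
        simp only [Equiv.coe_addRight]
        linear_combination (b * ↑u⁻¹ * (2 * v * w + p * w^2)) * hπ
      simp_rw [AddChar.sum_mulShift _ hψ, if_neg h] at hs
      have hcc : (Fintype.card R : ℂ) ≠ 0 := by exact_mod_cast hc.ne'
      simp only [Nat.cast_zero, mul_zero, Finset.sum_const_zero, mul_eq_zero, hcc, false_or] at hs
      rw [hs, norm_zero]
  have h2 : (Fintype.card R : ℝ) * ‖klS ψ a b‖ ≤ (Fintype.card R : ℝ) * (M * ((Finset.univ.filter
      (fun u : Rˣ => (π * p) * (a * u - b * (↑u⁻¹ : R)) = 0)).card : ℝ)) := by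
    calc (Fintype.card R : ℝ) * ‖klS ψ a b‖ = ‖(Fintype.card R : ℂ) * klS ψ a b‖ := by simp
      _ ≤ _ := by
        rw [h1]
        refine (norm_sum_le _ _).trans ?_
        rw [Finset.card_filter, Nat.cast_sum, Finset.mul_sum, Finset.mul_sum]
        apply Finset.sum_le_sum
        intro u _
        rw [norm_mul, AddChar.norm_apply, one_mul]
        refine (hG u).trans ?_
        split_ifs <;> simp
  exact le_of_mul_le_mul_left h2 hc

theorem kl_two_dvd {p : ℕ} (hp : p.Prime) (m : ℕ) (t : ℤ) (h : (p : ℤ) ^ m ∣ (t - 1) * (t + 1)) :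
    (p : ℤ) ^ m ∣ 2 * (t - 1) ∨ (p : ℤ) ^ m ∣ 2 * (t + 1) := by
  have hpi : Prime (p : ℤ) := Nat.prime_iff_prime_int.1 hp
  by_cases h1 : (p : ℤ) ∣ t - 1
  · by_cases h2 : (p : ℤ) ∣ t + 1
    · have h3 : (p : ℤ) ∣ 2 := by
        have := dvd_sub h2 h1
        rwa [show t + 1 - (t - 1) = 2 by ring] at this
      have hp2 : p = 2 := by
        have : p ∣ 2 := by exact_mod_cast h3
        exact (Nat.prime_dvd_prime_iff_eq hp Nat.prime_two).1 this
      subst hp2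
      obtain ⟨x, hx⟩ := h1
      push_cast at *
      obtain rfl : t = 2 * x + 1 := by linarith
      rw [show 2 * x + 1 - 1 = 2 * x by ring, show 2 * x + 1 + 1 = 2 * (x + 1) by ring] at *
      have h2i : Prime (2 : ℤ) := Int.prime_two
      rcases Int.even_or_odd x with he | ho
      · left
        have hodd : ¬ (2 : ℤ) ∣ (x + 1) := by
          obtain ⟨y, hy⟩ := he; omega
        have : (2:ℤ) ^ m ∣ (2 * (2 * x)) * (x + 1) := by convert h using 1; ring
        exact h2i.pow_dvd_of_dvd_mul_right m hodd this
      · right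
        have hodd : ¬ (2 : ℤ) ∣ x := by
          obtain ⟨y, hy⟩ := ho; omega
        have : (2:ℤ) ^ m ∣ x * (2 * (2 * (x + 1))) := by convert h using 1; ring
        exact h2i.pow_dvd_of_dvd_mul_left m hodd this
    · left
      exact Dvd.dvd.mul_left (hpi.pow_dvd_of_dvd_mul_right m h2 h) _
  · right
    exact Dvd.dvd.mul_left (hpi.pow_dvd_of_dvd_mul_left m h1 h) _

theorem klg_nat_le {n : ℕ} [NeZero n] (d : ℕ) (hd : 0 < d) : klg (d : ZMod n) ≤ d := by
  unfold klg
  simpa [nsmul_eq_mul] using IsAddCyclic.card_nsmul_eq_zero_le (α := ZMod n) hd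

theorem kl_count {p : ℕ} [Fact p.Prime] (k j : ℕ) (hj : j ≤ k) (a b : ZMod (p ^ k)) (ha : IsUnit a) :
    (Finset.univ.filter
      (fun u : (ZMod (p ^ k))ˣ => (p : ZMod (p ^ k)) ^ j * (a * u - b * (↑u⁻¹ : ZMod (p^k))) = 0)).card ≤ 4 * p ^ j := by
  have hp : p.Prime := Fact.out
  set S := (Finset.univ.filter
      (fun u : (ZMod (p ^ k))ˣ => (p : ZMod (p ^ k)) ^ j * (a * u - b * (↑u⁻¹ : ZMod (p^k))) = 0)) with hS
  rcases S.eq_empty_or_nonempty with he | ⟨u₀, hu₀⟩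
  · rw [he]; simp
  have hmem : ∀ u ∈ S, (p : ZMod (p ^ k)) ^ j * (a * u * u - b) = 0 := by
    intro u hu
    rw [hS, Finset.mem_filter] at hu
    have := hu.2
    have h1 : (u : ZMod (p^k)) * (↑u⁻¹ : ZMod (p^k)) = 1 := u.mul_inv
    linear_combination (u : ZMod (p^k)) * this + (p : ZMod (p ^ k)) ^ j * b * h1
  have key : ∀ u ∈ S, (p : ZMod (p ^ k)) ^ j * (2 * ((↑(u * u₀⁻¹) : ZMod (p^k)) - 1)) = 0 ∨
      (p : ZMod (p ^ k)) ^ j * (2 * ((↑(u * u₀⁻¹) : ZMod (p^k)) + 1)) = 0 := by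
    intro u hu
    set t : ZMod (p^k) := ↑(u * u₀⁻¹) with ht
    have hut : (u : ZMod (p^k)) = t * u₀ := by rw [ht]; simp
    have h1 := hmem u hu
    have h2 := hmem u₀ hu₀
    have h3 : (a * u₀ * u₀) * ((p : ZMod (p ^ k)) ^ j * ((t - 1) * (t + 1))) = 0 := by
      rw [hut] at h1
      linear_combination h1 - h2
    rw [((ha.mul u₀.isUnit).mul u₀.isUnit).mul_right_eq_zero] at h3
    have conv : ∀ z : ℤ, (p : ZMod (p ^ k)) ^ j * (z : ZMod (p^k)) = 0 ↔ (p : ℤ) ^ (k - j) ∣ z := by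
      intro z
      rw [show (p : ZMod (p ^ k)) ^ j * (z : ZMod (p^k)) = (((p : ℤ) ^ j * z : ℤ) : ZMod (p^k)) by push_cast; rfl,
        ZMod.intCast_zmod_eq_zero_iff_dvd]
      rw [show ((p ^ k : ℕ) : ℤ) = (p:ℤ) ^ j * (p:ℤ) ^ (k - j) by
        rw [← pow_add, Nat.add_sub_cancel' hj]; push_cast; rfl]
      exact mul_dvd_mul_iff_left (pow_ne_zero _ (by exact_mod_cast hp.ne_zero))
    obtain ⟨z, hz⟩ := ZMod.intCast_surjective t
    rw [← hz] at h3 ⊢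
    have h4 := kl_two_dvd hp (k - j) z ((conv _).1 (by push_cast; exact h3))
    rcases h4 with h4 | h4
    · left; have := (conv _).2 h4; push_cast at this; exact this
    · right; have := (conv _).2 h4; push_cast at this; exact this
  have hle : ∀ ε : ZMod (p^k), (Finset.univ.filter (fun u : (ZMod (p^k))ˣ => 
      (p : ZMod (p ^ k)) ^ j * (2 * ((↑(u * u₀⁻¹) : ZMod (p^k)) + ε)) = 0)).card ≤ 2 * p ^ j := by
    intro ε
    refine le_trans ?_ (klg_nat_le (n := p ^ k) (2 * p ^ j) (by have := hp.pos; positivity))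
    unfold klg
    apply Finset.card_le_card_of_injOn (fun u => (↑(u * u₀⁻¹) : ZMod (p^k)) + ε)
    · intro u hu
      simp only [Finset.coe_filter, Finset.mem_univ, true_and, Set.mem_ofPred_eq] at hu ⊢
      push_cast at hu ⊢
      rw [← hu]; ring
    · intro u _ v _ h
      have := add_right_cancel h
      exact mul_right_cancel (Units.ext this)
  calc S.card ≤ ((Finset.univ.filter (fun u : (ZMod (p^k))ˣ => 
      (p : ZMod (p ^ k)) ^ j * (2 * ((↑(u * u₀⁻¹) : ZMod (p^k)) + (-1))) = 0)) ∪ (Finset.univ.filter (fun u : (ZMod (p^k))ˣ => 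
      (p : ZMod (p ^ k)) ^ j * (2 * ((↑(u * u₀⁻¹) : ZMod (p^k)) + 1)) = 0))).card := by
        apply Finset.card_le_card
        intro u hu
        simp only [Finset.mem_union, Finset.mem_filter, Finset.mem_univ, true_and, ← sub_eq_add_neg]
        exact key u hu
    _ ≤ 2 * p ^ j + 2 * p ^ j := (Finset.card_union_le _ _).trans (Nat.add_le_add (hle _) (hle _))
    _ = 4 * p ^ j := by ring


theorem kl_units_sum {F : Type*} [Field F] [Fintype F] [DecidableEq F] (f : F → ℂ) :
    ∑ u : Fˣ, f u = ∑ x ∈ Finset.univ.filter (fun x : F => x ≠ 0), f x := by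
  refine Finset.sum_bij (fun u _ => (u : F)) ?_ ?_ ?_ ?_
  · intro u _; simp
  · intro u _ v _ h; exact Units.ext h
  · intro x hx
    exact ⟨Units.mk0 x (by simpa using hx), by simp, by simp⟩
  · intro u _; rfl

theorem klg_pos {R : Type*} [CommRing R] [Fintype R] [DecidableEq R] (b : R) : 1 ≤ klg b := by
  unfold klg
  apply Finset.card_pos.2
  exact ⟨0, by simp⟩

theorem klS_trivial {R : Type*} [CommRing R] [Fintype R] [DecidableEq R] (ψ : AddChar R ℂ) (a b : R) :
    ‖klS ψ a b‖ ≤ Fintype.card R := by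
  refine (norm_sum_le _ _).trans ?_
  simp only [AddChar.norm_apply, Finset.sum_const, Finset.card_univ, nsmul_eq_mul, mul_one]
  exact_mod_cast Fintype.card_le_of_injective (fun u : Rˣ => (u : R)) (fun u v h => Units.ext h)

theorem kl_base {p : ℕ} [Fact p.Prime] (ψ : AddChar (ZMod p) ℂ) (hψ : ψ.IsPrimitive) (a b : ZMod p) :
    ‖klS ψ a b‖ ≤ 8 * √((p : ℝ) * klg b) := by
  have hp : p.Prime := Fact.out
  have hp0 : (0 : ℝ) < p := by exact_mod_cast hp.pos
  by_cases hb : b = 0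
  · subst hb
    have : klg (0 : ZMod p) = p := by simp [klg, ZMod.card]
    rw [this, Real.sqrt_mul_self hp0.le]
    have := klS_trivial ψ a 0
    rw [ZMod.card] at this
    linarith
  have hg : (1 : ℝ) ≤ klg b := by exact_mod_cast klg_pos b
  suffices h : ‖klS ψ a b‖ ≤ 2 * √(p : ℝ) by
    have h2 : √(p : ℝ) ≤ √((p : ℝ) * klg b) := Real.sqrt_le_sqrt (by nlinarith)
    have := Real.sqrt_nonneg (p : ℝ)
    linarith
  have hs1 : (1 : ℝ) ≤ √(p : ℝ) := by
    rw [Real.one_le_sqrt]; exact_mod_cast hp.one_le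
  by_cases hp2 : p = 2
  · have := klS_trivial ψ a b
    rw [ZMod.card] at this
    have h2 : (p : ℝ) = 2 := by exact_mod_cast hp2
    linarith
  by_cases ha : a = 0
  · subst ha
    have h1 : klS ψ 0 b = ∑ x ∈ Finset.univ.filter (fun x : ZMod p => x ≠ 0), ψ (x * b) := by
      rw [← kl_units_sum (fun x => ψ (x * b)), klS]
      refine Fintype.sum_equiv (Equiv.inv (ZMod p)ˣ) _ _ (fun u => ?_)
      rw [zero_mul, zero_add, mul_comm]
      rfl
    have h2 := AddChar.sum_mulShift b hψ
    rw [if_neg hb, ← Finset.sum_filter_add_sum_filter_not Finset.univ (fun x : ZMod p => x ≠ 0), ← h1] at h2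
    simp [Finset.filter_eq'] at h2
    rw [eq_neg_of_add_eq_zero_left h2]
    simp; linarith
  · have hψ1 : ψ ≠ 1 := by
      have := hψ (a := 1) one_ne_zero
      rwa [AddChar.mulShift_one] at this
    have h1 := kl_prime hp2 ψ hψ1 (a * b) (mul_ne_zero ha hb)
    have h2 : klS ψ a b = ∑ x ∈ Finset.univ.filter (fun x : ZMod p => x ≠ 0), ψ (x + (a * b) * x⁻¹) := by
      rw [← kl_units_sum (fun x => ψ (x + (a * b) * x⁻¹)), klS]
      refine Fintype.sum_equiv (Equiv.mulLeft (Units.mk0 a ha)) _ _ (fun u => ?_)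
      have hu : (u : ZMod p) ≠ 0 := u.ne_zero
      congr 1
      rw [Equiv.coe_mulLeft, Units.val_mul, Units.val_mk0, Units.val_inv_eq_inv_val, mul_inv]
      field_simp
    rw [h2]; exact h1

theorem kl_fiber {G H : Type*} [Group G] [Group H] [Fintype G] [Fintype H] [DecidableEq H] (f : G →* H)
    (hf : Function.Surjective f) (F : H → ℂ) :
    (Fintype.card H : ℂ) * ∑ g, F (f g) = (Fintype.card G : ℂ) * ∑ h, F h := by
  have hc : ∀ h : H, ((Finset.univ.filter (fun g => f g = h)).card : ℂ) = (Finset.univ.filter (fun g => f g = 1)).card := by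
    intro h
    rw [MonoidHom.card_fiber_eq_of_mem_range f (hf h) (hf 1)]
  have h1 : ∀ F : H → ℂ, ∑ g, F (f g) = ((Finset.univ.filter (fun g => f g = 1)).card : ℂ) * ∑ h, F h := by
    intro F
    rw [← Finset.sum_fiberwise Finset.univ f, Finset.mul_sum]
    apply Finset.sum_congr rfl
    intro h _
    rw [← hc h, Finset.sum_congr rfl (g := fun _ => F h) (by
      intro g hg
      rw [(Finset.mem_filter.1 hg).2])]
    simp
  have h2 := h1 (fun _ => 1)
  simp at h2
  rw [h1, h2]
  ring

theorem kl_add_fiber {G H : Type*} [AddGroup G] [AddGroup H] [Fintype G] [Fintype H] [DecidableEq H] (f : G →+ H)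
    (hf : Function.Surjective f) (F : H → ℂ) :
    (Fintype.card H : ℂ) * ∑ g, F (f g) = (Fintype.card G : ℂ) * ∑ h, F h := by
  have hc : ∀ h : H, ((Finset.univ.filter (fun g => f g = h)).card : ℂ) = (Finset.univ.filter (fun g => f g = 0)).card := by
    intro h
    rw [AddMonoidHom.card_fiber_eq_of_mem_range f (hf h) (hf 0)]
  have h1 : ∀ F : H → ℂ, ∑ g, F (f g) = ((Finset.univ.filter (fun g => f g = 0)).card : ℂ) * ∑ h, F h := by
    intro F
    rw [← Finset.sum_fiberwise Finset.univ f, Finset.mul_sum]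
    apply Finset.sum_congr rfl
    intro h _
    rw [← hc h, Finset.sum_congr rfl (g := fun _ => F h) (by
      intro g hg
      rw [(Finset.mem_filter.1 hg).2])]
    simp
  have h2 := h1 (fun _ => 1)
  simp at h2
  rw [h1, h2]
  ring

theorem kl_nonunit {p : ℕ} [Fact p.Prime] (k : ℕ) (a : ZMod (p ^ k)) (ha : ¬ IsUnit a) :
    ∃ a', a = p * a' := by
  have hp : p.Prime := Fact.out
  obtain ⟨z, rfl⟩ := ZMod.natCast_zmod_surjective a
  rw [ZMod.isUnit_iff_coprime] at ha
  have : p ∣ z := by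
    by_contra h
    exact ha (Nat.Coprime.pow_right _ ((Nat.Prime.coprime_iff_not_dvd hp).2 h).symm)
  obtain ⟨w, rfl⟩ := this
  exact ⟨w, by push_cast; rfl⟩

theorem kl_ppow_ne {p : ℕ} [Fact p.Prime] (k : ℕ) : (p : ZMod (p ^ (k + 1))) ^ k ≠ 0 := by
  have hp : p.Prime := Fact.out
  intro h
  have h' : ((p ^ k : ℕ) : ZMod (p ^ (k+1))) = 0 := by push_cast; exact h
  rw [ZMod.natCast_eq_zero_iff] at h'
  have := (Nat.pow_dvd_pow_iff_le_right hp.one_lt).1 h'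
  omega

theorem kl_ppow_zero {p : ℕ} (k m : ℕ) (h : k ≤ m) : (p : ZMod (p ^ k)) ^ m = 0 := by
  have h' : ((p ^ m : ℕ) : ZMod (p ^ k)) = 0 := by
    rw [ZMod.natCast_eq_zero_iff]; exact pow_dvd_pow _ h
  push_cast at h'; exact h'

theorem kl_reduce {p : ℕ} [Fact p.Prime] (k : ℕ) (hk : 1 ≤ k)
    (ih : ∀ (ψ : AddChar (ZMod (p ^ k)) ℂ), ψ.IsPrimitive → ∀ a b, ‖klS ψ a b‖ ≤ 8 * √((p : ℝ) ^ k * klg b))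
    (ψ : AddChar (ZMod (p ^ (k + 1))) ℂ) (hψ : ψ.IsPrimitive) (a b : ZMod (p ^ (k + 1))) :
    ‖klS ψ (p * a) (p * b)‖ ≤ 8 * √((p : ℝ) ^ (k + 1) * klg (p * b)) := by
  have hp : p.Prime := Fact.out
  have hp0 : (0 : ℝ) < p := by exact_mod_cast hp.pos
  have hdvd : p ^ k ∣ p ^ (k + 1) := pow_dvd_pow _ (Nat.le_succ k)
  have hζ : (ψ p) ^ (p ^ k) = 1 := by
    rw [← AddChar.map_nsmul_eq_pow, nsmul_eq_mul]
    push_cast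
    rw [← pow_succ, kl_ppow_zero _ _ le_rfl, AddChar.map_zero_eq_one]
  set ψ' : AddChar (ZMod (p ^ k)) ℂ := AddChar.zmodChar (p ^ k) hζ with hψ'
  set π := ZMod.castHom hdvd (ZMod (p ^ k)) with hπ
  have hcomp : ∀ x, ψ (p * x) = ψ' (π x) := by
    intro x
    obtain ⟨z, rfl⟩ := ZMod.natCast_zmod_surjective x
    rw [map_natCast, hψ', AddChar.zmodChar_apply', ← AddChar.map_nsmul_eq_pow, nsmul_eq_mul, mul_comm]
  have hzero : ∀ x : ZMod (p ^ (k + 1)), p * x = 0 ↔ π x = 0 := by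
    intro x
    obtain ⟨z, rfl⟩ := ZMod.natCast_zmod_surjective x
    rw [map_natCast, ← Nat.cast_mul, ZMod.natCast_eq_zero_iff, ZMod.natCast_eq_zero_iff, pow_succ, mul_comm (p ^ k)]
    exact Nat.mul_dvd_mul_iff_left hp.pos
  have hprim : ψ'.IsPrimitive := by
    apply AddChar.zmod_char_primitive_of_eq_one_only_at_zero
    intro y hy
    obtain ⟨z, rfl⟩ := ZMod.castHom_surjective hdvd y
    rw [← hπ, ← hcomp, hψ.zmod_char_eq_one_iff] at hy
    exact (hzero z).1 hy
  have h1 := ih ψ' hprim (π a) (π b)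
  have hS : klS ψ (p * a) (p * b) = p * klS ψ' (π a) (π b) := by
    have h2 := kl_fiber (ZMod.unitsMap hdvd) (ZMod.unitsMap_surjective hdvd)
      (fun u => ψ' (π a * u + π b * (↑u⁻¹ : ZMod (p ^ k))))
    rw [ZMod.card_units_eq_totient, ZMod.card_units_eq_totient, Nat.totient_prime_pow_succ hp,
      Nat.totient_prime_pow hp hk] at h2
    have h3 : ∑ g, ψ' (π a * ↑(ZMod.unitsMap hdvd g) + π b * ↑(ZMod.unitsMap hdvd g)⁻¹) = klS ψ (p * a) (p * b) := by
      rw [klS]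
      apply Finset.sum_congr rfl
      intro u _
      rw [← map_inv, mul_assoc, mul_assoc, ← mul_add, hcomp, π.map_add, π.map_mul, π.map_mul]
      rfl
    rw [h3] at h2
    change _ = _ * klS ψ' (π a) (π b) at h2
    obtain ⟨m, rfl⟩ : ∃ m, k = m + 1 := ⟨k - 1, by omega⟩
    have hne : ((p ^ (m + 1 - 1) * (p - 1) : ℕ) : ℂ) ≠ 0 := by
      have := hp.two_le
      exact_mod_cast (Nat.mul_pos (pow_pos hp.pos _) (by omega)).ne'
    apply mul_left_cancel₀ hne
    rw [h2]
    simp only [Nat.add_sub_cancel]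
    push_cast
    ring
  have hg : (klg (p * b) : ℝ) = p * klg (π b) := by
    have h2 := kl_add_fiber (π : ZMod (p ^ (k+1)) →+ ZMod (p ^ k)) (ZMod.castHom_surjective hdvd)
      (fun y => if π b * y = 0 then 1 else 0)
    rw [ZMod.card, ZMod.card] at h2
    have h3 : (∑ g, if π b * (π : ZMod (p ^ (k+1)) →+ ZMod (p ^ k)) g = 0 then (1:ℂ) else 0) = klg (p * b) := by
      rw [Finset.sum_boole, klg]
      congr 3
      ext x
      rw [mul_assoc, hzero, map_mul]
      rfl
    rw [h3, Finset.sum_boole] at h2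
    change _ = _ * ((klg (π b) : ℕ) : ℂ) at h2
    have h4 : (p ^ k : ℕ) * klg (p * b) = (p ^ (k + 1) : ℕ) * klg (π b) := by exact_mod_cast h2
    have h5 : klg (p * b) = p * klg (π b) := by
      apply Nat.eq_of_mul_eq_mul_left (pow_pos hp.pos k)
      rw [h4]; ring
    exact_mod_cast h5
  rw [hS, norm_mul, Complex.norm_natCast, hg]
  calc (p : ℝ) * ‖klS ψ' (π a) (π b)‖ ≤ p * (8 * √((p : ℝ) ^ k * klg (π b))) := by gcongr
    _ = 8 * (√((p:ℝ)^2) * √((p : ℝ) ^ k * klg (π b))) := by rw [Real.sqrt_sq hp0.le]; ring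
    _ = _ := by rw [← Real.sqrt_mul (by positivity)]; congr 2; ring

theorem kl_pp {p : ℕ} [Fact p.Prime] (k : ℕ) (hk : 1 ≤ k) :
    ∀ (ψ : AddChar (ZMod (p ^ k)) ℂ), ψ.IsPrimitive → ∀ a b, ‖klS ψ a b‖ ≤ 8 * √((p : ℝ) ^ k * klg b) := by
  have hp : p.Prime := Fact.out
  have hp0 : (0 : ℝ) < p := by exact_mod_cast hp.pos
  induction k, hk using Nat.le_induction with
  | base =>
    have : ∀ (n : ℕ) [NeZero n], n = p → ∀ (ψ : AddChar (ZMod n) ℂ), ψ.IsPrimitive → ∀ a b, ‖klS ψ a b‖ ≤ 8 * √((p : ℝ) * klg b) := by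
      intro n _ hn
      subst hn
      intro ψ hψ a b
      exact kl_base ψ hψ a b
    rw [pow_one (p : ℝ)]
    exact this (p ^ 1) (pow_one p)
  | succ k hk ih =>
    intro ψ hψ a b
    have hcard : Fintype.card (ZMod (p ^ (k + 1))) = p ^ (k + 1) := ZMod.card _
    by_cases ha : IsUnit a
    · by_cases hb : IsUnit b
      · have hg : (1 : ℝ) ≤ klg b := by exact_mod_cast klg_pos b
        suffices h : ‖klS ψ a b‖ ≤ 8 * √((p : ℝ) ^ (k + 1)) by
          refine h.trans ?_
          gcongr
          have : (0:ℝ) < (p : ℝ) ^ (k + 1) := by positivity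
          nlinarith
        rcases Nat.even_or_odd (k + 1) with ⟨j, hj⟩ | ⟨j, hj⟩
        · have h1 := klS_E1 ψ hψ a b ((p : ZMod (p ^ (k+1))) ^ j) (by
            rw [← pow_add]; exact kl_ppow_zero _ _ hj.le)
          have h2 := kl_count (k + 1) j (by omega) a b ha
          have h2' : ((Finset.univ.filter (fun u : (ZMod (p ^ (k+1)))ˣ => (p : ZMod (p ^ (k+1))) ^ j * (a * u - b * (↑u⁻¹ : ZMod (p^(k+1)))) = 0)).card : ℝ) ≤ 4 * p ^ j := by exact_mod_cast h2
          have h3 : √((p : ℝ) ^ (k + 1)) = p ^ j := by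
            rw [hj, ← two_mul, mul_comm, pow_mul, Real.sqrt_sq (by positivity)]
          rw [h3]
          have : (0:ℝ) < (p : ℝ) ^ j := by positivity
          linarith
        · have hj1 : 1 ≤ j := by omega
          have h1 := klS_E2 ψ hψ a b ((p : ZMod (p ^ (k+1))) ^ j) p hb (by
            rw [← pow_add, ← pow_succ]; exact kl_ppow_zero _ _ (by omega)) (by
            rw [← pow_add, ← pow_add]; exact kl_ppow_zero _ _ (by omega)) (√(2 / p)) (Real.sqrt_nonneg _) (by
              rw [mul_pow, Real.sq_sqrt (by positivity), hcard]
              have h5 := klg_nat_le (n := p ^ (k + 1)) (2 * (p ^ j * p ^ j)) (by have := hp.pos; positivity)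
              push_cast at h5
              have h6 : (klg (2 * ((p : ZMod (p ^ (k+1))) ^ j * (p : ZMod (p ^ (k+1))) ^ j)) : ℝ) ≤ 2 * (p ^ j * p ^ j) := by
                exact_mod_cast h5
              push_cast
              calc (p : ℝ) ^ (k + 1) * _ ≤ (p : ℝ) ^ (k + 1) * (2 * (p ^ j * p ^ j)) := by gcongr
                _ = _ := by
                  rw [hj]; field_simp; ring)
          have h2 := kl_count (k + 1) (j + 1) (by omega) a b ha
          rw [pow_succ (p : ZMod (p ^ (k+1)))] at h2
          have h2' : ((Finset.univ.filter (fun u : (ZMod (p ^ (k+1)))ˣ => (p : ZMod (p ^ (k+1))) ^ j * p * (a * u - b * (↑u⁻¹ : ZMod (p^(k+1)))) = 0)).card : ℝ) ≤ 4 * p ^ (j + 1) := by exact_mod_cast h2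
          refine h1.trans ((mul_le_mul_of_nonneg_left h2' (Real.sqrt_nonneg _)).trans ?_)
          apply le_of_sq_le_sq _ (by positivity)
          rw [mul_pow, mul_pow _ (√_), Real.sq_sqrt (by positivity), Real.sq_sqrt (by positivity), hj]
          have e : 2 / (p : ℝ) * (4 * (p : ℝ) ^ (j + 1)) ^ 2 = 32 * (p : ℝ) ^ (2 * j + 1) := by
            field_simp; ring
          rw [e]
          have : (0:ℝ) < (p : ℝ) ^ (2 * j + 1) := by positivity
          linarith
      · obtain ⟨b', rfl⟩ := kl_nonunit _ b hb
        have h1 := klS_E1 ψ hψ a (p * b') ((p : ZMod (p ^ (k+1))) ^ k) (by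
            rw [← pow_add]; exact kl_ppow_zero _ _ (by omega))
        rw [Finset.filter_false_of_mem, Finset.card_empty, Nat.cast_zero] at h1
        · exact h1.trans (by positivity)
        · intro u _ h
          have hz : (p : ZMod (p ^ (k+1))) ^ k * p = 0 := by rw [← pow_succ]; exact kl_ppow_zero _ _ le_rfl
          have h2 : (a * u) * (p : ZMod (p ^ (k+1))) ^ k = 0 := by
            linear_combination h + (b' * (↑u⁻¹ : ZMod (p ^ (k+1)))) * hz
          rw [(ha.mul u.isUnit).mul_right_eq_zero] at h2
          exact kl_ppow_ne k h2
    · obtain ⟨a', rfl⟩ := kl_nonunit _ a ha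
      by_cases hb : IsUnit b
      · have h1 := klS_E1 ψ hψ (p * a') b ((p : ZMod (p ^ (k+1))) ^ k) (by
            rw [← pow_add]; exact kl_ppow_zero _ _ (by omega))
        rw [Finset.filter_false_of_mem, Finset.card_empty, Nat.cast_zero] at h1
        · exact h1.trans (by positivity)
        · intro u _ h
          have hz : (p : ZMod (p ^ (k+1))) ^ k * p = 0 := by rw [← pow_succ]; exact kl_ppow_zero _ _ le_rfl
          have h2 : (b * (↑u⁻¹ : ZMod (p ^ (k+1)))) * (p : ZMod (p ^ (k+1))) ^ k = 0 := by
            linear_combination -h + (a' * (u : ZMod (p ^ (k+1)))) * hz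
          rw [(hb.mul (u⁻¹).isUnit).mul_right_eq_zero] at h2
          exact kl_ppow_ne k h2
      · obtain ⟨b', rfl⟩ := kl_nonunit _ b hb
        exact kl_reduce k hk ih ψ hψ a' b'


theorem kl_mult {R S T : Type*} [CommRing R] [Fintype R] [DecidableEq R] [CommRing S] [Fintype S] [DecidableEq S]
    [CommRing T] [Fintype T] [DecidableEq T] (e : R ≃+* S × T) (ψ : AddChar R ℂ) (hψ : ψ.IsPrimitive) (a b : R) :
    ∃ (ψ₁ : AddChar S ℂ) (ψ₂ : AddChar T ℂ), ψ₁.IsPrimitive ∧ ψ₂.IsPrimitive ∧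
      klS ψ a b = klS ψ₁ (e a).1 (e b).1 * klS ψ₂ (e a).2 (e b).2 := by
  let ψ₁ : AddChar S ℂ := ψ.compAddMonoidHom (((e.symm : S × T →+* R) : S × T →+ R).comp (AddMonoidHom.inl S T))
  let ψ₂ : AddChar T ℂ := ψ.compAddMonoidHom (((e.symm : S × T →+* R) : S × T →+ R).comp (AddMonoidHom.inr S T))
  have h1 : ∀ x, ψ₁ x = ψ (e.symm (x, 0)) := fun x => rfl
  have h2 : ∀ x, ψ₂ x = ψ (e.symm (0, x)) := fun x => rfl
  refine ⟨ψ₁, ψ₂, ?_, ?_, ?_⟩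
  · intro s hs hcon
    apply hψ (a := e.symm (s, 0)) (by simpa using hs)
    ext y
    have := DFunLike.congr_fun hcon (e y).1
    rw [AddChar.mulShift_apply, h1, AddChar.one_apply] at this
    rw [AddChar.mulShift_apply, AddChar.one_apply, ← this]
    congr 1
    apply e.injective
    simp [Prod.ext_iff]
  · intro s hs hcon
    apply hψ (a := e.symm (0, s)) (by simpa using hs)
    ext y
    have := DFunLike.congr_fun hcon (e y).2
    rw [AddChar.mulShift_apply, h2, AddChar.one_apply] at this
    rw [AddChar.mulShift_apply, AddChar.one_apply, ← this]
    congr 1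
    apply e.injective
    simp [Prod.ext_iff]
  · rw [klS, klS, klS, Finset.sum_mul_sum, ← Fintype.sum_prod_type']
    refine Fintype.sum_equiv ((Units.mapEquiv (e : R ≃* S × T)).trans MulEquiv.prodUnits).toEquiv _ _ (fun u => ?_)
    rw [h1, h2, ← AddChar.map_add_eq_mul, ← map_add]
    congr 1
    apply e.injective
    rw [RingEquiv.apply_symm_apply, map_add, map_mul, map_mul]
    have hi : (e (↑u⁻¹ : R)) = ↑((Units.mapEquiv (e : R ≃* S × T) u)⁻¹) := by
      rw [← map_inv]; rfl
    rw [hi]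
    have hi2 : e (↑u : R) = ↑((Units.mapEquiv (e : R ≃* S × T) u)) := rfl
    rw [hi2]
    ext <;> simp [MulEquiv.prodUnits]

theorem klg_mult {R S T : Type*} [CommRing R] [Fintype R] [DecidableEq R] [CommRing S] [Fintype S] [DecidableEq S]
    [CommRing T] [Fintype T] [DecidableEq T] (e : R ≃+* S × T) (b : R) :
    klg b = klg (e b).1 * klg (e b).2 := by
  unfold klg
  rw [← Finset.card_product]
  refine Finset.card_bij (fun x _ => e x) ?_ ?_ ?_
  · intro x hx
    simp only [Finset.mem_filter, Finset.mem_univ, true_and] at hx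
    simp only [Finset.mem_product, Finset.mem_filter, Finset.mem_univ, true_and]
    have : e b * e x = 0 := by rw [← map_mul, hx, map_zero]
    exact Prod.ext_iff.1 this
  · intro x _ y _ h; exact e.injective h
  · intro y hy
    simp only [Finset.mem_product, Finset.mem_filter, Finset.mem_univ, true_and] at hy
    refine ⟨e.symm y, ?_, by simp⟩
    simp only [Finset.mem_filter, Finset.mem_univ, true_and]
    apply e.injective
    rw [map_mul, RingEquiv.apply_symm_apply, map_zero]
    exact Prod.ext hy.1 hy.2

theorem kl_all (q : ℕ) : ∀ [NeZero q] (ψ : AddChar (ZMod q) ℂ), ψ.IsPrimitive → ∀ a b,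
    ‖klS ψ a b‖ ≤ 8 ^ q.primeFactors.card * √((q : ℝ) * klg b) := by
  induction q using Nat.recOnPosPrimePosCoprime with
  | prime_pow p n hp hn =>
    intro _ ψ hψ a b
    haveI : Fact p.Prime := ⟨hp⟩
    have := kl_pp n hn ψ hψ a b
    rw [Nat.primeFactors_prime_pow hn.ne' hp, Finset.card_singleton, pow_one]
    push_cast
    exact this
  | zero => intro h; exact absurd rfl h.out
  | one =>
    intro _ ψ hψ a b
    have h1 := klS_trivial ψ a b
    rw [ZMod.card] at h1
    have hg : (1 : ℝ) ≤ klg b := by exact_mod_cast klg_pos b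
    simp only [Nat.primeFactors_one, Finset.card_empty, pow_zero, one_mul, Nat.cast_one] at h1 ⊢
    exact h1.trans (by rw [Real.one_le_sqrt]; exact hg)
  | coprime m n hm hn hmn ihm ihn =>
    intro _ ψ hψ a b
    haveI : NeZero m := ⟨by omega⟩
    haveI : NeZero n := ⟨by omega⟩
    obtain ⟨ψ₁, ψ₂, h1, h2, h3⟩ := kl_mult (ZMod.chineseRemainder hmn) ψ hψ a b
    rw [h3, klg_mult (ZMod.chineseRemainder hmn) b, norm_mul, hmn.primeFactors_mul,
      Finset.card_union_of_disjoint hmn.disjoint_primeFactors]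
    refine (mul_le_mul (ihm ψ₁ h1 _ _) (ihn ψ₂ h2 _ _) (norm_nonneg _) (by positivity)).trans (le_of_eq ?_)
    push_cast
    rw [mul_mul_mul_comm (m : ℝ), pow_add, mul_mul_mul_comm, ← Real.sqrt_mul (by positivity)]


theorem kl_divisor (ε : ℝ) (hε : 0 < ε) : ∃ C : ℝ, 0 < C ∧ ∀ q : ℕ, q ≠ 0 →
    (8 : ℝ) ^ q.primeFactors.card * q.divisors.card ≤ C * (q : ℝ) ^ ε := by
  have hL : 0 < Real.log 2 := Real.log_pos (by norm_num)
  set D : ℝ := 8 * (1 + 1 / (ε * Real.log 2)) with hD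
  have hD1 : 1 ≤ D := by
    have : 0 < 1 / (ε * Real.log 2) := by positivity
    rw [hD]; linarith
  obtain ⟨P, hP⟩ := exists_nat_ge ((16 : ℝ) ^ (1 / ε))
  refine ⟨D ^ P, by positivity, fun q hq => ?_⟩
  rw [Nat.card_divisors hq]
  have key : ∀ p ∈ q.primeFactors, (8 : ℝ) * (q.factorization p + 1) ≤
      (if p < P then D else 1) * ((p : ℝ) ^ (q.factorization p)) ^ ε := by
    intro p hp
    have hpp := Nat.prime_of_mem_primeFactors hp
    have he : 1 ≤ q.factorization p := by
      have := (Nat.Prime.dvd_iff_one_le_factorization hpp hq).1 (Nat.dvd_of_mem_primeFactors hp)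
      exact this
    set e := q.factorization p with hedef
    have hp2 : (2 : ℝ) ≤ p := by exact_mod_cast hpp.two_le
    split_ifs with h
    · have h1 : 1 + (e : ℝ) * (ε * Real.log 2) ≤ ((p : ℝ) ^ e) ^ ε := by
        calc 1 + (e : ℝ) * (ε * Real.log 2) ≤ Real.exp ((e : ℝ) * (ε * Real.log 2)) := by
              rw [add_comm]; exact Real.add_one_le_exp _
          _ = ((2 : ℝ) ^ e) ^ ε := by
              rw [Real.rpow_def_of_pos (by positivity), Real.log_pow]; congr 1; ring
          _ ≤ _ := by gcongr
      have h2 : (8 : ℝ) * (e + 1) ≤ D * (1 + (e : ℝ) * (ε * Real.log 2)) := by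
        rw [hD]
        have h3 : (1 + 1 / (ε * Real.log 2)) * (1 + (e : ℝ) * (ε * Real.log 2)) =
          1 + e + (e * (ε * Real.log 2) + 1 / (ε * Real.log 2)) := by field_simp; ring
        have h4 : 0 ≤ e * (ε * Real.log 2) + 1 / (ε * Real.log 2) := by positivity
        rw [mul_assoc, h3]; linarith
      exact h2.trans (by gcongr)
    · push Not at h
      have h1 : (16 : ℝ) ≤ (p : ℝ) ^ ε := by
        have : (16 : ℝ) ^ (1 / ε) ≤ p := hP.trans (by exact_mod_cast h)
        calc (16 : ℝ) = ((16 : ℝ) ^ (1 / ε)) ^ ε := by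
              rw [← Real.rpow_mul (by norm_num), one_div_mul_cancel hε.ne', Real.rpow_one]
          _ ≤ _ := by gcongr
      have h2 : ((p : ℝ) ^ e) ^ ε = ((p : ℝ) ^ ε) ^ e := by
        rw [← Real.rpow_natCast, ← Real.rpow_natCast, ← Real.rpow_mul (by positivity), ← Real.rpow_mul (by positivity), mul_comm]
      rw [h2, one_mul]
      refine le_trans ?_ (pow_le_pow_left₀ (by norm_num) h1 e)
      have h3 := one_add_mul_le_pow (a := (15 : ℝ)) (by norm_num) e
      have h5 : (1 : ℝ) ≤ e := by exact_mod_cast he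
      norm_num at h3
      linarith
  calc (8 : ℝ) ^ q.primeFactors.card * ((∏ x ∈ q.primeFactors, (q.factorization x + 1) : ℕ) : ℝ) =
      ∏ p ∈ q.primeFactors, ((8 : ℝ) * (q.factorization p + 1)) := by
        rw [Finset.prod_mul_distrib, Finset.prod_const]; push_cast; rfl
    _ ≤ ∏ p ∈ q.primeFactors, ((if p < P then D else 1) * ((p : ℝ) ^ (q.factorization p)) ^ ε) :=
        Finset.prod_le_prod (fun p _ => by positivity) key
    _ = (∏ p ∈ q.primeFactors, (if p < P then D else 1)) * (q : ℝ) ^ ε := by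
        rw [Finset.prod_mul_distrib, Real.finsetProd_rpow _ _ (fun p _ => by positivity)]
        congr 2
        conv_rhs => rw [← Nat.factorization_prod_pow_eq_self hq]
        rw [Finsupp.prod]
        push_cast
        rfl
    _ ≤ D ^ P * (q : ℝ) ^ ε := by
        gcongr
        rw [Finset.prod_ite, Finset.prod_const, Finset.prod_const_one, mul_one]
        apply pow_le_pow_right₀ hD1
        calc _ ≤ (Finset.range P).card := by
              apply Finset.card_le_card
              intro p hp
              simp only [Finset.mem_filter] at hp
              simpa using hp.2
          _ = P := by simp


def klE (q : ℕ) [NeZero q] : AddChar (ZMod q) ℂ := ZMod.stdAddChar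

theorem klE_prim (q : ℕ) [NeZero q] : (klE q).IsPrimitive := ZMod.isPrimitive_stdAddChar q

def klLa {q : ℕ} [NeZero q] (m : ZMod q) : ℝ := ‖klE q m - 1‖⁻¹

def klInc {q : ℕ} [NeZero q] (A : ZMod q) (L : ℕ) (α β : ZMod q) : ℂ :=
  ∑ i ∈ Finset.range L, ∑ u : (ZMod q)ˣ, if A + i = u then
    klE q (α * u + β * (↑u⁻¹ : ZMod q)) else 0

theorem klLa_nonneg {q : ℕ} [NeZero q] (m : ZMod q) : 0 ≤ klLa m := inv_nonneg.2 (norm_nonneg _)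

theorem kl_std_ne {q : ℕ} [NeZero q] {m : ZMod q} (hm : m ≠ 0) : (klE q m : ℂ) - 1 ≠ 0 := by
  intro h
  apply hm
  rw [← (klE_prim q).zmod_char_eq_one_iff]
  linear_combination h

theorem kl_geom {q : ℕ} [NeZero q] {m : ZMod q} (hm : m ≠ 0) (L : ℕ) :
    ∑ i ∈ Finset.range L, (klE q (m * (i : ZMod q)) : ℂ) =
      (klE q (m * (L : ZMod q)) - 1) / (klE q m - 1) := by
  have h : ∀ i : ℕ, (klE q (m * (i : ZMod q)) : ℂ) = (klE q m) ^ i := by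
    intro i
    rw [← AddChar.map_nsmul_eq_pow, nsmul_eq_mul, mul_comm]
  simp_rw [h]
  rw [geom_sum_eq]
  intro h1
  exact kl_std_ne hm (by rw [h1, sub_self])

theorem kl_inc_bound {q : ℕ} [NeZero q] (A : ZMod q) (L : ℕ) (hL : L ≤ q) (α β : ZMod q) :
    ‖klInc A L α β‖ ≤ (1 + 2 * (∑ m : ZMod q, klLa m) / q) * (8 ^ q.primeFactors.card * √((q : ℝ) * klg β)) := by
  have hprim := klE_prim q
  have hq0 : (0 : ℝ) < q := by exact_mod_cast Nat.pos_of_ne_zero (NeZero.ne q)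
  have h1 : (q : ℂ) * klInc A L α β = ∑ m : ZMod q,
      (∑ i ∈ Finset.range L, (klE q ((-m) * (A + i)) : ℂ)) * klS (klE q) (α + m) β := by
    have e1 : ∀ m : ZMod q, (∑ i ∈ Finset.range L, (klE q ((-m) * (A + i)) : ℂ)) * klS (klE q) (α + m) β
      = ∑ i ∈ Finset.range L, ∑ u : (ZMod q)ˣ, klE q (α * u + β * (↑u⁻¹ : ZMod q)) * klE q (m * (u - (A + i))) := by
      intro m
      rw [klS, Finset.sum_mul_sum]
      refine Finset.sum_congr rfl fun i _ => Finset.sum_congr rfl fun u _ => ?_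
      rw [← AddChar.map_add_eq_mul, ← AddChar.map_add_eq_mul]
      congr 1
      ring
    simp_rw [e1]
    rw [Finset.sum_comm, klInc, Finset.mul_sum]
    refine Finset.sum_congr rfl fun i _ => ?_
    rw [Finset.sum_comm, Finset.mul_sum]
    refine Finset.sum_congr rfl fun u _ => ?_
    rw [← Finset.mul_sum, AddChar.sum_mulShift _ hprim, ZMod.card]
    by_cases h : A + i = u
    · rw [if_pos h, if_pos (by rw [h, sub_self])]; ring
    · rw [if_neg h, if_neg (fun h' => h (sub_eq_zero.1 h').symm)]; simp
  have h2 : ∀ m : ZMod q, ‖∑ i ∈ Finset.range L, (klE q ((-m) * (A + i)) : ℂ)‖ ≤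
      (if m = 0 then (q : ℝ) else 0) + 2 * klLa (-m) := by
    intro m
    by_cases hm : m = 0
    · subst hm
      rw [if_pos rfl]
      have := klLa_nonneg (-0 : ZMod q)
      refine (norm_sum_le _ _).trans ?_
      simp only [AddChar.norm_apply, Finset.sum_const, Finset.card_range, nsmul_eq_mul, mul_one]
      have : (L : ℝ) ≤ q := by exact_mod_cast hL
      linarith
    · rw [if_neg hm, zero_add]
      have hm' : -m ≠ 0 := neg_ne_zero.2 hm
      have : ∑ i ∈ Finset.range L, (klE q ((-m) * (A + i)) : ℂ) = klE q ((-m) * A) *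
          ((klE q (-m * (L : ZMod q)) - 1) / (klE q (-m) - 1)) := by
        rw [← kl_geom hm', Finset.mul_sum]
        refine Finset.sum_congr rfl fun i _ => ?_
        rw [← AddChar.map_add_eq_mul, mul_add]
      rw [this, norm_mul, AddChar.norm_apply, one_mul, norm_div, div_eq_mul_inv, klLa]
      gcongr
      refine (norm_sub_le _ _).trans ?_
      rw [AddChar.norm_apply, norm_one]; norm_num
  have h3 : (q : ℝ) * ‖klInc A L α β‖ ≤ (q + 2 * (∑ m : ZMod q, klLa m)) * (8 ^ q.primeFactors.card * √((q : ℝ) * klg β)) := by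
    calc (q : ℝ) * ‖klInc A L α β‖ = ‖(q : ℂ) * klInc A L α β‖ := by simp
      _ ≤ ∑ m : ZMod q, ((if m = 0 then (q : ℝ) else 0) + 2 * klLa (-m)) * (8 ^ q.primeFactors.card * √((q : ℝ) * klg β)) := by
        rw [h1]
        refine (norm_sum_le _ _).trans (Finset.sum_le_sum fun m _ => ?_)
        rw [norm_mul]
        exact mul_le_mul (h2 m) (kl_all q _ hprim _ _) (norm_nonneg _) ((norm_nonneg _).trans (h2 m))
      _ = _ := by
        rw [← Finset.sum_mul, Finset.sum_add_distrib, ← Finset.mul_sum, show ∑ i : ZMod q, klLa (-i) = ∑ i, klLa i from Equiv.sum_comp (Equiv.neg (ZMod q)) (fun m => klLa m)]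
        simp
  have h4 : (q + 2 * (∑ m : ZMod q, klLa m)) = q * (1 + 2 * (∑ m : ZMod q, klLa m) / q) := by field_simp
  rw [h4, mul_assoc] at h3
  exact le_of_mul_le_mul_left h3 hq0

theorem kl_count_main {q : ℕ} [NeZero q] (A h c s : ZMod q) (hh : IsUnit h) (L : ℕ) (hL : L ≤ q) (F : ℕ → ℕ)
    (hF : ∀ i < L, (F i : ZMod q) = c + s * (A + i)) :
    |(∑ i ∈ Finset.range L, ∑ j ∈ Finset.range (F i), (if (A + i) * (j + 1 : ZMod q) = h then (1 : ℝ) else 0)) -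
      (∑ i ∈ Finset.range L, (if IsUnit (A + i) then (F i : ℝ) else 0)) / q| ≤
    2 / q * ((1 + 2 * (∑ m : ZMod q, klLa m) / q) * 8 ^ q.primeFactors.card * √q) *
      ∑ n : ZMod q, klLa n * √(klg n) := by
  classical
  have hprim := klE_prim q
  have hq0 : (0 : ℝ) < q := by exact_mod_cast Nat.pos_of_ne_zero (NeZero.ne q)
  set T : ZMod q → ℂ := fun n => ∑ i ∈ Finset.range L, ∑ u : (ZMod q)ˣ, if A + i = u then
    ∑ j ∈ Finset.range (F i), (klE q (n * (j + 1 - h * (↑u⁻¹ : ZMod q))) : ℂ) else 0 with hT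
  have hTsum : ∑ n, T n = ((q * ∑ i ∈ Finset.range L, ∑ j ∈ Finset.range (F i),
      (if (A + i) * (j + 1 : ZMod q) = h then (1 : ℝ) else 0) : ℝ) : ℂ) := by
    push_cast
    rw [Finset.sum_comm, Finset.mul_sum]
    refine Finset.sum_congr rfl fun i _ => ?_
    rw [Finset.sum_comm]
    by_cases hu : IsUnit (A + i)
    · obtain ⟨u, hu⟩ := hu
      rw [Finset.sum_eq_single u]
      · simp only [hu, if_true]
        rw [Finset.sum_comm, Finset.mul_sum]
        refine Finset.sum_congr rfl fun j _ => ?_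
        rw [AddChar.sum_mulShift _ hprim, ZMod.card]
        have : ((j : ZMod q) + 1 - h * (↑u⁻¹ : ZMod q) = 0) ↔ ((A + i) * (j + 1 : ZMod q) = h) := by
          rw [← hu, sub_eq_zero, Units.eq_mul_inv_iff_mul_eq, mul_comm]
        rw [if_congr this rfl rfl]
        split_ifs <;> simp
      · intro v _ hv
        apply Finset.sum_eq_zero
        intro n _
        rw [if_neg]
        rw [← hu]
        exact fun h' => hv (Units.ext h').symm
      · simp
    · rw [Finset.sum_eq_zero, Finset.sum_eq_zero, mul_zero]
      · intro j _
        rw [if_neg, Complex.ofReal_zero]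
        intro h'
        exact hu (isUnit_of_mul_isUnit_left (h' ▸ hh))
      · intro u _
        apply Finset.sum_eq_zero
        intro n _
        rw [if_neg]
        intro h'
        exact hu (h' ▸ u.isUnit)
  have hT0 : T 0 = ((∑ i ∈ Finset.range L, (if IsUnit (A + i) then (F i : ℝ) else 0) : ℝ) : ℂ) := by
    push_cast
    rw [hT]
    refine Finset.sum_congr rfl fun i _ => ?_
    by_cases hu : IsUnit (A + i)
    · rw [if_pos hu]
      obtain ⟨u, hu⟩ := hu
      rw [Finset.sum_eq_single u]
      · rw [if_pos hu.symm]; simp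
      · intro v _ hv
        rw [if_neg]
        rw [← hu]
        exact fun h' => hv (Units.ext h').symm
      · simp
    · rw [if_neg hu, Finset.sum_eq_zero]
      · simp
      · intro u _
        rw [if_neg]
        intro h'
        exact hu (h' ▸ u.isUnit)
  have hTn : ∀ n : ZMod q, n ≠ 0 → T n = (klE q n / (klE q n - 1)) *
      (klE q (n * c) * klInc A L (n * s) (-n * h) - klInc A L 0 (-n * h)) := by
    intro n hn
    rw [hT]
    simp only
    rw [klInc, klInc, Finset.mul_sum, ← Finset.sum_sub_distrib, Finset.mul_sum]
    refine Finset.sum_congr rfl fun i hi => ?_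
    rw [Finset.mul_sum, ← Finset.sum_sub_distrib, Finset.mul_sum]
    refine Finset.sum_congr rfl fun u _ => ?_
    by_cases hu : A + i = u
    · rw [if_pos hu, if_pos hu, if_pos hu]
      have e1 : ∀ j : ℕ, (klE q (n * (j + 1 - h * (↑u⁻¹ : ZMod q))) : ℂ) =
          klE q n * klE q (-n * h * (↑u⁻¹ : ZMod q)) * klE q (n * (j : ZMod q)) := by
        intro j
        rw [← AddChar.map_add_eq_mul, ← AddChar.map_add_eq_mul]
        congr 1; ring
      simp_rw [e1]
      rw [← Finset.mul_sum, kl_geom hn, hF i (Finset.mem_range.1 hi), hu]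
      have e2 : (klE q (n * (c + s * (u : ZMod q))) : ℂ) = klE q (n * c) * klE q (n * s * u) := by
        rw [← AddChar.map_add_eq_mul]
        congr 1; ring
      rw [e2, AddChar.map_add_eq_mul, zero_mul, zero_add]
      ring
    · rw [if_neg hu, if_neg hu, if_neg hu]; ring
  set Q : ℝ := (1 + 2 * (∑ m : ZMod q, klLa m) / q) * 8 ^ q.primeFactors.card * √q with hQ
  have hQ0 : 0 ≤ Q := by
    have h2 : 0 ≤ ∑ m : ZMod q, klLa m := Finset.sum_nonneg fun m _ => klLa_nonneg m
    positivity
  have hTb : ∀ n : ZMod q, n ≠ 0 → ‖T n‖ ≤ 2 * Q * (klLa n * √(klg n)) := by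
    intro n hn
    have hg : klg (-n * h) = klg n := by
      rw [show -n * h = (-h) * n by ring]; exact klg_unit_mul _ _ hh.neg
    have hb : ∀ α, ‖klInc A L α (-n * h)‖ ≤ Q * √(klg n) := by
      intro α
      refine (kl_inc_bound A L hL α (-n * h)).trans (le_of_eq ?_)
      rw [hg, Real.sqrt_mul hq0.le, hQ]; ring
    rw [hTn n hn, norm_mul, norm_div, AddChar.norm_apply, one_div]
    have : ‖klE q (n * c) * klInc A L (n * s) (-n * h) - klInc A L 0 (-n * h)‖ ≤ Q * √(klg n) + Q * √(klg n) := by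
      refine (norm_sub_le _ _).trans ?_
      rw [norm_mul, AddChar.norm_apply, one_mul]
      exact add_le_add (hb _) (hb _)
    calc _ ≤ klLa n * (Q * √(klg n) + Q * √(klg n)) := by
          apply mul_le_mul_of_nonneg_left this (klLa_nonneg n)
      _ = _ := by ring
  set N := (∑ i ∈ Finset.range L, ∑ j ∈ Finset.range (F i), (if (A + i) * (j + 1 : ZMod q) = h then (1 : ℝ) else 0))
  set M := (∑ i ∈ Finset.range L, (if IsUnit (A + i) then (F i : ℝ) else 0))
  have hdiff : ((q * N - M : ℝ) : ℂ) = ∑ n ∈ Finset.univ.erase (0 : ZMod q), T n := by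
    push_cast
    rw [Finset.sum_erase_eq_sub (Finset.mem_univ _), hTsum, hT0]
    push_cast; rfl
  clear hTsum hT0 hTn
  clear_value N M T Q
  have hfin : |q * N - M| ≤ 2 * Q * ∑ n : ZMod q, klLa n * √(klg n) := by
    rw [← Real.norm_eq_abs, ← Complex.norm_real, hdiff, Finset.mul_sum]
    refine (norm_sum_le _ _).trans ((Finset.sum_le_sum (fun n hn => hTb n (Finset.ne_of_mem_erase hn))).trans ?_)
    apply Finset.sum_le_sum_of_subset_of_nonneg (Finset.erase_subset _ _)
    intro n _ _
    have h1 := klLa_nonneg n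
    positivity
  have : N - M / q = (q * N - M) / q := by field_simp
  rw [this, abs_div, abs_of_pos hq0, div_le_iff₀ hq0]
  refine hfin.trans (le_of_eq ?_)
  field_simp


theorem klLa_le {q : ℕ} [NeZero q] (n : ZMod q) :
    klLa n ≤ (q : ℝ) / 4 * ((n.val : ℝ)⁻¹ + ((-n).val : ℝ)⁻¹) := by
  have hq0 : (0 : ℝ) < q := by exact_mod_cast Nat.pos_of_ne_zero (NeZero.ne q)
  by_cases hn : n = 0
  · subst hn; simp [klLa]
  have hv : 0 < n.val := ZMod.val_pos.2 hn
  have hvq : n.val < q := ZMod.val_lt n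
  have hneg : (-n).val = q - n.val := by rw [ZMod.neg_val, if_neg hn]
  have hneg' : ((-n).val : ℝ) = q - n.val := by rw [hneg, Nat.cast_sub hvq.le]
  have hvr : (0 : ℝ) < n.val := by exact_mod_cast hv
  have hvqr : (n.val : ℝ) < q := by exact_mod_cast hvq
  have he : ‖klE q n - 1‖ = 2 * |Real.sin (Real.pi * n.val / q)| := by
    rw [klE, ZMod.stdAddChar_apply, ZMod.toCircle_apply]
    have : (2 * (Real.pi : ℂ) * Complex.I * n.val / q) = Complex.I * ((2 * Real.pi * n.val / q : ℝ) : ℂ) := by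
      push_cast; ring
    rw [this, Complex.norm_exp_I_mul_ofReal_sub_one, norm_mul, Real.norm_eq_abs, Real.norm_eq_abs]
    congr 2
    · norm_num
    · congr 1; ring
  have hpi := Real.pi_pos
  rw [klLa, he, hneg']
  have hd : 0 < (q : ℝ) - n.val := by linarith
  rcases le_total (n.val : ℝ) (q / 2) with h | h
  · have h1 : 2 / Real.pi * (Real.pi * n.val / q) ≤ Real.sin (Real.pi * n.val / q) := by
      apply Real.mul_le_sin (by positivity)
      rw [div_le_iff₀ hq0]
      nlinarith
    have h2 : 2 / Real.pi * (Real.pi * n.val / q) = 2 * n.val / q := by field_simp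
    rw [h2] at h1
    have h3 : 4 * n.val / q ≤ 2 * |Real.sin (Real.pi * n.val / q)| := by
      have := le_abs_self (Real.sin (Real.pi * n.val / q))
      have e : 4 * (n.val : ℝ) / q = 2 * (2 * n.val / q) := by ring
      linarith
    calc _ ≤ (4 * (n.val : ℝ) / q)⁻¹ := inv_anti₀ (by positivity) h3
      _ = (q : ℝ) / 4 * ((n.val : ℝ)⁻¹) := by field_simp
      _ ≤ _ := by
        have : 0 < ((q : ℝ) - n.val)⁻¹ := inv_pos.2 hd
        gcongr; linarith
  · have hs : Real.sin (Real.pi * n.val / q) = Real.sin (Real.pi * (q - n.val) / q) := by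
      rw [← Real.sin_pi_sub]; congr 1; field_simp
    rw [hs]
    set w : ℝ := q - n.val with hw
    have h1 : 2 / Real.pi * (Real.pi * w / q) ≤ Real.sin (Real.pi * w / q) := by
      apply Real.mul_le_sin (by positivity)
      rw [div_le_iff₀ hq0]
      nlinarith
    have h2 : 2 / Real.pi * (Real.pi * w / q) = 2 * w / q := by field_simp
    rw [h2] at h1
    have h3 : 4 * w / q ≤ 2 * |Real.sin (Real.pi * w / q)| := by
      have := le_abs_self (Real.sin (Real.pi * w / q))
      have e : 4 * w / q = 2 * (2 * w / q) := by ring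
      linarith
    calc _ ≤ (4 * w / q)⁻¹ := inv_anti₀ (by positivity) h3
      _ = (q : ℝ) / 4 * (w⁻¹) := by field_simp
      _ ≤ _ := by
        have : 0 < (n.val : ℝ)⁻¹ := inv_pos.2 hvr
        gcongr; linarith

theorem klg_le_gcd {q : ℕ} [NeZero q] (n : ZMod q) : klg n ≤ Nat.gcd n.val q := by
  have hq : 0 < q := Nat.pos_of_ne_zero (NeZero.ne q)
  refine le_trans ?_ (klg_nat_le (n := q) (Nat.gcd n.val q) (Nat.gcd_pos_of_pos_right _ hq))
  unfold klg
  apply Finset.card_le_card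
  intro x hx
  simp only [Finset.mem_filter, Finset.mem_univ, true_and] at hx ⊢
  have h := Nat.gcd_eq_gcd_ab n.val q
  have h2 := congrArg (Int.cast : ℤ → ZMod q) h
  push_cast at h2
  rw [ZMod.natCast_zmod_val, ZMod.natCast_self, zero_mul, add_zero] at h2
  rw [h2]
  linear_combination ((n.val.gcdA q : ℤ) : ZMod q) * hx

theorem klg_neg {q : ℕ} [NeZero q] (n : ZMod q) : klg (-n) = klg n := by
  rw [show -n = (-1) * n by ring]
  exact klg_unit_mul _ _ isUnit_one.neg

theorem kl_harm (q d : ℕ) (hq : 0 < q) (hd : 0 < d) :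
    √d * ∑ v ∈ (Finset.range q).filter (fun v => d ∣ v), (v : ℝ)⁻¹ ≤ 1 + Real.log q := by
  have h1 : ∑ v ∈ (Finset.range q).filter (fun v => d ∣ v), (v : ℝ)⁻¹ ≤ (d : ℝ)⁻¹ * ∑ w ∈ Finset.range q, ((w : ℝ))⁻¹ := by
    rw [Finset.mul_sum]
    calc ∑ v ∈ (Finset.range q).filter (fun v => d ∣ v), (v : ℝ)⁻¹ ≤
        ∑ v ∈ (Finset.range q).image (fun w => d * w), (v : ℝ)⁻¹ := by
          apply Finset.sum_le_sum_of_subset_of_nonneg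
          · intro v hv
            simp only [Finset.mem_filter, Finset.mem_range, Finset.mem_image] at hv ⊢
            obtain ⟨hv, w, rfl⟩ := hv
            exact ⟨w, by nlinarith, rfl⟩
          · intros; positivity
      _ = ∑ w ∈ Finset.range q, ((d * w : ℕ) : ℝ)⁻¹ := by
          rw [Finset.sum_image]
          intro x _ y _ h
          exact Nat.eq_of_mul_eq_mul_left hd h
      _ ≤ _ := by
          apply Finset.sum_le_sum
          intro w _
          push_cast; rw [mul_inv]
  have h2 : ∑ w ∈ Finset.range q, ((w : ℝ))⁻¹ ≤ 1 + Real.log q := by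
    refine le_trans ?_ (harmonic_le_one_add_log q)
    rw [harmonic]
    push_cast
    obtain ⟨m, rfl⟩ : ∃ m, q = m + 1 := ⟨q - 1, by omega⟩
    rw [Finset.sum_range_succ']
    rw [Finset.sum_range_succ]
    simp only [Nat.cast_zero, inv_zero, add_zero, Nat.cast_add, Nat.cast_one]
    have : (0:ℝ) ≤ ((m : ℝ) + 1)⁻¹ := by positivity
    linarith
  have h3 : 0 ≤ 1 + Real.log q := by
    have := Real.log_natCast_nonneg q; linarith
  have hd1 : (1 : ℝ) ≤ d := by exact_mod_cast hd
  have h4 : √(d : ℝ) * (d : ℝ)⁻¹ ≤ 1 := by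
    rw [← div_eq_mul_inv, div_le_one (by positivity)]
    rw [Real.sqrt_le_left (by positivity)]
    nlinarith
  calc _ ≤ √(d : ℝ) * ((d : ℝ)⁻¹ * (1 + Real.log q)) := by
        gcongr; exact h1.trans (by gcongr)
    _ = (√(d : ℝ) * (d : ℝ)⁻¹) * (1 + Real.log q) := by ring
    _ ≤ 1 * (1 + Real.log q) := by gcongr
    _ = _ := one_mul _

theorem kl_Z {q : ℕ} [NeZero q] : ∑ n : ZMod q, klLa n * √(klg n) ≤
    (q : ℝ) / 2 * (q.divisors.card * (1 + Real.log q)) := by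
  have hq : 0 < q := Nat.pos_of_ne_zero (NeZero.ne q)
  have h1 : ∑ n : ZMod q, klLa n * √(klg n) ≤ (q : ℝ) / 2 * ∑ n : ZMod q, (n.val : ℝ)⁻¹ * √(klg n) := by
    calc _ ≤ ∑ n : ZMod q, ((q : ℝ) / 4 * ((n.val : ℝ)⁻¹ + ((-n).val : ℝ)⁻¹)) * √(klg n) := by
          apply Finset.sum_le_sum
          intro n _
          gcongr; exact klLa_le n
      _ = (q : ℝ) / 4 * (∑ n : ZMod q, (n.val : ℝ)⁻¹ * √(klg n) + ∑ n : ZMod q, ((-n).val : ℝ)⁻¹ * √(klg (-n))) := by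
          rw [← Finset.sum_add_distrib, Finset.mul_sum]
          apply Finset.sum_congr rfl
          intro n _
          rw [klg_neg]; ring
      _ = _ := by
          rw [show ∑ n : ZMod q, ((-n).val : ℝ)⁻¹ * √(klg (-n)) = ∑ n : ZMod q, (n.val : ℝ)⁻¹ * √(klg n) from
            Equiv.sum_comp (Equiv.neg (ZMod q)) (fun n => (n.val : ℝ)⁻¹ * √(klg n))]
          ring
  refine h1.trans ?_
  gcongr
  calc ∑ n : ZMod q, (n.val : ℝ)⁻¹ * √(klg n) ≤ ∑ n : ZMod q, (n.val : ℝ)⁻¹ * √(Nat.gcd n.val q) := by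
        apply Finset.sum_le_sum
        intro n _
        gcongr; exact klg_le_gcd n
    _ = ∑ v ∈ Finset.range q, (v : ℝ)⁻¹ * √(Nat.gcd v q) := by
        refine Finset.sum_bij (fun n _ => n.val) ?_ ?_ ?_ ?_
        · intro n _; simpa using ZMod.val_lt n
        · intro n _ m _ h; exact ZMod.val_injective q h
        · intro v hv
          exact ⟨(v : ZMod q), by simp, ZMod.val_natCast_of_lt (Finset.mem_range.1 hv)⟩
        · intros; rfl
    _ ≤ ∑ v ∈ Finset.range q, ∑ d ∈ q.divisors, if d ∣ v then √d * (v : ℝ)⁻¹ else 0 := by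
        apply Finset.sum_le_sum
        intro v _
        have hm : Nat.gcd v q ∈ q.divisors := Nat.mem_divisors.2 ⟨Nat.gcd_dvd_right _ _, hq.ne'⟩
        refine le_trans ?_ (Finset.single_le_sum (f := fun d : ℕ => if d ∣ v then √d * (v : ℝ)⁻¹ else 0) ?_ hm)
        · rw [if_pos (Nat.gcd_dvd_left _ _), mul_comm]
        · intro d _
          positivity
    _ = ∑ d ∈ q.divisors, √d * ∑ v ∈ (Finset.range q).filter (fun v => d ∣ v), (v : ℝ)⁻¹ := by
        rw [Finset.sum_comm]
        apply Finset.sum_congr rfl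
        intro d _
        rw [Finset.mul_sum, Finset.sum_filter]
    _ ≤ ∑ d ∈ q.divisors, (1 + Real.log q) := by
        apply Finset.sum_le_sum
        intro d hd
        exact kl_harm q d hq (Nat.pos_of_mem_divisors hd)
    _ = _ := by simp; ring

theorem kl_Z' {q : ℕ} [NeZero q] : ∑ n : ZMod q, klLa n ≤
    (q : ℝ) / 2 * (q.divisors.card * (1 + Real.log q)) := by
  refine le_trans ?_ kl_Z
  apply Finset.sum_le_sum
  intro n _
  have h1 : (1 : ℝ) ≤ √(klg n) := by
    rw [Real.one_le_sqrt]; exact_mod_cast klg_pos n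
  have := klLa_nonneg n
  nlinarith

theorem kl_count_final {q : ℕ} [NeZero q] (A h c s : ZMod q) (hh : IsUnit h) (L : ℕ) (hL : L ≤ q) (F : ℕ → ℕ)
    (hF : ∀ i < L, (F i : ZMod q) = c + s * (A + i)) :
    |(∑ i ∈ Finset.range L, ∑ j ∈ Finset.range (F i), (if (A + i) * (j + 1 : ZMod q) = h then (1 : ℝ) else 0)) -
      (∑ i ∈ Finset.range L, (if IsUnit (A + i) then (F i : ℝ) else 0)) / q| ≤
    2 * (8 ^ q.primeFactors.card * q.divisors.card) ^ 2 * (1 + Real.log q) ^ 2 * √q := by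
  classical
  have hq : 0 < q := Nat.pos_of_ne_zero (NeZero.ne q)
  have hq0 : (0 : ℝ) < q := by exact_mod_cast hq
  refine (kl_count_main A h c s hh L hL F hF).trans ?_
  have h1 := kl_Z (q := q)
  have h2 := kl_Z' (q := q)
  set τ : ℝ := (q.divisors.card : ℝ) with hτ
  set l : ℝ := 1 + Real.log q with hl
  have hτ1 : 1 ≤ τ := by
    rw [hτ]; exact_mod_cast Finset.card_pos.2 ⟨1, by simp [hq.ne']⟩
  have hl1 : 1 ≤ l := by
    have := Real.log_natCast_nonneg q; linarith
  have hΛ0 : 0 ≤ ∑ m : ZMod q, klLa m := Finset.sum_nonneg fun m _ => klLa_nonneg m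
  have hw1 : (1 : ℝ) ≤ 8 ^ q.primeFactors.card := one_le_pow₀ (by norm_num)
  set w : ℝ := 8 ^ q.primeFactors.card with hw
  have h3 : 1 + 2 * (∑ m : ZMod q, klLa m) / q ≤ 1 + τ * l := by
    have : 2 * (∑ m : ZMod q, klLa m) / q ≤ τ * l := by
      rw [div_le_iff₀ hq0]; linarith
    linarith
  have h4 : 1 ≤ τ * l := one_le_mul_of_one_le_of_one_le hτ1 hl1
  calc _ ≤ 2 / q * ((1 + τ * l) * w * √q) * ((q : ℝ) / 2 * (τ * l)) := by
        have : 0 ≤ ∑ n : ZMod q, klLa n * √(klg n) :=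
          Finset.sum_nonneg fun m _ => mul_nonneg (klLa_nonneg m) (Real.sqrt_nonneg _)
        gcongr
    _ = (1 + τ * l) * (τ * l) * w * √q := by field_simp
    _ ≤ (2 * (τ * l)) * (τ * l) * (w * w) * √q := by
        gcongr
        · linarith
        · nlinarith
    _ = _ := by ring


theorem kl_integral (c s a b : ℝ) : ∫ x in a..b, (c + s * x) = (b - a) * ((c + s * a) + (c + s * b)) / 2 := by
  rw [intervalIntegral.integral_add (by simp) (by apply Continuous.intervalIntegrable; fun_prop),
    intervalIntegral.integral_const_mul, integral_id]
  simp
  ring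

theorem kl_moebius (q : ℕ) [NeZero q] (hq : q ≠ 0) (x : ℤ) :
    ∑ d ∈ q.divisors, (if (d : ℤ) ∣ x then (ArithmeticFunction.moebius d : ℝ) else 0) =
      if IsUnit (x : ZMod q) then 1 else 0 := by
  have h1 : ∀ n : ℕ, n ≠ 0 → ∑ d ∈ n.divisors, (ArithmeticFunction.moebius d : ℤ) = if n = 1 then 1 else 0 := by
    intro n hn
    have := congrArg (fun f : ArithmeticFunction ℤ => f n) ArithmeticFunction.coe_zeta_mul_moebius
    simp only [ArithmeticFunction.coe_zeta_mul_apply, ArithmeticFunction.one_apply] at this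
    exact this
  have hg : Int.gcd x q ≠ 0 := by
    intro h
    exact hq (by exact_mod_cast (Int.gcd_eq_zero_iff.1 h).2)
  have h2 := h1 (Int.gcd x q) hg
  rw [← Finset.sum_filter]
  have h3 : q.divisors.filter (fun d : ℕ => (d : ℤ) ∣ x) = (Int.gcd x q).divisors := by
    ext d
    simp only [Finset.mem_filter, Nat.mem_divisors]
    constructor
    · rintro ⟨⟨h, _⟩, h'⟩
      exact ⟨Int.dvd_gcd h' (by exact_mod_cast h), hg⟩
    · rintro ⟨h, _⟩
      have h' : (d : ℤ) ∣ Int.gcd x q := by exact_mod_cast h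
      exact ⟨⟨by exact_mod_cast h'.trans (Int.gcd_dvd_right _ _), hq⟩, h'.trans (Int.gcd_dvd_left _ _)⟩
  rw [h3]
  have h4 : IsUnit (x : ZMod q) ↔ Int.gcd x q = 1 := by
    rw [ZMod.coe_int_isUnit_iff_isCoprime, Int.isCoprime_iff_gcd_eq_one, Int.gcd_comm]
  rw [if_congr h4 rfl rfl]
  have h5 := congrArg (Int.cast : ℤ → ℝ) h2
  push_cast at h5
  exact h5

theorem kl_totient (q : ℕ) (hq : q ≠ 0) :
    (q.totient : ℝ) / q = ∑ d ∈ q.divisors, (ArithmeticFunction.moebius d : ℝ) / d := by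
  have h := (ArithmeticFunction.sum_eq_iff_sum_mul_moebius_eq (f := fun n => (n.totient : ℝ)) (g := fun n => (n : ℝ))).1
    (by intro n _; exact_mod_cast Nat.sum_totient n) q (Nat.pos_of_ne_zero hq)
  rw [← h, Nat.sum_divisorsAntidiagonal (f := fun i j => (ArithmeticFunction.moebius i : ℝ) * (j : ℝ)), Finset.sum_div]
  apply Finset.sum_congr rfl
  intro d hd
  have hdq := Nat.dvd_of_mem_divisors hd
  have hd0 : (d : ℝ) ≠ 0 := by exact_mod_cast (Nat.pos_of_mem_divisors hd).ne'
  have hq0 : (q : ℝ) ≠ 0 := by exact_mod_cast hq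
  rw [Nat.cast_div hdq hd0]
  field_simp

theorem kl_trap (α β : ℝ) (m : ℤ) (K : ℕ) :
    ∑ k ∈ Finset.Icc m (m + K - 1), (α + β * (k : ℝ)) = (K : ℝ) * ((α + β * m) + (α + β * (m + K - 1))) / 2 := by
  induction K with
  | zero => simp
  | succ K ih =>
    have : Finset.Icc m (m + ((K + 1 : ℕ) : ℤ) - 1) = insert (m + K) (Finset.Icc m (m + K - 1)) := by
      ext k; simp only [Finset.mem_Icc, Finset.mem_insert]; push_cast; omega
    rw [this, Finset.sum_insert (by simp), ih]
    push_cast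
    ring

theorem kl_sum_int (α β a b q : ℝ) (hab : a ≤ b) (hg : ∀ x, a ≤ x → x ≤ b → 0 ≤ α + β * x ∧ α + β * x ≤ q) :
    |∑ k ∈ Finset.Icc ⌈a⌉ ⌊b⌋, (α + β * (k : ℝ)) - (b - a) * ((α + β * a) + (α + β * b)) / 2| ≤ 2 * q := by
  have ha1 := Int.le_ceil a
  have ha2 := Int.ceil_lt_add_one a
  have hb1 := Int.floor_le b
  have hb2 := Int.lt_floor_add_one b
  obtain ⟨ga, ga'⟩ := hg a le_rfl hab
  obtain ⟨gb, gb'⟩ := hg b hab le_rfl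
  rcases le_or_gt ⌈a⌉ ⌊b⌋ with h | h
  · have hr : (⌈a⌉ : ℝ) ≤ ⌊b⌋ := by exact_mod_cast h
    obtain ⟨K, hK⟩ : ∃ K : ℕ, ⌊b⌋ = ⌈a⌉ + K - 1 := ⟨(⌊b⌋ + 1 - ⌈a⌉).toNat, by omega⟩
    have hKr : (⌊b⌋ : ℝ) = ⌈a⌉ + K - 1 := by rw [hK]; push_cast; ring
    have hs := kl_trap α β ⌈a⌉ K
    rw [← hK, ← hKr] at hs
    have hKe : (K : ℝ) = ⌊b⌋ - ⌈a⌉ + 1 := by linarith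
    rw [hs, hKe]
    set m : ℝ := (⌈a⌉ : ℝ)
    set n : ℝ := (⌊b⌋ : ℝ)
    obtain ⟨gm, gm'⟩ := hg m ha1 (hr.trans hb1)
    obtain ⟨gn, gn'⟩ := hg n (ha1.trans hr) hb1
    have id1 : (n - m + 1) * (α + β * m + (α + β * n)) / 2 - (b - a) * ((α + β * a) + (α + β * b)) / 2 =
      ((α + β * m) + (α + β * n)) / 2 - (m - a) * (((α + β * a) + (α + β * m)) / 2)
        - (b - n) * (((α + β * n) + (α + β * b)) / 2) := by ring
    rw [id1]
    have e1 : 0 ≤ (m - a) * (((α + β * a) + (α + β * m)) / 2) := mul_nonneg (by linarith) (by linarith)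
    have e2 : 0 ≤ (b - n) * (((α + β * n) + (α + β * b)) / 2) := mul_nonneg (by linarith) (by linarith)
    have e3 : (m - a) * (((α + β * a) + (α + β * m)) / 2) ≤ 1 * q :=
      mul_le_mul (by linarith) (by linarith) (by linarith) (by norm_num)
    have e4 : (b - n) * (((α + β * n) + (α + β * b)) / 2) ≤ 1 * q :=
      mul_le_mul (by linarith) (by linarith) (by linarith) (by norm_num)
    rw [abs_le]; constructor <;> linarith
  · rw [Finset.Icc_eq_empty (by omega), Finset.sum_empty, zero_sub, abs_neg]
    have hr : (⌊b⌋ : ℝ) + 1 ≤ ⌈a⌉ := by exact_mod_cast h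
    have e1 : 0 ≤ (b - a) * (((α + β * a) + (α + β * b)) / 2) := mul_nonneg (by linarith) (by linarith)
    have e3 : (b - a) * (((α + β * a) + (α + β * b)) / 2) ≤ 2 * q :=
      mul_le_mul (by linarith) (by linarith) (by linarith) (by norm_num)
    rw [mul_div_assoc, abs_of_nonneg e1]; exact e3

theorem kl_main_term (q : ℕ) [NeZero q] (hq : q ≠ 0) (c s x₀ y₀ : ℝ) (hxy : x₀ ≤ y₀)
    (hf : ∀ x, x₀ ≤ x → x ≤ y₀ → 0 ≤ c + s * x ∧ c + s * x ≤ q) :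
    |(∑ x ∈ Finset.Icc ⌈x₀⌉ ⌊y₀⌋, if IsUnit (x : ZMod q) then (c + s * (x : ℝ)) else 0) / q -
      (q.totient : ℝ) / (q : ℝ) ^ 2 * ∫ x in x₀..y₀, (c + s * x)| ≤ 2 * q.divisors.card := by
  have hq0 : (0 : ℝ) < q := by exact_mod_cast Nat.pos_of_ne_zero hq
  set J := ∫ x in x₀..y₀, (c + s * x) with hJ
  rw [kl_integral] at hJ
  have hSd : ∀ d ∈ q.divisors, |∑ x ∈ (Finset.Icc ⌈x₀⌉ ⌊y₀⌋).filter (fun x => (d : ℤ) ∣ x), (c + s * (x : ℝ)) - J / d| ≤ 2 * q := by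
    intro d hd
    have hd0 : (0 : ℝ) < d := by exact_mod_cast Nat.pos_of_mem_divisors hd
    have hdz : (d : ℤ) ≠ 0 := by exact_mod_cast (Nat.pos_of_mem_divisors hd).ne'
    have h1 := kl_sum_int c (s * d) (x₀ / d) (y₀ / d) q (by gcongr) (by
      intro x hx hx'
      rw [div_le_iff₀ hd0] at hx
      rw [le_div_iff₀ hd0] at hx'
      have := hf (x * d) hx hx'
      rwa [show s * d * x = s * (x * d) by ring])
    have h2 : (y₀ / d - x₀ / d) * ((c + s * d * (x₀ / d)) + (c + s * d * (y₀ / d))) / 2 = J / d := by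
      rw [hJ]; field_simp
    rw [h2] at h1
    have h3 : ∑ x ∈ (Finset.Icc ⌈x₀⌉ ⌊y₀⌋).filter (fun x => (d : ℤ) ∣ x), (c + s * (x : ℝ)) =
        ∑ k ∈ Finset.Icc ⌈x₀ / d⌉ ⌊y₀ / d⌋, (c + s * d * (k : ℝ)) := by
      symm
      refine Finset.sum_bij (fun k _ => (d : ℤ) * k) ?_ ?_ ?_ ?_
      · intro k hk
        simp only [Finset.mem_Icc, Finset.mem_filter, Int.ceil_le, Int.le_floor] at hk ⊢
        push_cast
        rw [div_le_iff₀ hd0, le_div_iff₀ hd0] at hk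
        exact ⟨⟨by linarith, by linarith⟩, dvd_mul_right _ _⟩
      · intro k _ k' _ h
        exact mul_left_cancel₀ hdz h
      · intro x hx
        simp only [Finset.mem_Icc, Finset.mem_filter, Int.ceil_le, Int.le_floor] at hx
        obtain ⟨hx, k, rfl⟩ := hx
        refine ⟨k, ?_, rfl⟩
        push_cast at hx
        simp only [Finset.mem_Icc, Int.ceil_le, Int.le_floor]
        rw [div_le_iff₀ hd0, le_div_iff₀ hd0]
        exact ⟨by linarith, by linarith⟩
      · intro k _
        push_cast; ring
    rw [h3]; exact h1
  have hM : (∑ x ∈ Finset.Icc ⌈x₀⌉ ⌊y₀⌋, if IsUnit (x : ZMod q) then (c + s * (x : ℝ)) else 0) =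
      ∑ d ∈ q.divisors, (ArithmeticFunction.moebius d : ℝ) *
        ∑ x ∈ (Finset.Icc ⌈x₀⌉ ⌊y₀⌋).filter (fun x => (d : ℤ) ∣ x), (c + s * (x : ℝ)) := by
    simp_rw [Finset.sum_filter, Finset.mul_sum]
    rw [Finset.sum_comm]
    apply Finset.sum_congr rfl
    intro x _
    have := kl_moebius q hq x
    have h2 : (if IsUnit (x : ZMod q) then (c + s * (x : ℝ)) else 0) = (if IsUnit (x : ZMod q) then 1 else 0) * (c + s * (x : ℝ)) := by
      split_ifs <;> simp
    rw [h2, ← this, Finset.sum_mul]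
    apply Finset.sum_congr rfl
    intro d _
    split_ifs <;> simp
  have hdiff : (∑ x ∈ Finset.Icc ⌈x₀⌉ ⌊y₀⌋, if IsUnit (x : ZMod q) then (c + s * (x : ℝ)) else 0) / q -
      (q.totient : ℝ) / (q : ℝ) ^ 2 * J = (∑ d ∈ q.divisors, (ArithmeticFunction.moebius d : ℝ) *
        (∑ x ∈ (Finset.Icc ⌈x₀⌉ ⌊y₀⌋).filter (fun x => (d : ℤ) ∣ x), (c + s * (x : ℝ)) - J / d)) / q := by
    rw [hM, show (q.totient : ℝ) / (q : ℝ) ^ 2 * J = (q.totient : ℝ) / q * J / q by field_simp, kl_totient q hq,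
      ← sub_div, Finset.sum_mul, ← Finset.sum_sub_distrib]
    congr 1
    apply Finset.sum_congr rfl
    intro d _
    ring
  rw [hdiff, abs_div, abs_of_pos hq0, div_le_iff₀ hq0]
  refine (Finset.abs_sum_le_sum_abs _ _).trans ?_
  calc _ ≤ ∑ d ∈ q.divisors, (2 * q : ℝ) := by
        apply Finset.sum_le_sum
        intro d hd
        rw [abs_mul]
        have : |(ArithmeticFunction.moebius d : ℝ)| ≤ 1 := by
          exact_mod_cast ArithmeticFunction.abs_moebius_le_one (n := d)
        calc _ ≤ 1 * (2 * q : ℝ) := mul_le_mul this (hSd d hd) (abs_nonneg _) (by norm_num)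
          _ = _ := one_mul _
    _ = _ := by rw [Finset.sum_const, nsmul_eq_mul]; ring


theorem kl_ncard (q : ℕ) [NeZero q] (h c s : ℤ) (x₀ y₀ : ℝ) (hq2 : 2 ≤ q) (hg : Int.gcd h (q : ℤ) = 1) :
    ({P : ℤ × ℤ | (P.1 : ℝ) ∈ Set.Icc x₀ y₀ ∧ 0 ≤ P.2 ∧
            (P.2 : ℝ) ≤ (c : ℝ) + s * P.1 ∧
            P.1 * P.2 ≡ h [ZMOD (q : ℤ)]}.ncard : ℝ) =
    ∑ i ∈ Finset.range (⌊y₀⌋ + 1 - ⌈x₀⌉).toNat, ∑ j ∈ Finset.range (c + s * (⌈x₀⌉ + i)).toNat,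
      (if (((⌈x₀⌉ : ℤ) : ZMod q) + i) * (j + 1 : ZMod q) = (h : ZMod q) then (1 : ℝ) else 0) := by
  rw [Finset.sum_sigma', ← Finset.sum_filter, Finset.sum_const, nsmul_eq_mul, mul_one]
  norm_cast
  rw [← Finset.card_image_of_injective (f := fun p : (_ : ℕ) × ℕ => ((⌈x₀⌉ + p.1 : ℤ), (p.2 + 1 : ℤ))),
    ← Set.ncard_coe_finset]
  · congr 1
    ext ⟨x, y⟩
    simp only [Set.mem_setOf_eq, Set.mem_Icc, Finset.coe_image, Set.mem_image, Finset.mem_coe, Finset.mem_filter,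
      Finset.mem_sigma, Finset.mem_range, Prod.mk.injEq]
    constructor
    · rintro ⟨⟨h1, h2⟩, h3, h4, h5⟩
      have h1' := Int.ceil_le.2 h1
      have h2' := Int.le_floor.2 h2
      have h4' : y ≤ c + s * x := by exact_mod_cast h4
      have hy : y ≠ 0 := by
        rintro rfl
        rw [mul_zero] at h5
        have hd : (q : ℤ) ∣ h := by simpa using h5.dvd
        have : (q : ℤ) ∣ Int.gcd h q := Int.dvd_coe_gcd hd dvd_rfl
        rw [hg] at this
        have := Int.le_of_dvd (by norm_num) this
        omega
      refine ⟨⟨(x - ⌈x₀⌉).toNat, (y - 1).toNat⟩, ⟨⟨by dsimp only; omega, ?_⟩, ?_⟩, by dsimp only; omega, by dsimp only; omega⟩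
      · dsimp only
        rw [show (⌈x₀⌉ + ((x - ⌈x₀⌉).toNat : ℤ)) = x by omega]; omega
      · dsimp only
        have e := (ZMod.intCast_eq_intCast_iff _ _ _).2 h5
        rw [← e]
        push_cast
        have e1 : (((x - ⌈x₀⌉).toNat : ℕ) : ZMod q) = (x : ZMod q) - (⌈x₀⌉ : ℤ) := by
          rw [← Int.cast_sub, ← Int.cast_natCast, Int.toNat_of_nonneg (by omega)]
        have e2 : (((y - 1).toNat : ℕ) : ZMod q) = (y : ZMod q) - 1 := by
          rw [← Int.cast_natCast, Int.toNat_of_nonneg (by omega)]; push_cast; rfl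
        rw [e1, e2]; ring
    · rintro ⟨⟨i, j⟩, ⟨⟨h1, h2⟩, h3⟩, rfl, rfl⟩
      dsimp only at h1 h2 h3
      have h4 : ((j : ℤ) + 1) ≤ c + s * (⌈x₀⌉ + i) := by omega
      refine ⟨⟨Int.ceil_le.1 (by dsimp only; omega), Int.le_floor.1 (by dsimp only; omega)⟩, by dsimp only; omega, by exact_mod_cast h4, ?_⟩
      rw [← ZMod.intCast_eq_intCast_iff]
      push_cast at h3 ⊢
      exact h3
  · rintro ⟨i, j⟩ ⟨i', j'⟩ hh
    simp only [Prod.mk.injEq] at hh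
    obtain ⟨a, b⟩ := hh
    have : i = i' := by omega
    have : j = j' := by omega
    subst i' j'; rfl

theorem kl_final_bound (q : ℕ) [NeZero q] (h c s : ℤ) (x₀ y₀ : ℝ) (hq2 : 2 ≤ q) (hg : Int.gcd h (q : ℤ) = 1)
    (hxy : x₀ ≤ y₀) (hlt : y₀ - x₀ < q)
    (hf : ∀ x ∈ Set.Icc x₀ y₀, (c : ℝ) + s * x ∈ Set.Icc (0 : ℝ) (q : ℝ)) :
      |({P : ℤ × ℤ | (P.1 : ℝ) ∈ Set.Icc x₀ y₀ ∧ 0 ≤ P.2 ∧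
            (P.2 : ℝ) ≤ (c : ℝ) + s * P.1 ∧
            P.1 * P.2 ≡ h [ZMOD (q : ℤ)]}.ncard : ℝ) -
          (q.totient : ℝ) / (q : ℝ) ^ 2 * ∫ x in x₀..y₀, ((c : ℝ) + s * x)|
        ≤ 2 * q.divisors.card + 2 * (8 ^ q.primeFactors.card * q.divisors.card) ^ 2 * (1 + Real.log q) ^ 2 * √q := by
  rw [kl_ncard q h c s x₀ y₀ hq2 hg]
  have hm := kl_main_term q (NeZero.ne q) c s x₀ y₀ hxy (fun x h1 h2 => hf x ⟨h1, h2⟩)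
  set L := (⌊y₀⌋ + 1 - ⌈x₀⌉).toNat with hL
  set F : ℕ → ℕ := fun i => (c + s * (⌈x₀⌉ + i)).toNat with hF
  have hFn : ∀ i < L, ((F i : ℕ) : ℤ) = c + s * (⌈x₀⌉ + i) := by
    intro i hi
    have hx1 : x₀ ≤ ((⌈x₀⌉ + i : ℤ) : ℝ) := Int.ceil_le.1 (by omega)
    have hx2 : ((⌈x₀⌉ + i : ℤ) : ℝ) ≤ y₀ := Int.le_floor.1 (by omega)
    have := (hf _ ⟨hx1, hx2⟩).1
    have h0 : 0 ≤ c + s * (⌈x₀⌉ + i) := by exact_mod_cast this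
    exact Int.toNat_of_nonneg h0
  have hLq : L ≤ q := by
    have h1 := Int.le_ceil x₀
    have h2 := Int.floor_le y₀
    have h3 : ((⌊y₀⌋ - ⌈x₀⌉ : ℤ) : ℝ) < ((q : ℤ) : ℝ) := by push_cast; linarith
    have h4 : ⌊y₀⌋ - ⌈x₀⌉ < q := by exact_mod_cast h3
    omega
  have hu : IsUnit (h : ZMod q) := by
    rw [ZMod.coe_int_isUnit_iff_isCoprime, Int.isCoprime_iff_gcd_eq_one, Int.gcd_comm]; exact hg
  have hc := kl_count_final (q := q) ((⌈x₀⌉ : ℤ) : ZMod q) h c s hu L hLq F (by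
    intro i hi
    have := congrArg (Int.cast : ℤ → ZMod q) (hFn i hi)
    push_cast at this
    exact this)
  have hS : (∑ i ∈ Finset.range L, (if IsUnit (((⌈x₀⌉ : ℤ) : ZMod q) + i) then (F i : ℝ) else 0)) =
      ∑ x ∈ Finset.Icc ⌈x₀⌉ ⌊y₀⌋, if IsUnit (x : ZMod q) then ((c : ℝ) + s * (x : ℝ)) else 0 := by
    refine Finset.sum_bij (fun i _ => (⌈x₀⌉ + i : ℤ)) ?_ ?_ ?_ ?_
    · intro i hi
      rw [Finset.mem_range] at hi
      rw [Finset.mem_Icc]; omega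
    · intro i _ j _ hh
      omega
    · intro x hx
      rw [Finset.mem_Icc] at hx
      exact ⟨(x - ⌈x₀⌉).toNat, by rw [Finset.mem_range]; omega, by omega⟩
    · intro i hi
      have := congrArg (Int.cast : ℤ → ℝ) (hFn i (Finset.mem_range.1 hi))
      push_cast at this ⊢
      rw [this]
  rw [hS] at hc
  rw [abs_le] at hm hc ⊢
  constructor <;> linarith [hm.1, hm.2, hc.1, hc.2]

theorem stmt17 : ∀ ε > (0 : ℝ), ∃ C > (0 : ℝ),
    ∀ (q : ℕ) (h c s : ℤ) (x₀ y₀ : ℝ),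
      2 ≤ q → Int.gcd h (q : ℤ) = 1 → (s = 1 ∨ s = -1) →
      x₀ ≤ y₀ → y₀ - x₀ < q →
      (∀ x ∈ Set.Icc x₀ y₀, (c : ℝ) + s * x ∈ Set.Icc (0 : ℝ) (q : ℝ)) →
      |({P : ℤ × ℤ | (P.1 : ℝ) ∈ Set.Icc x₀ y₀ ∧ 0 ≤ P.2 ∧
            (P.2 : ℝ) ≤ (c : ℝ) + s * P.1 ∧
            P.1 * P.2 ≡ h [ZMOD (q : ℤ)]}.ncard : ℝ) -
          (q.totient : ℝ) / (q : ℝ) ^ 2 * ∫ x in x₀..y₀, ((c : ℝ) + s * x)|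
        ≤ C * (q : ℝ) ^ ((1 : ℝ) / 2 + ε) := by
  intro ε hε
  obtain ⟨C₁, hC₁, hC⟩ := kl_divisor (ε / 4) (by positivity)
  refine ⟨4 * C₁ ^ 2 * (1 + 4 / ε) ^ 2, by positivity, ?_⟩
  intro q h c s x₀ y₀ hq2 hg _ hxy hlt hf
  have hq0 : q ≠ 0 := by omega
  haveI : NeZero q := ⟨hq0⟩
  refine (kl_final_bound q h c s x₀ y₀ hq2 hg hxy hlt hf).trans ?_
  have hq1 : (1 : ℝ) ≤ q := by exact_mod_cast (by omega : 1 ≤ q)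
  have hqp : (0 : ℝ) < q := by linarith
  have hD := hC q hq0
  set τ : ℝ := (q.divisors.card : ℝ) with hτ
  set D : ℝ := 8 ^ q.primeFactors.card * τ with hDd
  have hτ1 : 1 ≤ τ := by
    rw [hτ]; exact_mod_cast Finset.card_pos.2 ⟨1, by simp [hq0]⟩
  have hτD : τ ≤ D := le_mul_of_one_le_left (by linarith) (one_le_pow₀ (by norm_num))
  have hlog : 0 ≤ Real.log q := Real.log_nonneg hq1
  have hl : Real.log q ≤ (q : ℝ) ^ (ε / 4) / (ε / 4) := Real.log_le_rpow_div hqp.le (by positivity)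
  set Q : ℝ := (q : ℝ) ^ (ε / 4) with hQ
  have hQ1 : 1 ≤ Q := Real.one_le_rpow hq1 (by positivity)
  have hl2 : 1 + Real.log q ≤ (1 + 4 / ε) * Q := by
    have : Q / (ε / 4) = 4 / ε * Q := by field_simp
    rw [this] at hl
    nlinarith
  have hsq : 1 ≤ √(q : ℝ) := by rw [Real.one_le_sqrt]; exact hq1
  have hQQ : (q : ℝ) ^ ((1 : ℝ) / 2 + ε) = √q * Q ^ 4 := by
    rw [Real.rpow_add hqp, Real.sqrt_eq_rpow, hQ, ← Real.rpow_natCast, ← Real.rpow_mul hqp.le]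
    congr 2; push_cast; ring
  have hX : D ^ 2 * (1 + Real.log q) ^ 2 * √q ≤ (C₁ * Q) ^ 2 * ((1 + 4 / ε) * Q) ^ 2 * √q := by
    have hD0 : 0 ≤ D := by linarith
    gcongr
  have hY : τ ≤ D ^ 2 * (1 + Real.log q) ^ 2 * √q := by
    have a1 : D ≤ D ^ 2 := by nlinarith
    have a2 : (1 : ℝ) ≤ (1 + Real.log q) ^ 2 := by nlinarith
    calc τ ≤ D ^ 2 := hτD.trans a1
      _ ≤ D ^ 2 * (1 + Real.log q) ^ 2 := le_mul_of_one_le_right (by positivity) a2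
      _ ≤ _ := le_mul_of_one_le_right (by positivity) hsq
  rw [hQQ]
  calc _ ≤ 4 * ((C₁ * Q) ^ 2 * ((1 + 4 / ε) * Q) ^ 2 * √q) := by linarith
    _ = _ := by ring
end
end

section
/- There exists a constant C > 0 such that for all integers N ≥ 2, | Σ_{m ≤ N, m odd} φ(m)/m² − (2/(3ζ(2)))·( log N + γ + (2 log 2)/3 − ζ′(2)/ζ(2) ) | ≤ C·(log N)²/N, where the sum is over odd positive integers m ≤ N, φ is Euler's totient function, ζ is the Riemann zeta function, ζ′ its derivative, ζ(2) = π²/6, and γ is the Euler–Mascheroni constant. -/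
noncomputable section
/-- Moebius function restricted to the odd integers. -/
def gg (n : ℕ) : ℝ := if Odd n then ((ArithmeticFunction.moebius n : ℤ) : ℝ) else 0

lemma abs_gg_le (n : ℕ) : |gg n| ≤ 1 := by
  unfold gg
  split_ifs
  · exact_mod_cast ArithmeticFunction.abs_moebius_le_one
  · simp

def cf (n : ℕ) : ℂ := ((gg n : ℝ) : ℂ)

lemma cf_eq : cf = (fun n : ℕ => (1 : DirichletCharacter ℂ 2) n) *
    (fun n : ℕ => ((ArithmeticFunction.moebius n : ℤ) : ℂ)) := by
  funext n
  simp only [cf, gg, Pi.mul_apply]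
  by_cases h : Odd n
  · have : IsUnit ((n : ZMod 2)) := by
      rw [ZMod.isUnit_iff_coprime]; exact (Nat.coprime_two_right).2 h
    rw [MulChar.one_apply this]; simp [h]
  · have : ¬ IsUnit ((n : ZMod 2)) := by
      rw [ZMod.isUnit_iff_coprime]; exact fun h' => h ((Nat.coprime_two_right).1 h')
    rw [MulChar.map_nonunit _ this]; simp [h]

lemma cf_summable {s : ℂ} (hs : 1 < s.re) : LSeriesSummable cf s := by
  rw [cf_eq]
  exact DirichletCharacter.LSeriesSummable_mul _ (ArithmeticFunction.LSeriesSummable_moebius_iff.2 hs)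

lemma cf_abscissa : LSeries.abscissaOfAbsConv cf < ((2 : ℂ).re : EReal) := by
  refine lt_of_le_of_lt (LSeries.abscissaOfAbsConv_le_of_forall_lt_LSeriesSummable (x := 1) ?_) ?_
  · intro y hy; exact cf_summable (by simpa using hy)
  · simp only [Complex.re_ofNat]; exact_mod_cast (by norm_num : (1:ℝ) < 2)

lemma cf_LSeries {s : ℂ} (hs : 1 < s.re) :
    LSeries cf s = ((1 - (2 : ℂ) ^ (-s)) * riemannZeta s)⁻¹ := by
  have h1 := DirichletCharacter.LSeries.mul_mu_eq_one (1 : DirichletCharacter ℂ 2) hs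
  rw [← cf_eq, ← DirichletCharacter.LFunction_eq_LSeries _ hs] at h1
  have h2 := DirichletCharacter.LFunctionTrivChar_eq_mul_riemannZeta (N := 2) (s := s)
    (by rintro rfl; simp at hs)
  rw [Nat.Prime.primeFactors Nat.prime_two] at h2
  simp only [Finset.prod_singleton, Nat.cast_ofNat] at h2
  rw [← h2]
  exact eq_inv_of_mul_eq_one_right h1

lemma cf_hasDeriv : HasDerivAt (LSeries cf)
    (-((Real.log 2 / 4) * riemannZeta 2 + (3/4) * deriv riemannZeta 2) / ((3/4) * riemannZeta 2)^2) 2 := by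
  have e : (2:ℂ)^(-2:ℂ) = 1/4 := by
    rw [Complex.cpow_neg]; norm_num
  have hz : HasDerivAt riemannZeta (deriv riemannZeta 2) 2 :=
    (differentiableAt_riemannZeta (by norm_num)).hasDerivAt
  have hp : HasDerivAt (fun s : ℂ => 1 - (2:ℂ)^(-s)) (Real.log 2 / 4) 2 := by
    have := ((hasDerivAt_neg' (2:ℂ)).const_cpow (c := 2) (Or.inl (by norm_num))).const_sub 1
    refine this.congr_deriv ?_
    rw [e, Complex.ofReal_log (by norm_num)]; push_cast; ring
  have hm := hp.mul hz
  have hne : riemannZeta 2 ≠ 0 := riemannZeta_ne_zero_of_one_lt_re (by norm_num)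
  have := hm.inv (by simp only [Pi.mul_apply]; rw [e]; exact mul_ne_zero (by norm_num) hne)
  have h3 : LSeries cf =ᶠ[nhds 2] ((fun s : ℂ => 1 - (2:ℂ)^(-s)) * riemannZeta)⁻¹ := by
    have : {s : ℂ | 1 < s.re} ∈ nhds (2:ℂ) :=
      (isOpen_lt continuous_const Complex.continuous_re).mem_nhds (by norm_num)
    filter_upwards [this] with s hs
    rw [cf_LSeries hs]; rfl
  refine (this.congr_of_eventuallyEq h3).congr_deriv ?_
  simp only [Pi.mul_apply]; rw [e]; norm_num

def fA (d : ℕ) : ℝ := gg d / (d:ℝ)^2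
def fB (d : ℕ) : ℝ := gg d * Real.log d / (d:ℝ)^2

lemma hasSum_fA : HasSum fA ((4/3) / (Real.pi^2/6)) := by
  have h := (cf_summable (s := 2) (by norm_num)).LSeriesHasSum
  rw [cf_LSeries (by norm_num)] at h
  have h' := Complex.hasSum_re h
  convert h' using 1
  · funext n
    rcases eq_or_ne n 0 with rfl | hn
    · simp [fA]
    rw [LSeries.term_of_ne_zero hn]
    simp only [fA, cf]
    rw [show ((n:ℂ)^(2:ℂ)) = (((n:ℝ)^2 : ℝ) : ℂ) by push_cast; norm_cast, ← Complex.ofReal_div, Complex.ofReal_re]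
  · rw [riemannZeta_two]
    have e : (2:ℂ)^(-2:ℂ) = 1/4 := by
      rw [Complex.cpow_neg]; norm_num
    rw [e, show ((1 - 1/4) * ((Real.pi:ℂ)^2/6))⁻¹ = (((4/3) / (Real.pi^2/6) : ℝ) : ℂ) by
      push_cast; field_simp; norm_num]
    rw [Complex.ofReal_re]

lemma hasSum_fB : HasSum fB ((4/3) / (Real.pi^2/6) *
    ((deriv riemannZeta 2).re / (Real.pi^2/6) + Real.log 2 / 3)) := by
  have h := (LSeriesSummable_logMul_of_lt_re cf_abscissa).LSeriesHasSum
  have hd := (LSeries_hasDerivAt cf_abscissa).unique cf_hasDeriv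
  rw [show LSeries (LSeries.logMul cf) 2 = _ from neg_eq_iff_eq_neg.1 hd] at h
  have h' := Complex.hasSum_re h
  convert h' using 1
  · funext n
    rcases eq_or_ne n 0 with rfl | hn
    · simp [fB]
    rw [LSeries.term_of_ne_zero hn]
    simp only [fB, cf, LSeries.logMul]
    rw [show ((n:ℂ)^(2:ℂ)) = (((n:ℝ)^2 : ℝ) : ℂ) by push_cast; norm_cast, ← Complex.natCast_log, ← Complex.ofReal_mul, ← Complex.ofReal_div, Complex.ofReal_re, mul_comm]
  · rw [riemannZeta_two]
    have hpi : (Real.pi : ℂ) ≠ 0 := by exact_mod_cast Real.pi_ne_zero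
    rw [show -(-((Real.log 2 / 4 : ℂ) * ((Real.pi:ℂ)^2/6) + (3/4) * deriv riemannZeta 2) / ((3/4) * ((Real.pi:ℂ)^2/6))^2)
      = (((4/3) / (Real.pi^2/6) : ℝ) : ℂ) * (deriv riemannZeta 2 * ((1/(Real.pi^2/6) : ℝ) : ℂ) + ((Real.log 2/3 : ℝ) : ℂ)) by
      push_cast; field_simp; ring]
    rw [Complex.re_ofReal_mul, Complex.add_re, Complex.re_mul_ofReal, Complex.ofReal_re]
    ring

lemma oddH_eq (M : ℕ) : ∑ k ∈ Finset.Ioc 0 M, (if Odd k then 1 / (k:ℝ) else 0) =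
    (harmonic M : ℝ) - (1/2) * (harmonic (M/2) : ℝ) := by
  induction M with
  | zero => simp
  | succ M ih =>
    rw [Finset.sum_Ioc_succ_top (Nat.zero_le M), ih, harmonic_succ]
    by_cases h : Odd (M+1)
    · have : (M+1)/2 = M/2 := by obtain ⟨j, hj⟩ := h; omega
      rw [this, if_pos h]; push_cast; ring
    · rw [Nat.not_odd_iff_even] at h
      obtain ⟨j, hj⟩ := h
      obtain ⟨i, rfl⟩ : ∃ i, j = i + 1 := ⟨j - 1, by omega⟩
      have h1 : (M+1)/2 = i + 1 := by omega
      have h2 : M/2 = i := by omega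
      have h3 : M = 2 * i + 1 := by omega
      rw [h1, h2, harmonic_succ, if_neg (by rw [Nat.not_odd_iff_even]; exact ⟨_, hj⟩), h3]
      have : (i:ℝ) + 1 ≠ 0 := by positivity
      have : 2 * (i:ℝ) + 1 + 1 ≠ 0 := by positivity
      push_cast
      field_simp
      ring

def aF : ArithmeticFunction ℝ := ⟨fA, by simp [fA]⟩
def aG : ArithmeticFunction ℝ := ⟨fun k => if Odd k then 1 / (k:ℝ) else 0, by simp⟩

lemma aF_mul_aG (n : ℕ) (hn : 0 < n) :
    (aF * aG) n = if Odd n then (Nat.totient n : ℝ) / (n:ℝ)^2 else 0 := by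
  rw [ArithmeticFunction.mul_apply]
  simp only [aF, aG, ArithmeticFunction.coe_mk]
  split_ifs with h
  · have key := (ArithmeticFunction.sum_eq_iff_sum_mul_moebius_eq (R := ℝ)
      (f := fun n => (Nat.totient n : ℝ)) (g := fun n => (n : ℝ))).1
      (fun n _ => by exact_mod_cast Nat.sum_totient n) n hn
    rw [← key, Finset.sum_div]
    refine Finset.sum_congr rfl fun x hx => ?_
    obtain ⟨hx, -⟩ := Nat.mem_divisorsAntidiagonal.1 hx
    rw [← hx] at h ⊢
    obtain ⟨ha, hb⟩ := Nat.odd_mul.1 h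
    have ha0 : (x.1 : ℝ) ≠ 0 := by exact_mod_cast ha.pos.ne'
    have hb0 : (x.2 : ℝ) ≠ 0 := by exact_mod_cast hb.pos.ne'
    rw [if_pos hb, fA, gg, if_pos ha]
    push_cast
    field_simp
  · refine Finset.sum_eq_zero fun x hx => ?_
    obtain ⟨hx, -⟩ := Nat.mem_divisorsAntidiagonal.1 hx
    rw [← hx, Nat.odd_mul, not_and_or] at h
    rcases h with h | h
    · simp [fA, gg, h]
    · simp [h]

lemma main_id (N : ℕ) :
    (∑ m ∈ (Finset.Icc 1 N).filter (fun m => Odd m), (Nat.totient m : ℝ) / (m : ℝ) ^ 2) =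
    ∑ d ∈ Finset.Ioc 0 N, fA d * ((harmonic (N/d) : ℝ) - (1/2) * (harmonic (N/(2*d)) : ℝ)) := by
  rw [Finset.sum_filter]
  have : Finset.Icc 1 N = Finset.Ioc 0 N := by ext; simp [Nat.succ_le_iff]
  rw [this]
  have h := ArithmeticFunction.sum_Ioc_mul_eq_sum_sum aF aG N
  rw [← Finset.sum_congr rfl (fun n hn => aF_mul_aG n (Finset.mem_Ioc.1 hn).1), h]
  refine Finset.sum_congr rfl fun d _ => ?_
  simp only [aF, aG, ArithmeticFunction.coe_mk]
  rw [oddH_eq, Nat.div_div_eq_div_mul, mul_comm d 2]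

lemma harm_bound (N d : ℕ) (hN : 0 < N) (hd : 0 < d) (h : d ≤ 2 * N) :
    |(harmonic (N/d) : ℝ) - (Real.log N - Real.log d) - Real.eulerMascheroniConstant|
      ≤ 2 * d / N := by
  have hNr : (0:ℝ) < N := by exact_mod_cast hN
  have hdr : (0:ℝ) < d := by exact_mod_cast hd
  rw [← Real.log_div hNr.ne' hdr.ne']
  have g1 := Real.one_half_lt_eulerMascheroniConstant
  have g2 := Real.eulerMascheroniConstant_lt_two_thirds
  rcases Nat.eq_zero_or_pos (N/d) with h0 | h0
  · rw [h0, harmonic_zero]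
    have h1 : N < d := by
      rcases Nat.div_eq_zero_iff.1 h0 with h | h <;> omega
    have h1r : (N:ℝ) < d := by exact_mod_cast h1
    have hr : (d:ℝ) ≤ 2 * N := by exact_mod_cast h
    have l1 : Real.log ((N:ℝ)/d) ≤ 0 := Real.log_nonpos (by positivity) (by rw [div_le_one hdr]; exact h1r.le)
    have l2 : -Real.log 2 ≤ Real.log ((N:ℝ)/d) := by
      rw [← Real.log_inv]
      apply Real.log_le_log (by norm_num)
      rw [le_div_iff₀ hdr]; linarith
    have l3 := Real.log_two_lt_d9
    have l4 : (2:ℝ) ≤ 2 * d / N := by rw [le_div_iff₀ hNr]; linarith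
    rw [abs_le]; push_cast; constructor <;> linarith
  · set n := N/d with hn
    have hnr : (0:ℝ) < n := by exact_mod_cast h0
    have b1 : (n:ℝ) ≤ (N:ℝ)/d := Nat.cast_div_le
    have b2 : (N:ℝ)/d ≤ n + 1 := by
      rw [div_le_iff₀ hdr]
      have := Nat.lt_div_mul_add (a := N) hd
      have h3 : N ≤ (n+1) * d := by rw [hn]; nlinarith
      exact_mod_cast h3
    have l1 := Real.log_le_log hnr b1
    have l2 := Real.log_le_log (hnr.trans_le b1) b2
    have e1 := Real.eulerMascheroniSeq_lt_eulerMascheroniConstant n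
    have e2 := Real.eulerMascheroniConstant_lt_eulerMascheroniSeq' n
    rw [Real.eulerMascheroniSeq] at e1
    rw [Real.eulerMascheroniSeq', if_neg h0.ne'] at e2
    have l3 : Real.log (n+1) - Real.log n ≤ 1 / n := by
      rw [← Real.log_div (by positivity) hnr.ne']
      have := Real.log_le_sub_one_of_pos (x := ((n:ℝ)+1)/n) (by positivity)
      refine this.trans (le_of_eq ?_)
      field_simp; ring
    have l4 : 1 / (n:ℝ) ≤ 2 * d / N := by
      rw [div_le_div_iff₀ hnr hNr]
      rw [div_le_iff₀ hdr] at b2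
      have : (1:ℝ) ≤ n := by exact_mod_cast h0
      nlinarith
    rw [abs_le]; constructor <;> linarith

lemma odd_bound (N d : ℕ) (hN : 0 < N) (hd : 0 < d) (h : d ≤ N) :
    |((harmonic (N/d) : ℝ) - (1/2) * (harmonic (N/(2*d)) : ℝ)) -
      ((Real.log N + Real.eulerMascheroniConstant + Real.log 2) / 2 - Real.log d / 2)|
      ≤ 4 * d / N := by
  have h1 := harm_bound N d hN hd (by omega)
  have h2 := harm_bound N (2*d) hN (by omega) (by omega)
  have hdr : (d:ℝ) ≠ 0 := by exact_mod_cast hd.ne'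
  rw [Nat.cast_mul, Nat.cast_ofNat, Real.log_mul (by norm_num) hdr] at h2
  have e1 : 2 * (2 * (d:ℝ)) / N = 2 * (2 * d / N) := by ring
  have e2 : 4 * (d:ℝ) / N = 2 * (2 * d / N) := by ring
  rw [e1] at h2
  rw [e2]
  rw [abs_le] at *
  constructor <;> linarith [h1.1, h1.2, h2.1, h2.2]

lemma tail_bound (f u : ℕ → ℝ) (S : ℝ) (N : ℕ) (hf : HasSum f S) (f0 : f 0 = 0) (hu : ∀ n, 0 ≤ u n)
    (hb : ∀ d, N ≤ d → |f (d+1)| ≤ u d - u (d+1)) :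
    |S - ∑ d ∈ Finset.Ioc 0 N, f d| ≤ u N := by
  have hr : ∀ M, ∑ d ∈ Finset.Ioc 0 M, f d = ∑ d ∈ Finset.range (M+1), f d := by
    intro M
    induction M with
    | zero => simp [f0]
    | succ M ih => rw [Finset.sum_Ioc_succ_top (Nat.zero_le M), ih, Finset.sum_range_succ _ (M+1)]
  have ht : Filter.Tendsto (fun M => |∑ d ∈ Finset.range (M+1), f d - ∑ d ∈ Finset.Ioc 0 N, f d|)
      Filter.atTop (nhds |S - ∑ d ∈ Finset.Ioc 0 N, f d|) :=
    (((Filter.tendsto_add_atTop_iff_nat 1).2 hf.tendsto_sum_nat).sub_const _).abs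
  refine le_of_tendsto ht ?_
  filter_upwards [Filter.eventually_ge_atTop N] with M hM
  suffices h : |∑ d ∈ Finset.range (M+1), f d - ∑ d ∈ Finset.Ioc 0 N, f d| ≤ u N - u M by
    linarith [hu M]
  induction M, hM using Nat.le_induction with
  | base => rw [hr]; simp
  | succ M hM ih =>
    rw [Finset.sum_range_succ]
    have := hb M hM
    have h3 := abs_add_le (∑ d ∈ Finset.range (M+1), f d - ∑ d ∈ Finset.Ioc 0 N, f d) (f (M+1))
    rw [show ∑ d ∈ Finset.range (M+1), f d - ∑ d ∈ Finset.Ioc 0 N, f d + f (M+1) =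
      ∑ d ∈ Finset.range (M+1), f d + f (M+1) - ∑ d ∈ Finset.Ioc 0 N, f d by ring] at h3
    linarith

lemma tailA (N : ℕ) (hN : 1 ≤ N) (S : ℝ) (hS : HasSum fA S) :
    |S - ∑ d ∈ Finset.Ioc 0 N, fA d| ≤ 1 / N := by
  refine tail_bound fA (fun n => 1 / (n:ℝ)) S N hS (by simp [fA]) (fun n => by positivity) ?_
  intro d hd
  have hd0 : (0:ℝ) < d := by exact_mod_cast (by omega : 0 < d)
  rw [fA, abs_div, abs_of_nonneg (a := ((d+1 : ℕ) : ℝ)^2) (by positivity)]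
  push_cast
  calc |gg (d+1)| / ((d:ℝ)+1)^2 ≤ 1 / ((d:ℝ)+1)^2 := by gcongr; exact abs_gg_le _
    _ ≤ 1 / ((d:ℝ) * (d+1)) := by gcongr; nlinarith
    _ = _ := by field_simp; ring

lemma tailB (N : ℕ) (hN : 1 ≤ N) (S : ℝ) (hS : HasSum fB S) :
    |S - ∑ d ∈ Finset.Ioc 0 N, fB d| ≤ (Real.log N + 2) / N := by
  refine tail_bound fB (fun n => (Real.log n + 2) / (n:ℝ)) S N hS (by simp [fB])
    (fun n => div_nonneg (by have := Real.log_natCast_nonneg n; linarith) (by positivity)) ?_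
  intro d hd
  have hd1 : (1:ℝ) ≤ d := by exact_mod_cast (by omega : 1 ≤ d)
  have hd0 : (0:ℝ) < d := by linarith
  have hl : 0 ≤ Real.log ((d:ℝ)+1) := Real.log_nonneg (by linarith)
  rw [fB, abs_div, abs_mul, abs_of_nonneg (a := ((d+1 : ℕ) : ℝ)^2) (by positivity)]
  push_cast
  rw [abs_of_nonneg hl]
  have l3 : d * (Real.log (d+1) - Real.log d) ≤ 1 := by
    rw [← Real.log_div (by positivity) hd0.ne']
    have := Real.log_le_sub_one_of_pos (x := ((d:ℝ)+1)/d) (by positivity)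
    have h2 : ((d:ℝ)+1)/d - 1 = 1/d := by field_simp; ring
    rw [h2, le_div_iff₀ hd0] at this
    linarith
  have l4 : Real.log (d+1) - Real.log d ≤ 1 := by
    have : 0 ≤ Real.log (d+1) - Real.log d := sub_nonneg.2 (Real.log_le_log hd0 (by linarith))
    nlinarith
  calc |gg (d+1)| * Real.log ((d:ℝ)+1) / ((d:ℝ)+1)^2
      ≤ 1 * Real.log ((d:ℝ)+1) / ((d:ℝ)+1)^2 := by gcongr; exact abs_gg_le _
    _ ≤ 1 * Real.log ((d:ℝ)+1) / ((d:ℝ) * (d+1)) := by gcongr; nlinarith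
    _ ≤ (Real.log (d+1) + 2 - (d+1) * (Real.log (d+1) - Real.log d)) / ((d:ℝ) * (d+1)) := by
        gcongr; nlinarith
    _ = _ := by field_simp; ring

lemma err_bound (N : ℕ) (hN : 1 ≤ N) :
    |∑ d ∈ Finset.Ioc 0 N, fA d * ((harmonic (N/d) : ℝ) - (1/2) * (harmonic (N/(2*d)) : ℝ)) -
      ((Real.log N + Real.eulerMascheroniConstant + Real.log 2) / 2 * ∑ d ∈ Finset.Ioc 0 N, fA d
        - (∑ d ∈ Finset.Ioc 0 N, fB d) / 2)| ≤ 4 * (1 + Real.log N) / N := by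
  have hNr : (0:ℝ) < N := by exact_mod_cast hN
  rw [Finset.mul_sum, Finset.sum_div, ← Finset.sum_sub_distrib, ← Finset.sum_sub_distrib]
  have hh : ∑ d ∈ Finset.Ioc 0 N, (4 / (N:ℝ)) * (d:ℝ)⁻¹ ≤ 4 * (1 + Real.log N) / N := by
    rw [← Finset.mul_sum]
    have := harmonic_le_one_add_log N
    rw [harmonic_eq_sum_Icc] at this
    have e : Finset.Icc 1 N = Finset.Ioc 0 N := by ext; simp [Nat.succ_le_iff]
    rw [e] at this
    push_cast at this
    calc _ ≤ 4 / (N:ℝ) * (1 + Real.log N) := by gcongr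
      _ = _ := by ring
  refine (Finset.abs_sum_le_sum_abs _ _).trans (le_trans (Finset.sum_le_sum fun d hd => ?_) hh)
  obtain ⟨h1, h2⟩ := Finset.mem_Ioc.1 hd
  have hd0 : (0:ℝ) < d := by exact_mod_cast h1
  have hb := odd_bound N d hN h1 h2
  have e : fA d * ((harmonic (N/d) : ℝ) - (1/2) * (harmonic (N/(2*d)) : ℝ)) -
      ((Real.log N + Real.eulerMascheroniConstant + Real.log 2) / 2 * fA d - fB d / 2) =
      fA d * (((harmonic (N/d) : ℝ) - (1/2) * (harmonic (N/(2*d)) : ℝ)) -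
      ((Real.log N + Real.eulerMascheroniConstant + Real.log 2) / 2 - Real.log d / 2)) := by
    simp only [fA, fB]; ring
  rw [e, abs_mul]
  have hA : |fA d| ≤ 1 / (d:ℝ)^2 := by
    rw [fA, abs_div, abs_of_nonneg (a := (d:ℝ)^2) (by positivity)]
    gcongr; exact abs_gg_le _
  calc _ ≤ 1 / (d:ℝ)^2 * (4 * d / N) := by gcongr
    _ = _ := by field_simp

theorem stmt18 : ∃ C > (0 : ℝ), ∀ N : ℕ, 2 ≤ N →
    |(∑ m ∈ (Finset.Icc 1 N).filter (fun m => Odd m), (Nat.totient m : ℝ) / (m : ℝ) ^ 2) -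
        2 / (3 * (Real.pi ^ 2 / 6)) *
          (Real.log N + Real.eulerMascheroniConstant + 2 * Real.log 2 / 3 -
            (deriv riemannZeta 2).re / (Real.pi ^ 2 / 6))|
      ≤ C * (Real.log N) ^ 2 / N := by
  refine ⟨34, by norm_num, fun N hN => ?_⟩
  have hNr : (0:ℝ) < N := by exact_mod_cast (by omega : 0 < N)
  rw [main_id]
  have hE := err_bound N (by omega)
  have hA := tailA N (by omega) _ hasSum_fA
  have hB := tailB N (by omega) _ hasSum_fB
  have g1 := Real.one_half_lt_eulerMascheroniConstant
  have g2 := Real.eulerMascheroniConstant_lt_two_thirds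
  have l2 := Real.log_two_lt_d9
  have l2' := Real.log_two_gt_d9
  have hL : Real.log 2 ≤ Real.log N := Real.log_le_log (by norm_num) (by exact_mod_cast hN)
  set T := ∑ d ∈ Finset.Ioc 0 N, fA d * ((harmonic (N/d) : ℝ) - (1/2) * (harmonic (N/(2*d)) : ℝ))
  set SA := ∑ d ∈ Finset.Ioc 0 N, fA d
  set SB := ∑ d ∈ Finset.Ioc 0 N, fB d
  set L := Real.log N
  set z := (deriv riemannZeta 2).re
  set K := (L + Real.eulerMascheroniConstant + Real.log 2) / 2 with hK
  set A := (4/3) / (Real.pi^2/6) with hAdef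
  have e0 : 2 / (3 * (Real.pi ^ 2 / 6)) = A / 2 := by rw [hAdef]; field_simp; norm_num
  rw [e0]
  set Z := z / (Real.pi^2/6)
  have e : T - A / 2 * (L + Real.eulerMascheroniConstant + 2 * Real.log 2 / 3 - Z) =
      (T - (K * SA - SB / 2)) + (-(K * (A - SA)) + (A * (Z + Real.log 2 / 3) - SB) / 2) := by
    rw [hK]; ring
  rw [e]
  have hK0 : 0 ≤ K := by rw [hK]; linarith
  have hK1 : K ≤ L / 2 + 1 := by rw [hK]; linarith
  have t1 : |K * (A - SA)| ≤ (L / 2 + 1) * (1 / N) := by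
    rw [abs_mul, abs_of_nonneg hK0]; gcongr
  have t2 : |(A * (Z + Real.log 2 / 3) - SB) / 2| ≤ (L + 2) / N / 2 := by
    rw [abs_div, abs_of_pos (by norm_num : (0:ℝ) < 2)]; gcongr
  refine (abs_add_le _ _).trans ((add_le_add hE ((abs_add_le _ _).trans (add_le_add ((abs_neg _).trans_le t1) t2))).trans ?_)
  have : 4 * (1 + L) / N + ((L / 2 + 1) * (1 / N) + (L + 2) / N / 2) = (6 + 5 * L) / N := by
    field_simp; ring
  rw [this]
  gcongr
  nlinarith
end
end
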